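/- Let G be a finite group whose character graph Δ(G) is K₄-free with exactly seven vertices, and let M be a normal subgroup of G with R(G) < M such that S := M/R(G) ≅ PSL₂(q) for an odd prime power q, the centralizer of M/R(G) in G/R(G) is trivial, the complement of the induced subgraph of Δ(G) on π(S) is not bipartite, and every vertex set of an odd cycle in the complement of Δ(G) is contained in π(S). Then it is impossible that both π(q − 1) \ {2} and π(q + 1) \ {2} have exactly one element (i.e. Δ(S) is not isomorphic to ((K₁ ∪ K₁) ⋆ K₁) ∪ K₁). -/

import Mathlib

open CategoryTheory

/-- `cd(G)`: the set of character degrees of `G`, i.e. the dimensions of the simple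
finite-dimensional complex representations of `G`. -/
def charDegrees (G : Type) [Group G] : Set ℕ :=
  { n | ∃ V : FDRep ℂ G, Simple V ∧ Module.finrank ℂ V = n }

/-- `ρ(G)`: the set of primes dividing some character degree of `G`. -/
def charPrimes (G : Type) [Group G] : Set ℕ :=
  { p | p.Prime ∧ ∃ n ∈ charDegrees G, p ∣ n }

/-- The character graph `Δ(G)`, on vertex set `ρ(G)`: two distinct primes `p`, `q`
are adjacent iff `p * q` divides some character degree of `G`. -/
def charGraph (G : Type) [Group G] : SimpleGraph (charPrimes G) where
  Adj p q := (p : ℕ) ≠ (q : ℕ) ∧ ∃ n ∈ charDegrees G, (p : ℕ) * (q : ℕ) ∣ n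
  symm := by
    constructor
    rintro p q ⟨h, n, hn, hd⟩
    exact ⟨fun e => h e.symm, n, hn, by rwa [mul_comm]⟩
  loopless := by constructor; rintro p ⟨h, -⟩; exact h rfl

/-- The solvable radical `R(G)` of `G`: the largest solvable normal subgroup of `G`
(realized as the join of all solvable normal subgroups). -/
def solvableRadical (G : Type*) [Group G] : Subgroup G :=
  ⨆ N : { N : Subgroup G // N.Normal ∧ IsSolvable ↥N }, (N : Subgroup G)

instance solvableRadical_normal (G : Type*) [Group G] : (solvableRadical G).Normal := by
  constructor
  intro n hn g
  refine Subgroup.iSup_induction (C := fun x => g * x * g⁻¹ ∈ solvableRadical G)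
    (fun N : { N : Subgroup G // N.Normal ∧ IsSolvable ↥N } => (N : Subgroup G)) hn ?_ ?_ ?_
  · intro N x hx
    exact Subgroup.mem_iSup_of_mem N (N.2.1.conj_mem x hx g)
  · simpa using Subgroup.one_mem _
  · intro x y hx hy
    have h : g * (x * y) * g⁻¹ = (g * x * g⁻¹) * (g * y * g⁻¹) := by group
    rw [h]; exact Subgroup.mul_mem _ hx hy

/-- `PSL₂(F)`: the special linear group `SL₂(F)` modulo its center. -/
abbrev PSL2 (F : Type) [Field F] :=
  Matrix.SpecialLinearGroup (Fin 2) F ⧸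
    Subgroup.center (Matrix.SpecialLinearGroup (Fin 2) F)

/-- The join `Γ ⋆ Δ` of two simple graphs: the disjoint union together with all
edges between the two vertex sets. -/
def graphJoin {α β : Type*} (G : SimpleGraph α) (H : SimpleGraph β) :
    SimpleGraph (α ⊕ β) :=
  (G ⊕g H) ⊔
    { Adj := fun u v => u.isLeft ≠ v.isLeft
      symm := ⟨fun _ _ h => h.symm⟩
      loopless := ⟨fun _ h => h rfl⟩ }

/-- The image of a subgroup `M` of `G` in `G/R(G)`; when `R(G) ≤ M` this is `M/R(G)`. -/
def radicalQuotImage {G : Type*} [Group G] (M : Subgroup G) :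
    Subgroup (G ⧸ solvableRadical G) :=
  M.map (QuotientGroup.mk' (solvableRadical G))

theorem mem_cd_iff {G : Type} [Group G] [Finite G] (d : ℕ) : d ∈ charDegrees G ↔
    ∃ (V : Type) (_ : AddCommGroup V) (_ : Module ℂ V) (_ : FiniteDimensional ℂ V)
      (ρ : Representation ℂ G V), Module.finrank ℂ V = d ∧ 0 < d ∧
      ∀ T : V →ₗ[ℂ] V, (∀ g, T ∘ₗ ρ g = ρ g ∘ₗ T) → ∃ c : ℂ, T = c • LinearMap.id := by
  have key : ∀ V : FDRep ℂ G, Simple V ↔ (0 < Module.finrank ℂ V ∧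
      ∀ T : V →ₗ[ℂ] V, (∀ g, T ∘ₗ V.ρ g = V.ρ g ∘ₗ T) → ∃ c : ℂ, T = c • LinearMap.id) := by
    intro V
    have : NeZero (Nat.card G : ℂ) := ⟨by exact_mod_cast Nat.card_pos.ne'⟩
    rw [FDRep.simple_iff_end_is_rank_one, ← (FDRep.forget₂HomLinearEquiv V V).finrank_eq]
    constructor
    · intro h
      have hpos : 0 < Module.finrank ℂ V := by
        by_contra h0
        have h0 : Module.finrank ℂ V = 0 := by omega
        have : Subsingleton V := Module.finrank_zero_iff.mp h0
        have : Subsingleton ((forget₂ (FDRep ℂ G) (Rep ℂ G)).obj V ⟶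
          (forget₂ (FDRep ℂ G) (Rep ℂ G)).obj V) := by
          constructor
          intro a b
          ext x
          exact this.elim _ _
        have := Module.finrank_zero_of_subsingleton (R := ℂ) (M := ((forget₂ (FDRep ℂ G) (Rep ℂ G)).obj V ⟶
          (forget₂ (FDRep ℂ G) (Rep ℂ G)).obj V))
        omega
      refine ⟨hpos, ?_⟩
      intro T hT
      have hne : Nontrivial V := Module.nontrivial_of_finrank_pos hpos
      have h1 : (𝟙 ((forget₂ (FDRep ℂ G) (Rep ℂ G)).obj V)) ≠ 0 := by
        intro h0
        obtain ⟨x, hx⟩ := exists_ne (0 : V)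
        apply hx
        have := congrArg (fun f => f.hom x) h0
        exact this
      obtain ⟨c, hc⟩ := (finrank_eq_one_iff_of_nonzero' _ h1).mp h (Rep.ofHom ⟨T, hT⟩)
      refine ⟨c, ?_⟩
      ext x
      have := congrArg (fun f => f.hom x) hc
      exact this.symm
    · rintro ⟨hpos, hT⟩
      have hne : Nontrivial V := Module.nontrivial_of_finrank_pos hpos
      refine finrank_eq_one_iff'.mpr ⟨𝟙 _, ?_, ?_⟩
      · intro h0
        obtain ⟨x, hx⟩ := exists_ne (0 : V)
        apply hx
        have := congrArg (fun f => f.hom x) h0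
        exact this
      · intro w
        obtain ⟨c, hc⟩ := hT w.hom.toLinearMap (fun g => w.hom.2 g)
        refine ⟨c, ?_⟩
        ext x
        exact (LinearMap.congr_fun hc x).symm
  constructor
  · rintro ⟨V, hV, rfl⟩
    obtain ⟨h1, h2⟩ := (key V).mp hV
    exact ⟨V, inferInstance, inferInstance, inferInstance, V.ρ, rfl, h1, h2⟩
  · rintro ⟨V, _, _, _, ρ, rfl, h1, h2⟩
    exact ⟨FDRep.of ρ, (key _).mpr ⟨h1, h2⟩, rfl⟩

/-- T1': quotients -/
theorem cd_of_surj {G H : Type} [Group G] [Group H] [Finite G] [Finite H] (φ : G →* H)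
    (hφ : Function.Surjective φ) {d : ℕ} (hd : d ∈ charDegrees H) : d ∈ charDegrees G := by
  rw [mem_cd_iff] at hd ⊢
  obtain ⟨V, i1, i2, i3, ρ, h1, h2, h3⟩ := hd
  refine ⟨V, i1, i2, i3, ρ.comp φ, h1, h2, fun T hT => h3 T fun g => ?_⟩
  obtain ⟨x, rfl⟩ := hφ g
  exact hT x

structure Wed (A : Type) [Ring A] [Algebra ℂ A] where
  n : ℕ
  d : Fin n → ℕ
  hd : ∀ i, NeZero (d i)
  Φ : A ≃ₐ[ℂ] ∀ i : Fin n, Matrix (Fin (d i)) (Fin (d i)) ℂ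

namespace Wed
variable {A : Type} [Ring A] [Algebra ℂ A] (W : Wed A)
instance (i : Fin W.n) : NeZero (W.d i) := W.hd i
def M (i : Fin W.n) : A →ₐ[ℂ] Matrix (Fin (W.d i)) (Fin (W.d i)) ℂ :=
  (Pi.evalAlgHom ℂ (fun i : Fin W.n => Matrix (Fin (W.d i)) (Fin (W.d i)) ℂ) i).comp
    W.Φ.toAlgHom
def chi (i : Fin W.n) : A →ₗ[ℂ] ℂ := Matrix.traceLinearMap _ ℂ ℂ ∘ₗ (W.M i).toLinearMap
noncomputable def E (i : Fin W.n) (k l : Fin (W.d i)) : A :=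
  W.Φ.symm (Pi.single i (Matrix.single k l 1))
noncomputable def eps (i : Fin W.n) : A := W.Φ.symm (Pi.single i 1)
noncomputable def f (i : Fin W.n) : A := W.E i 0 0

lemma chi_def (i) (a : A) : W.chi i a = (W.M i a).trace := rfl
lemma ext' {a b : A} (h : ∀ i, W.M i a = W.M i b) : a = b :=
  W.Φ.injective (funext h)
lemma M_E (i) (k l) : W.M i (W.E i k l) = Matrix.single k l 1 := by simp [M, E]
lemma M_E_ne {i j} (h : j ≠ i) (k l) : W.M j (W.E i k l) = 0 := by simp [M, E, h]
lemma M_eps (i) : W.M i (W.eps i) = 1 := by simp [M, eps]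
lemma M_eps_ne {i j} (h : j ≠ i) : W.M j (W.eps i) = 0 := by simp [M, eps, h]
lemma M_f (i) : W.M i (W.f i) = Matrix.single 0 0 1 := W.M_E i 0 0
lemma M_f_ne {i j} (h : j ≠ i) : W.M j (W.f i) = 0 := W.M_E_ne h 0 0
lemma M_surj (i) (X) : ∃ a, W.M i a = X := ⟨W.Φ.symm (Pi.single i X), by simp [M]⟩
lemma chi_mul_comm (i) (a b : A) : W.chi i (a * b) = W.chi i (b * a) := by
  simp only [chi_def, map_mul]; exact Matrix.trace_mul_comm _ _
lemma chi_one (i) : W.chi i 1 = W.d i := by simp [chi_def]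
lemma chi_f (i) : W.chi i (W.f i) = 1 := by simp [chi_def, M_f]
lemma chi_f_ne {i j} (h : j ≠ i) : W.chi j (W.f i) = 0 := by simp [chi_def, M_f_ne _ h]
lemma eps_comm (i) (a : A) : W.eps i * a = a * W.eps i := by
  apply W.ext'; intro j
  by_cases h : j = i
  · subst h; simp [M_eps]
  · simp [M_eps_ne _ h]
lemma eps_idem (i) : W.eps i * W.eps i = W.eps i := by
  apply W.ext'; intro j
  by_cases h : j = i
  · subst h; simp [M_eps]
  · simp [M_eps_ne _ h]
lemma f_idem (i) : W.f i * W.f i = W.f i := by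
  apply W.ext'; intro j
  by_cases h : j = i
  · subst h; simp [M_f]
  · simp [M_f_ne _ h]
lemma eps_f (i) : W.eps i * W.f i = W.f i := by
  apply W.ext'; intro j
  by_cases h : j = i
  · subst h; simp [M_eps]
  · simp [M_f_ne _ h]
lemma f_ne (i) : W.f i ≠ 0 := by
  intro h; have := W.chi_f i; rw [h] at this; simp at this
lemma f_prim (i) (a : A) : W.f i * a * W.f i = (W.M i a 0 0) • W.f i := by
  apply W.ext'; intro j
  by_cases h : j = i
  · subst h; simp [M_f]
  · simp [M_f_ne _ h]
lemma sum_eps : ∑ i, W.eps i = 1 := by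
  apply W.ext'; intro j
  rw [map_sum, Finset.sum_eq_single j]
  · simp [M_eps]
  · intro b _ hb; exact W.M_eps_ne hb.symm
  · simp
lemma central_scalar {z : A} (hz : ∀ a, z * a = a * z) (i) : ∃ c : ℂ, W.M i z = c • 1 := by
  have : W.M i z ∈ Set.center (Matrix (Fin (W.d i)) (Fin (W.d i)) ℂ) := by
    rw [Semigroup.mem_center_iff]
    intro g
    obtain ⟨a, rfl⟩ := W.M_surj i g
    rw [← map_mul, ← map_mul, hz]
  rw [Matrix.center_eq_range] at this
  obtain ⟨c, hc⟩ := this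
  exact ⟨c, by rw [← hc]; simp [Matrix.smul_one_eq_diagonal]⟩
lemma central_idem {z : A} (hz : ∀ a, z * a = a * z) (h2 : z * z = z) (i) :
    W.M i z = 0 ∨ W.M i z = 1 := by
  obtain ⟨c, hc⟩ := W.central_scalar hz i
  have h3 : W.M i z * W.M i z = W.M i z := by rw [← map_mul, h2]
  rw [hc] at h3 ⊢
  have h4 := congrFun (congrFun h3 0) 0
  have h5 : c * (c - 1) = 0 := by
    simp at h4
    linear_combination h4
  rcases mul_eq_zero.mp h5 with h | h
  · left; rw [h]; simp
  · right; rw [sub_eq_zero.mp h]; simp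
lemma eps_min {z : A} (hz : ∀ a, z * a = a * z) (h2 : z * z = z) (i) :
    W.eps i * z = 0 ∨ W.eps i * z = W.eps i := by
  rcases W.central_idem hz h2 i with h | h
  · left
    apply W.ext'; intro j
    by_cases hj : j = i
    · subst hj; simp [h]
    · simp [M_eps_ne _ hj]
  · right
    apply W.ext'; intro j
    by_cases hj : j = i
    · subst hj; simp [h]
    · simp [M_eps_ne _ hj]
lemma trl_eps (i) (ℓ : A →ₗ[ℂ] ℂ) (hℓ : ∀ a b, ℓ (a * b) = ℓ (b * a)) :
    ℓ (W.eps i) = W.d i * ℓ (W.f i) := by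
  have h1 : W.eps i = ∑ k, W.E i k 0 * W.E i 0 k := by
    apply W.ext'; intro j
    by_cases hj : j = i
    · subst hj
      simp only [M_eps, map_sum, map_mul, M_E]
      ext a b
      simp only [Matrix.single_mul_single_same, mul_one, Matrix.sum_apply, Matrix.one_apply,
        Matrix.single_apply]
      by_cases h : a = b
      · subst h; simp
      · rw [if_neg h, Finset.sum_eq_zero]; intro x _; rw [if_neg]; rintro ⟨rfl, rfl⟩; exact h rfl
    · simp [M_eps_ne _ hj, M_E_ne _ hj]
  have h2 : ∀ k, W.E i 0 k * W.E i k 0 = W.f i := by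
    intro k
    apply W.ext'; intro j
    by_cases hj : j = i
    · subst hj; simp [M_f, M_E]
    · simp [M_f_ne _ hj, M_E_ne _ hj]
  rw [h1, map_sum, Finset.sum_congr rfl (fun k _ => (hℓ _ _).trans (by rw [h2]))]
  simp
lemma idem_nat {e : A} (he : e * e = e) (i) : ∃ m : ℕ, W.chi i e = m := by
  have h3 : IsIdempotentElem (Matrix.toLin' (W.M i e)) := by
    rw [IsIdempotentElem, Module.End.mul_eq_comp, ← Matrix.toLin'_mul, ← map_mul, he]
  refine ⟨Module.finrank ℂ (LinearMap.range (Matrix.toLin' (W.M i e))), ?_⟩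
  rw [chi_def, ← Matrix.trace_toLin'_eq]
  exact (LinearMap.IsIdempotentElem.isProj_range _ h3).trace
lemma idem_zero {e : A} (he : e * e = e) {i} (h0 : W.chi i e = 0) : W.M i e = 0 := by
  have h3 : IsIdempotentElem (Matrix.toLin' (W.M i e)) := by
    rw [IsIdempotentElem, Module.End.mul_eq_comp, ← Matrix.toLin'_mul, ← map_mul, he]
  rw [chi_def, ← Matrix.trace_toLin'_eq] at h0
  have := LinearMap.IsIdempotentElem.eq_zero_of_trace_eq_zero h3 h0
  simpa using this
lemma idem_exists {e : A} (he : e * e = e) (h0 : e ≠ 0) : ∃ i, W.chi i e ≠ 0 := by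
  by_contra! h
  exact h0 (W.ext' fun i => by rw [W.idem_zero he (h i), map_zero])
noncomputable def basis : Module.Basis (Σ i : Fin W.n, Fin (W.d i) × Fin (W.d i)) ℂ A :=
  (Pi.basis fun i => Matrix.stdBasis ℂ (Fin (W.d i)) (Fin (W.d i))).map W.Φ.symm.toLinearEquiv
lemma trace_two (x y : A) : LinearMap.trace ℂ A (LinearMap.mulLeft ℂ x ∘ₗ LinearMap.mulRight ℂ y)
    = ∑ i, W.chi i x * W.chi i y := by
  rw [LinearMap.trace_eq_matrix_trace ℂ W.basis, Matrix.trace, Fintype.sum_sigma]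
  refine Finset.sum_congr rfl fun i _ => ?_
  rw [Fintype.sum_prod_type, chi_def, chi_def, Matrix.trace, Matrix.trace, Finset.sum_mul_sum]
  refine Finset.sum_congr rfl fun k _ => Finset.sum_congr rfl fun l _ => ?_
  have hb : W.basis ⟨i, k, l⟩ = W.E i k l := by
    simp [basis, E, Pi.basis_apply, Matrix.stdBasis_eq_single]
  rw [Matrix.diag_apply, LinearMap.toMatrix_apply, hb]
  have : ∀ a, W.basis.repr a ⟨i, k, l⟩ = W.M i a k l := by
    intro a
    simp only [basis, Module.Basis.map_repr, LinearEquiv.trans_apply, Pi.basis_repr]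
    rfl
  rw [this]
  simp only [LinearMap.comp_apply, LinearMap.mulLeft_apply, LinearMap.mulRight_apply, map_mul, M_E]
  simp [Matrix.mul_apply, Matrix.single_apply, ite_and]
lemma trace_right (y : A) : LinearMap.trace ℂ A (LinearMap.mulRight ℂ y)
    = ∑ i, W.d i * W.chi i y := by
  have := W.trace_two 1 y
  simp only [chi_one] at this
  rw [← this]
  congr 1
  ext a; simp
lemma fd (W : Wed A) : Module.Finite ℂ A := Module.Finite.of_basis W.basis
lemma prim {e : A} (he : e * e = e) (h0 : e ≠ 0) (hp : ∀ a, ∃ c : ℂ, e * a * e = c • e) :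
    ∃ i, W.chi i e = 1 ∧ (∀ k, k ≠ i → W.chi k e = 0) ∧ W.eps i * e = e := by
  obtain ⟨i, hi⟩ := W.idem_exists he h0
  have := W.fd
  obtain ⟨c, hc⟩ := hp (W.eps i)
  have hc' : W.eps i * e = c • e := by
    rw [← hc, ← W.eps_comm, mul_assoc, he]
  have hMe : W.M i e ≠ 0 := by intro h; exact hi (by rw [chi_def, h]; simp)
  have hc1 : c = 1 := by
    have h1 := congrArg (W.M i) hc'
    rw [map_mul, M_eps, one_mul, map_smul] at h1
    have h2 : (1 - c) • W.M i e = 0 := by rw [sub_smul, one_smul, ← h1, sub_self]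
    rcases smul_eq_zero.mp h2 with h | h
    · linear_combination -h
    · exact absurd h hMe
  rw [hc1, one_smul] at hc'
  have hk : ∀ k, k ≠ i → W.chi k e = 0 := by
    intro k hk
    rw [← hc', chi_def, map_mul, M_eps_ne _ hk]; simp
  refine ⟨i, ?_, hk, hc'⟩
  have ht := W.trace_two e e
  rw [Finset.sum_eq_single i (fun k _ h => by rw [hk k h]; simp) (by simp)] at ht
  choose c hc using hp
  have hinj : Function.Injective (fun z : ℂ => z • e) := smul_left_injective ℂ h0
  let ℓ : A →ₗ[ℂ] ℂ :=
    { toFun := c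
      map_add' := fun a b => hinj (by simp only [← hc, add_smul, mul_add, add_mul])
      map_smul' := fun r a => hinj (by
        simp only [← hc, mul_smul_comm, smul_mul_assoc, smul_eq_mul, mul_smul, RingHom.id_apply]) }
  have hT : LinearMap.mulLeft ℂ e ∘ₗ LinearMap.mulRight ℂ e = ℓ.smulRight e := by
    ext a
    simp only [LinearMap.comp_apply, LinearMap.mulLeft_apply, LinearMap.mulRight_apply,
      LinearMap.smulRight_apply, ← mul_assoc]
    exact hc a
  rw [hT, LinearMap.trace_smulRight] at ht
  have h1 : ℓ e = 1 := hinj (by show c e • e = (1:ℂ) • e; rw [← hc, he, he, one_smul])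
  rw [h1] at ht
  obtain ⟨m, hm⟩ := W.idem_nat he i
  rw [hm] at ht ⊢
  have : 1 = m * m := by exact_mod_cast ht
  have : m = 1 := by nlinarith [Nat.eq_one_of_mul_eq_one_left this.symm]
  simp [this]
lemma f_inv {i} {x : A} (hx : W.f i * x = x) (h0 : x ≠ 0) : ∃ y, x * y = W.f i := by
  have h1 : ∀ j, j ≠ i → W.M j x = 0 := by
    intro j hj; rw [← hx, map_mul, M_f_ne _ hj, zero_mul]
  have h2 : W.M i x ≠ 0 := by
    intro h; apply h0; apply W.ext'; intro j
    by_cases hj : j = i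
    · subst hj; simp [h]
    · simp [h1 j hj]
  have h3 : ∀ a b, W.M i x a b = if a = 0 then W.M i x 0 b else 0 := by
    intro a b
    split_ifs with h
    · rw [h]
    · rw [← hx, map_mul, M_f]
      simp [Matrix.mul_apply, Matrix.single_apply, Ne.symm h]
  obtain ⟨l, hl⟩ : ∃ l, W.M i x 0 l ≠ 0 := by
    by_contra! h
    apply h2; ext a b; rw [h3]; simp [h]
  refine ⟨(W.M i x 0 l)⁻¹ • W.E i l 0, ?_⟩
  apply W.ext'; intro j
  by_cases hj : j = i
  · subst hj
    simp only [map_mul, map_smul, M_E, M_f]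
    ext a b
    simp only [Matrix.mul_apply, Matrix.smul_apply, Matrix.single_apply]
    rw [Finset.sum_eq_single l (by intro k _ hk; simp [Ne.symm hk]) (by simp), h3 a l]
    by_cases ha : a = 0 <;> by_cases hb : b = 0 <;> simp [ha, hb, hl, eq_comm]
  · simp [M_E_ne _ hj, M_f_ne _ hj]
end Wed

open scoped Classical in
theorem exists_wed (G : Type) [Group G] [Finite G] : Nonempty (Wed (MonoidAlgebra ℂ G)) := by
  have : Module.Finite ℂ (MonoidAlgebra ℂ G) := Module.Finite.of_basis (MonoidAlgebra.basis G ℂ)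
  have : NeZero (Nat.card G : ℂ) := ⟨by exact_mod_cast Nat.card_pos.ne'⟩
  obtain ⟨n, d, h, ⟨Φ⟩⟩ :=
    IsSemisimpleRing.exists_algEquiv_pi_matrix_of_isAlgClosed ℂ (MonoidAlgebra ℂ G)
  exact ⟨⟨n, d, h, Φ⟩⟩
noncomputable def wed (G : Type) [Group G] [Finite G] : Wed (MonoidAlgebra ℂ G) :=
  Classical.choice (exists_wed G)
abbrev CA (G : Type) [Group G] := MonoidAlgebra ℂ G
noncomputable def ofG {G : Type} [Group G] : G →* CA G := MonoidAlgebra.of ℂ G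
section
variable {G : Type} [Group G]
lemma ofG_eq (g : G) : ofG g = MonoidAlgebra.single g (1 : ℂ) := rfl
lemma ofG_inv_mul (g : G) : ofG g⁻¹ * ofG g = (1 : CA G) := by rw [← map_mul]; simp
lemma ofG_mul_inv (g : G) : ofG g * ofG g⁻¹ = (1 : CA G) := by rw [← map_mul]; simp
theorem CA_ind {p : CA G → Prop} (x : CA G) (h1 : ∀ g, p (ofG g))
    (h2 : ∀ x y, p x → p y → p (x + y)) (h3 : ∀ (r : ℂ) x, p x → p (r • x)) : p x :=
  MonoidAlgebra.induction_on x h1 h2 h3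
lemma CA_central {z : CA G} (h : ∀ g, ofG g * z = z * ofG g) (a : CA G) : z * a = a * z := by
  induction a using CA_ind with
  | h1 g => exact (h g).symm
  | h2 x y hx hy => rw [mul_add, add_mul, hx, hy]
  | h3 r x hx => rw [mul_smul_comm, smul_mul_assoc, hx]
variable [Finite G]
theorem wed_mem (i : Fin (wed G).n) : (wed G).d i ∈ charDegrees G := by
  rw [mem_cd_iff]
  refine ⟨Fin ((wed G).d i) → ℂ, inferInstance, inferInstance, inferInstance,
    ((Matrix.toLinAlgEquiv' : Matrix (Fin ((wed G).d i)) (Fin ((wed G).d i)) ℂ ≃ₐ[ℂ] _).toAlgHom.toRingHom.toMonoidHom.comp ((wed G).M i).toRingHom.toMonoidHom).comp ofG,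
    by simp, Nat.pos_of_ne_zero (NeZero.ne _), ?_⟩
  intro T hT
  have h1 : ∀ a : CA G, Matrix.toLinAlgEquiv'.symm T * (wed G).M i a =
      (wed G).M i a * Matrix.toLinAlgEquiv'.symm T := by
    intro a
    induction a using CA_ind with
    | h1 g =>
      apply Matrix.toLinAlgEquiv'.injective
      rw [map_mul, map_mul, AlgEquiv.apply_symm_apply]
      exact hT g
    | h2 x y hx hy => rw [map_add, mul_add, add_mul, hx, hy]
    | h3 r x hx => rw [map_smul, mul_smul_comm, smul_mul_assoc, hx]
  have : Matrix.toLinAlgEquiv'.symm T ∈ Set.center (Matrix (Fin ((wed G).d i)) (Fin ((wed G).d i)) ℂ) := by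
    rw [Semigroup.mem_center_iff]
    intro g
    obtain ⟨a, rfl⟩ := (wed G).M_surj i g
    rw [h1]
  rw [Matrix.center_eq_range] at this
  obtain ⟨c, hc⟩ := this
  refine ⟨c, ?_⟩
  have h2 := congrArg Matrix.toLinAlgEquiv' hc
  rw [AlgEquiv.apply_symm_apply] at h2
  rw [← h2]
  ext x y
  simp [Matrix.toLinAlgEquiv'_apply, Pi.single_apply]
theorem cd_exists {d : ℕ} (hd : d ∈ charDegrees G) : ∃ i, (wed G).d i = d := by
  rw [mem_cd_iff] at hd
  obtain ⟨V, i1, i2, i3, ρ, rfl, h2, h3⟩ := hd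
  let W := wed G
  let R : CA G →ₐ[ℂ] Module.End ℂ V := ρ.asAlgebraHom
  have hR : ∀ g, R (ofG g) = ρ g := fun g => ρ.asAlgebraHom_of g
  have hsc : ∀ T : Module.End ℂ V, (∀ a, T * R a = R a * T) → ∃ c : ℂ, T = c • LinearMap.id :=
    fun T hT => h3 T fun g => by have := hT (ofG g); rwa [hR] at this
  have hnt : Nontrivial V := Module.nontrivial_of_finrank_pos h2
  obtain ⟨i, hi⟩ : ∃ i, R (W.eps i) ≠ 0 := by
    by_contra! h
    have : R 1 = 0 := by rw [← W.sum_eps, map_sum]; exact Finset.sum_eq_zero fun i _ => h i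
    rw [map_one] at this
    exact one_ne_zero this
  refine ⟨i, ?_⟩
  have he : R (W.eps i) = 1 := by
    obtain ⟨c, hc⟩ := hsc (R (W.eps i)) fun a => by rw [← map_mul, ← map_mul, W.eps_comm]
    have h4 : R (W.eps i) * R (W.eps i) = R (W.eps i) := by rw [← map_mul, W.eps_idem]
    rw [hc] at h4 hi ⊢
    obtain ⟨v, hv⟩ := exists_ne (0 : V)
    have h5 := LinearMap.congr_fun h4 v
    simp [smul_smul] at h5
    have h6 : (c * c - c) • v = 0 := by rw [sub_smul, h5, sub_self]
    have h7 := (smul_eq_zero.mp h6).resolve_right hv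
    have hc0 : c ≠ 0 := by rintro rfl; simp at hi
    have : c = 1 := by
      have : c * (c - 1) = 0 := by linear_combination h7
      exact sub_eq_zero.mp ((mul_eq_zero.mp this).resolve_left hc0)
    rw [this, one_smul]; rfl
  have htr := W.trl_eps i (LinearMap.trace ℂ V ∘ₗ R.toLinearMap)
    (fun a b => by simp [LinearMap.trace_mul_comm])
  simp only [LinearMap.comp_apply, AlgHom.toLinearMap_apply, he] at htr
  rw [LinearMap.trace_one] at htr
  have hf0 : R (W.f i) ≠ 0 := by
    intro h; rw [h] at htr; simp at htr; omega
  obtain ⟨u, hu⟩ : ∃ u, R (W.f i) u ≠ 0 := by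
    by_contra! h; exact hf0 (LinearMap.ext h)
  set v := R (W.f i) u with hv
  have hff : R (W.f i) * R (W.f i) = R (W.f i) := by rw [← map_mul, W.f_idem]
  have hfv : R (W.f i) v = v := LinearMap.congr_fun hff u
  obtain ⟨ℓ, hℓ⟩ := Module.Projective.exists_dual_ne_zero ℂ hu
  have hprim : ∀ φ : Module.End ℂ V, ∃ c : ℂ, R (W.f i) * φ * R (W.f i) = c • R (W.f i) := by
    intro φ
    obtain ⟨c, hc⟩ := hsc (∑ k, R (W.E i k 0) * φ * R (W.E i 0 k)) (by
      have key : ∀ a k, W.E i 0 k * a = ∑ l, (W.M i a k l) • W.E i 0 l := by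
        intro a k
        apply W.ext'; intro j
        by_cases hj : j = i
        · subst hj
          simp only [map_mul, map_sum, map_smul, W.M_E]
          ext x y
          simp [Matrix.mul_apply, Matrix.sum_apply, Matrix.single_apply, ite_and]
        · simp [W.M_E_ne hj]
      have key2 : ∀ a k, a * W.E i k 0 = ∑ l, (W.M i a l k) • W.E i l 0 := by
        intro a k
        apply W.ext'; intro j
        by_cases hj : j = i
        · subst hj
          simp only [map_mul, map_sum, map_smul, W.M_E]
          ext x y
          simp [Matrix.mul_apply, Matrix.sum_apply, Matrix.single_apply, ite_and]
        · simp [W.M_E_ne hj]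
      intro a
      rw [Finset.sum_mul, Finset.mul_sum]
      have e1 : ∀ k, R (W.E i k 0) * φ * R (W.E i 0 k) * R a =
          ∑ l, W.M i a k l • (R (W.E i k 0) * φ * R (W.E i 0 l)) := by
        intro k
        rw [mul_assoc, ← map_mul, key, map_sum, Finset.mul_sum]
        simp only [map_smul, mul_smul_comm]
      have e2 : ∀ k, R a * (R (W.E i k 0) * φ * R (W.E i 0 k)) =
          ∑ l, W.M i a l k • (R (W.E i l 0) * φ * R (W.E i 0 k)) := by
        intro k
        rw [← mul_assoc, ← mul_assoc, ← map_mul, key2, map_sum, Finset.sum_mul, Finset.sum_mul]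
        simp only [map_smul, smul_mul_assoc]
      simp only [e1, e2]
      rw [Finset.sum_comm])
    refine ⟨c, ?_⟩
    have h9 : R (W.f i) * (∑ k, R (W.E i k 0) * φ * R (W.E i 0 k)) * R (W.f i) =
        R (W.f i) * φ * R (W.f i) := by
      have hz : ∀ k, k ≠ 0 → W.f i * W.E i k 0 = 0 := by
        intro k hk
        apply W.ext'; intro j
        by_cases hj : j = i
        · subst hj; simp [W.M_f, W.M_E, Matrix.single_mul_single_of_ne, Ne.symm hk]
        · simp [W.M_E_ne hj]
      rw [Finset.mul_sum, Finset.sum_mul, Finset.sum_eq_single 0]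
      · show R (W.f i) * (R (W.f i) * φ * R (W.f i)) * R (W.f i) = _
        rw [mul_assoc, mul_assoc, mul_assoc, hff, ← mul_assoc, ← mul_assoc, hff, ]
      · intro k _ hk
        rw [← mul_assoc, ← mul_assoc, ← map_mul, hz k hk]; simp
      · simp
    rw [← h9, hc]
    show R (W.f i) * (c • 1) * R (W.f i) = _
    rw [mul_smul_comm, mul_one, smul_mul_assoc, hff]
  obtain ⟨c, hc⟩ := hprim (ℓ.smulRight v)
  have hcv := LinearMap.congr_fun hc v
  simp [hfv] at hcv
  have hcl : ℓ v = c := by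
    have : (ℓ v - c) • v = 0 := by rw [sub_smul, hcv, sub_self]
    exact sub_eq_zero.mp ((smul_eq_zero.mp this).resolve_right hu)
  have htr2 : LinearMap.trace ℂ V (R (W.f i)) = 1 := by
    have h10 := congrArg (LinearMap.trace ℂ V) hc
    rw [LinearMap.trace_mul_comm, ← mul_assoc, hff, map_smul] at h10
    have h11 : R (W.f i) * ℓ.smulRight v = ℓ.smulRight v := by
      ext x; simp [hfv]
    rw [h11, LinearMap.trace_smulRight, hcl, smul_eq_mul] at h10
    have hc0 : c ≠ 0 := by rw [← hcl]; exact hℓ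
    exact (mul_left_cancel₀ hc0 (by rw [mul_one]; exact h10)).symm
  rw [htr2, mul_one] at htr
  exact_mod_cast htr.symm
open scoped Classical in
lemma trace_right_CA (y : CA G) : LinearMap.trace ℂ (CA G) (LinearMap.mulRight ℂ y) =
    Nat.card G * y.coeff 1 := by
  have := Fintype.ofFinite G
  rw [LinearMap.trace_eq_matrix_trace ℂ (MonoidAlgebra.basis G ℂ), Matrix.trace]
  have : ∀ g : G, (LinearMap.toMatrix (MonoidAlgebra.basis G ℂ) (MonoidAlgebra.basis G ℂ)
    (LinearMap.mulRight ℂ y)).diag g = y.coeff 1 := by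
    intro g
    rw [Matrix.diag_apply, LinearMap.toMatrix_apply, MonoidAlgebra.basis_apply]
    show ((MonoidAlgebra.single g 1 * y).coeff g) = _
    rw [MonoidAlgebra.coeff_single_mul_apply]; simp
  rw [Finset.sum_congr rfl (fun g _ => this g)]
  simp
open scoped Classical in
lemma trace_two_CA (x y : CA G) [Fintype G] :
    LinearMap.trace ℂ (CA G) (LinearMap.mulLeft ℂ x ∘ₗ LinearMap.mulRight ℂ y) =
    ∑ z : G, (x * ofG z * y).coeff z := by
  rw [LinearMap.trace_eq_matrix_trace ℂ (MonoidAlgebra.basis G ℂ), Matrix.trace]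
  refine Finset.sum_congr rfl fun z _ => ?_
  rw [Matrix.diag_apply, LinearMap.toMatrix_apply, MonoidAlgebra.basis_apply, mul_assoc]
  rfl
open scoped Classical in
lemma chi_ortho (g h : G) : ∑ i, (wed G).chi i (ofG g) * (wed G).chi i (ofG h) =
    Nat.card {z : G // g * z * h = z} := by
  have := Fintype.ofFinite G
  rw [← (wed G).trace_two, trace_two_CA]
  simp only [← map_mul]
  simp [ofG_eq, Finsupp.single_apply, Nat.card_eq_fintype_card, Fintype.card_subtype]
theorem deg_prim {e : CA G} (he : e * e = e) (h0 : e ≠ 0)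
    (hp : ∀ a, ∃ c : ℂ, e * a * e = c • e) :
    ∃ i, (wed G).chi i e = 1 ∧ (∀ k, k ≠ i → (wed G).chi k e = 0) ∧ (wed G).eps i * e = e ∧
      ((wed G).d i : ℂ) = Nat.card G * e.coeff 1 := by
  obtain ⟨i, h1, h2, h3⟩ := (wed G).prim he h0 hp
  refine ⟨i, h1, h2, h3, ?_⟩
  rw [← trace_right_CA, (wed G).trace_right, Finset.sum_eq_single i]
  · rw [h1, mul_one]
  · intro k _ hk; rw [h2 k hk, mul_zero]
  · simp
lemma f_coeff (i) : ((wed G).d i : ℂ) = Nat.card G * ((wed G).f i).coeff 1 := by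
  rw [← trace_right_CA, (wed G).trace_right, Finset.sum_eq_single i]
  · rw [Wed.chi_f, mul_one]
  · intro k _ hk; rw [Wed.chi_f_ne _ hk, mul_zero]
  · simp
end

section Clif
variable {G H : Type} [Group G] [Group H] (φ : G →* H)
noncomputable def io : CA φ.ker →ₐ[ℂ] CA G := MonoidAlgebra.mapDomainAlgHom ℂ ℂ φ.ker.subtype
lemma io_of (n : φ.ker) : io φ (ofG n) = ofG (n : G) := by
  simp [io, ofG_eq, MonoidAlgebra.mapDomainAlgHom]
lemma io_inj : Function.Injective (io φ) := by
  have := MonoidAlgebra.mapDomain_injective (R := ℂ) (Subtype.val_injective (p := (· ∈ φ.ker)))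
  exact this
lemma io_coeff_one (a : CA φ.ker) : (io φ a).coeff 1 = a.coeff 1 := by
  induction a using CA_ind with
  | h1 g =>
    rw [io_of, ofG_eq, ofG_eq]
    classical
    simp only [MonoidAlgebra.coeff_single, Finsupp.single_apply, OneMemClass.coe_eq_one]
  | h2 x y hx hy => rw [map_add, MonoidAlgebra.coeff_add, MonoidAlgebra.coeff_add]; simp [hx, hy]
  | h3 r x hx => rw [map_smul, MonoidAlgebra.coeff_smul_apply, MonoidAlgebra.coeff_smul_apply, hx]
noncomputable def cj (g : G) : CA φ.ker →ₐ[ℂ] CA φ.ker :=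
  MonoidAlgebra.mapDomainAlgHom ℂ ℂ (MulAut.conjNormal g : φ.ker ≃* φ.ker).toMonoidHom
lemma io_cj (g : G) (a : CA φ.ker) : io φ (cj φ g a) = ofG g * io φ a * ofG g⁻¹ := by
  induction a using CA_ind with
  | h1 n =>
    have : cj φ g (ofG n) = ofG (MulAut.conjNormal g n) := by
      simp [cj, ofG_eq, MonoidAlgebra.mapDomainAlgHom]
    rw [this, io_of, io_of, ← map_mul, ← map_mul]
    simp
  | h2 x y hx hy => simp only [map_add, hx, hy, mul_add, add_mul]
  | h3 r x hx => simp only [map_smul, hx, mul_smul_comm, smul_mul_assoc]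
lemma cj_inv (g : G) (a : CA φ.ker) : cj φ g (cj φ g⁻¹ a) = a := by
  apply io_inj φ
  rw [io_cj, io_cj, inv_inv, ← mul_assoc, ← mul_assoc, ofG_mul_inv, one_mul, mul_assoc, ofG_mul_inv,
    mul_one]
lemma cj_inv' (g : G) (a : CA φ.ker) : cj φ g⁻¹ (cj φ g a) = a := by
  have := cj_inv φ g⁻¹ a; rwa [inv_inv] at this
lemma of_io (g : G) (a : CA φ.ker) : ofG g * io φ a = io φ (cj φ g a) * ofG g := by
  rw [io_cj, mul_assoc _ (ofG g⁻¹), ofG_inv_mul, mul_one]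
/-- elements supported on a fibre -/
def comp (h : H) : Submodule ℂ (CA G) where
  carrier := {x | ∀ g, φ g ≠ h → x.coeff g = 0}
  zero_mem' := by intro g _; rfl
  add_mem' := by
    intro x y hx hy g hg
    rw [MonoidAlgebra.coeff_add, Finsupp.add_apply, hx g hg, hy g hg, add_zero]
  smul_mem' := by
    intro c x hx g hg
    rw [MonoidAlgebra.coeff_smul_apply, hx g hg, smul_zero]
lemma comp_of (g : G) : ofG g ∈ comp φ (φ g) := by
  classical
  intro g' hg'
  rw [ofG_eq, MonoidAlgebra.coeff_single, Finsupp.single_apply, if_neg]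
  rintro rfl; exact hg' rfl
lemma comp_single (x : CA G) (g : G) :
    (MonoidAlgebra.single g (x.coeff g) : CA G) = x.coeff g • ofG g := by
  rw [ofG_eq, MonoidAlgebra.smul_single, smul_eq_mul, mul_one]
lemma comp_ind {h : H} {p : CA G → Prop} {x : CA G} (hx : x ∈ comp φ h) (h0 : p 0)
    (h1 : ∀ g, φ g = h → p (ofG g))
    (h2 : ∀ x y, p x → p y → p (x + y)) (h3 : ∀ (r : ℂ) x, p x → p (r • x)) : p x := by
  have := MonoidAlgebra.sum_coeff_single x
  rw [← this, Finsupp.sum]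
  refine Finset.sum_induction _ p h2 h0 ?_
  intro g hg
  rw [comp_single]
  apply h3
  apply h1
  by_contra hne
  exact (Finsupp.mem_support_iff.mp hg) (hx g hne)
lemma comp_mul {h h' : H} {x y : CA G} (hx : x ∈ comp φ h) (hy : y ∈ comp φ h') :
    x * y ∈ comp φ (h * h') := by
  refine comp_ind φ (p := fun x => x * y ∈ comp φ (h * h')) hx ?_ ?_ ?_ ?_
  · simp
  · intro g hg
    refine comp_ind φ (p := fun y => ofG g * y ∈ comp φ (h * h')) hy ?_ ?_ ?_ ?_
    · simp
    · intro g' hg'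
      rw [← map_mul, ← hg, ← hg', ← map_mul]
      exact comp_of φ _
    · intro x y hx hy; rw [mul_add]; exact Submodule.add_mem _ hx hy
    · intro r x hx; rw [mul_smul_comm]; exact Submodule.smul_mem _ _ hx
  · intro x y hx hy; rw [add_mul]; exact Submodule.add_mem _ hx hy
  · intro r x hx; rw [smul_mul_assoc]; exact Submodule.smul_mem _ _ hx
lemma comp_io (a : CA φ.ker) : io φ a ∈ comp φ 1 := by
  induction a using CA_ind with
  | h1 n => rw [io_of]; have := comp_of φ (n : G); rwa [(MonoidHom.mem_ker).mp n.2] at this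
  | h2 x y hx hy => rw [map_add]; exact Submodule.add_mem _ hx hy
  | h3 r x hx => rw [map_smul]; exact Submodule.smul_mem _ _ hx
lemma comp_eq {g : G} {x : CA G} (hx : x ∈ comp φ (φ g)) : ∃ a, x = io φ a * ofG g := by
  refine comp_ind φ (p := fun x => ∃ a, x = io φ a * ofG g) hx ⟨0, by simp⟩ ?_ ?_ ?_
  · intro g' hg'
    refine ⟨ofG ⟨g' * g⁻¹, by rw [MonoidHom.mem_ker]; simp [hg']⟩, ?_⟩
    rw [io_of, ← map_mul]; simp
  · rintro x y ⟨a, rfl⟩ ⟨b, rfl⟩; exact ⟨a + b, by rw [map_add, add_mul]⟩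
  · rintro r x ⟨a, rfl⟩; exact ⟨r • a, by rw [map_smul, smul_mul_assoc]⟩
lemma comp_coeff_one {h : H} (hh : h ≠ 1) {x : CA G} (hx : x ∈ comp φ h) : x.coeff 1 = 0 :=
  hx 1 (by rw [map_one]; exact hh.symm)
variable [Finite G]
noncomputable def Fj (j : Fin (wed φ.ker).n) : CA G := io φ ((wed φ.ker).f j)
noncomputable def Zj (j : Fin (wed φ.ker).n) : CA G := io φ ((wed φ.ker).eps j)
def StabG (j : Fin (wed φ.ker).n) : Subgroup G where
  carrier := {g | ofG g * Zj φ j * ofG g⁻¹ = Zj φ j}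
  one_mem' := by simp
  mul_mem' := by
    intro a b ha hb
    change ofG a * Zj φ j * ofG a⁻¹ = Zj φ j at ha
    change ofG b * Zj φ j * ofG b⁻¹ = Zj φ j at hb
    change ofG (a * b) * Zj φ j * ofG (a * b)⁻¹ = Zj φ j
    calc _ = ofG a * (ofG b * Zj φ j * ofG b⁻¹) * ofG a⁻¹ := by
          rw [mul_inv_rev, map_mul, map_mul]; simp only [mul_assoc]
      _ = _ := by rw [hb, ha]
  inv_mem' := by
    intro a ha
    change ofG a * Zj φ j * ofG a⁻¹ = Zj φ j at ha
    change ofG a⁻¹ * Zj φ j * ofG a⁻¹⁻¹ = Zj φ j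
    rw [inv_inv]
    nth_rewrite 1 [← ha]
    rw [← mul_assoc, ← mul_assoc, ofG_inv_mul, one_mul, mul_assoc, ofG_inv_mul, mul_one]
lemma Fj_idem (j : Fin (wed φ.ker).n) : Fj φ j * Fj φ j = Fj φ j := by rw [Fj, ← map_mul, Wed.f_idem]
lemma Fj_ne (j : Fin (wed φ.ker).n) : Fj φ j ≠ 0 := by
  intro h; rw [Fj, map_eq_zero_iff _ (io_inj φ)] at h; exact Wed.f_ne _ _ h
lemma mem_StabG {j : Fin (wed φ.ker).n} {g : G} : g ∈ StabG φ j ↔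
    cj φ g ((wed φ.ker).eps j) = (wed φ.ker).eps j := by
  rw [← (io_inj φ).eq_iff, io_cj]; rfl
lemma cj_central (g : G) {z : CA φ.ker} (hz : ∀ a, z * a = a * z) (a) :
    cj φ g z * a = a * cj φ g z := by
  rw [← cj_inv φ g a, ← map_mul, ← map_mul, hz]
lemma cj_orth {j : Fin (wed φ.ker).n} {g : G} (hg : g ∉ StabG φ j) :
    (wed φ.ker).eps j * cj φ g ((wed φ.ker).eps j) = 0 := by
  have hc := cj_central φ g ((wed φ.ker).eps_comm j)
  have hi : cj φ g ((wed φ.ker).eps j) * cj φ g ((wed φ.ker).eps j) = cj φ g ((wed φ.ker).eps j) := by rw [← map_mul, (wed φ.ker).eps_idem]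
  rcases (wed φ.ker).eps_min hc hi j with h | h
  · exact h
  · exfalso
    have hc' := cj_central φ g⁻¹ ((wed φ.ker).eps_comm j)
    have hi' : cj φ g⁻¹ ((wed φ.ker).eps j) * cj φ g⁻¹ ((wed φ.ker).eps j) = cj φ g⁻¹ ((wed φ.ker).eps j) := by
      rw [← map_mul, (wed φ.ker).eps_idem]
    have h2 : cj φ g⁻¹ ((wed φ.ker).eps j) * (wed φ.ker).eps j = cj φ g⁻¹ ((wed φ.ker).eps j) := by
      have := congrArg (cj φ g⁻¹) h
      rwa [map_mul, cj_inv'] at this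
    rcases (wed φ.ker).eps_min hc' hi' j with h3 | h3
    · rw [(wed φ.ker).eps_comm, h2] at h3
      have := congrArg (cj φ g) h3
      rw [cj_inv, map_zero] at this
      have h5 := (wed φ.ker).eps_f j
      rw [this, zero_mul] at h5
      exact (wed φ.ker).f_ne j h5.symm
    · rw [(wed φ.ker).eps_comm, h2] at h3
      apply hg
      rw [mem_StabG]
      have := congrArg (cj φ g) h3
      rw [cj_inv] at this
      exact this.symm
open scoped Classical in
theorem clifford (i : Fin (wed G).n) (j : Fin (wed φ.ker).n) (hne : (wed G).chi i (Fj φ j) ≠ 0) :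
    ((wed G).d i : ℂ) = (StabG φ j).index * ((wed φ.ker).d j * (wed G).chi i (Fj φ j)) := by
  set z := Zj φ j with hz
  have hchi : (wed G).chi i z = (wed φ.ker).d j * (wed G).chi i (Fj φ j) :=
    (wed φ.ker).trl_eps j ((wed G).chi i ∘ₗ (io φ).toLinearMap)
      (fun a b => by simp [Wed.chi_mul_comm])
  rw [← hchi]
  have hd0 : ((wed φ.ker).d j : ℂ) ≠ 0 := by exact_mod_cast NeZero.ne _
  have hz0 : (wed G).chi i z ≠ 0 := by rw [hchi]; exact mul_ne_zero hd0 hne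
  let act : MulAction G (CA G) :=
    { smul := fun g x => ofG g * x * ofG g⁻¹
      one_smul := fun x => by show ofG 1 * x * ofG 1⁻¹ = x; simp
      mul_smul := fun a b x => by
        show ofG (a * b) * x * ofG (a * b)⁻¹ = ofG a * (ofG b * x * ofG b⁻¹) * ofG a⁻¹
        rw [mul_inv_rev, map_mul, map_mul]; simp only [mul_assoc] }
  have hsm : ∀ (g : G) x, g • x = ofG g * x * ofG g⁻¹ := fun _ _ => rfl
  have hst : MulAction.stabilizer G z = StabG φ j := by ext g; rfl
  have hfin : (MulAction.orbit G z).Finite := Set.finite_range _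
  set O := hfin.toFinset with hO
  have hcard : (StabG φ j).index = O.card := by
    rw [← hst, MulAction.index_stabilizer, Set.ncard_eq_toFinset_card _ hfin]
  have horth0 : ∀ g : G, g • z ≠ z → z * (g • z) = 0 := by
    intro g hg
    have : g ∉ StabG φ j := by rw [← hst]; exact hg
    have h2 := cj_orth φ this
    have h3 := congrArg (io φ) h2
    rwa [map_mul, map_zero, io_cj] at h3
  have hzz : z * z = z := by rw [hz, Zj, ← map_mul, Wed.eps_idem]
  have hmulsm : ∀ (g : G) (x y : CA G), g • (x * y) = (g • x) * (g • y) := by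
    intro g x y
    simp only [hsm]
    calc _ = ofG g * x * 1 * y * ofG g⁻¹ := by simp [mul_assoc]
      _ = _ := by rw [← ofG_inv_mul g]; simp only [mul_assoc]
  have hsm0 : ∀ g : G, g • (0 : CA G) = 0 := by intro g; rw [hsm]; simp
  have horth : ∀ x ∈ O, ∀ y ∈ O, x ≠ y → x * y = 0 := by
    intro x hx y hy hxy
    rw [hO, Set.Finite.mem_toFinset] at hx hy
    obtain ⟨a, rfl⟩ := hx
    obtain ⟨b, rfl⟩ := hy
    simp only at *
    have : a • z * b • z = a • (z * ((a⁻¹ * b) • z)) := by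
      rw [hmulsm, ← mul_smul]; simp
    rw [this, horth0, hsm0]
    intro h
    apply hxy
    nth_rewrite 1 [← h]
    rw [← mul_smul]; simp
  have hid : ∀ x ∈ O, x * x = x := by
    intro x hx
    rw [hO, Set.Finite.mem_toFinset] at hx
    obtain ⟨a, rfl⟩ := hx
    simp only
    rw [← hmulsm, hzz]
  set s := ∑ x ∈ O, x with hs
  have hss : ∀ x ∈ O, s * x = x := by
    intro x hx
    rw [hs, Finset.sum_mul, Finset.sum_eq_single x]
    · exact hid x hx
    · intro y hy hyx; exact horth y hy x hx hyx
    · intro h; exact absurd hx h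
  have hs2 : s * s = s := by
    nth_rewrite 2 [hs]; rw [Finset.mul_sum, Finset.sum_congr rfl hss]
  have hzO : z ∈ O := by rw [hO, Set.Finite.mem_toFinset]; exact MulAction.mem_orbit_self z
  have hsc : ∀ g, ofG g * s = s * ofG g := by
    intro g
    have : g • s = s := by
      rw [hsm, hs, Finset.mul_sum, Finset.sum_mul]
      refine Finset.sum_bij (fun x _ => g • x) ?_ ?_ ?_ ?_
      · intro x hx
        rw [hO, Set.Finite.mem_toFinset] at hx ⊢
        obtain ⟨a, rfl⟩ := hx
        exact ⟨g * a, mul_smul g a z⟩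
      · intro x _ y _ h; exact MulAction.injective g h
      · intro y hy
        refine ⟨g⁻¹ • y, ?_, by simp⟩
        rw [hO, Set.Finite.mem_toFinset] at hy ⊢
        obtain ⟨a, rfl⟩ := hy
        exact ⟨g⁻¹ * a, mul_smul g⁻¹ a z⟩
      · intro x _; rfl
    rw [hsm] at this
    nth_rewrite 2 [← this]
    rw [mul_assoc _ _ (ofG g), ofG_inv_mul, mul_one]
  rcases (wed G).central_idem (CA_central hsc) hs2 i with h | h
  · exfalso
    have h1 := congrArg ((wed G).chi i) (hss z hzO)
    rw [Wed.chi_def, map_mul, h] at h1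
    simp at h1
    exact hz0 h1.symm
  · have h1 : (wed G).chi i s = (wed G).d i := by rw [Wed.chi_def, h]; simp
    rw [← h1, hs, map_sum, hcard]
    rw [Finset.sum_congr rfl (g := fun _ => (wed G).chi i z)]
    · simp
    · intro x hx
      rw [hO, Set.Finite.mem_toFinset] at hx
      obtain ⟨a, rfl⟩ := hx
      show (wed G).chi i (ofG a * z * ofG a⁻¹) = _
      rw [Wed.chi_mul_comm, ← mul_assoc, ofG_inv_mul, one_mul]
end Clif

structure TS (A : Type) [Ring A] [Algebra ℂ A] (K : Type) [Group K] [Fintype K] [DecidableEq K] where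
  F : A
  X : K → A
  al : K → K → ℂ
  ka : K → A →ₗ[ℂ] ℂ
  al_ne : ∀ g h, al g h ≠ 0
  X_one : X 1 = F
  X_mul : ∀ g h, X g * X h = al g h • X (g * h)
  F_X : ∀ g, F * X g = X g
  X_F : ∀ g, X g * F = X g
  expa : ∀ a, F * a * F = ∑ k, ka k a • X k
  ka_X : ∀ k h, ka k (X h) = if k = h then 1 else 0
namespace TS
variable {A : Type} [Ring A] [Algebra ℂ A] {K : Type} [Group K] [Fintype K] [DecidableEq K]
  (T : TS A K) (W : Wed A)
lemma FF : T.F * T.F = T.F := by rw [← T.X_one, T.X_one, ← T.X_one]; nth_rewrite 1 [T.X_one]; exact T.F_X 1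
lemma X_ne (k : K) : T.X k ≠ 0 := by
  intro h; have := T.ka_X k k; rw [h] at this; simp at this
lemma F_ne : T.F ≠ 0 := by rw [← T.X_one]; exact T.X_ne 1
lemma al_one (g : K) : T.al 1 g = 1 := by
  have h := T.X_mul 1 g
  rw [T.X_one, T.F_X, one_mul] at h
  have h2 : (1 - T.al 1 g) • T.X g = 0 := by rw [sub_smul, one_smul, ← h, sub_self]
  rcases smul_eq_zero.mp h2 with h3 | h3
  · linear_combination -h3
  · exact absurd h3 (T.X_ne g)
lemma smul_X_inj {a b : ℂ} {k : K} (h : a • T.X k = b • T.X k) : a = b := by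
  have := congrArg (T.ka k) h
  simpa [T.ka_X] using this
lemma coc (g h x : K) : T.al g h * T.al (g * h) x = T.al g (h * x) * T.al h x := by
  have h1 : T.X g * T.X h * T.X x = T.X g * (T.X h * T.X x) := mul_assoc _ _ _
  rw [T.X_mul, T.X_mul, smul_mul_assoc, mul_smul_comm, T.X_mul, T.X_mul, smul_smul, smul_smul,
    mul_assoc g h x] at h1
  rw [T.smul_X_inj h1, mul_comm]
lemma tr (u v : A) (hu : u * T.F = u) (hv : T.F * v = v) :
    ∑ i, W.chi i u * W.chi i v = ∑ k, T.ka k (u * T.X k * v) := by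
  have := W.fd
  rw [← W.trace_two]
  have : LinearMap.mulLeft ℂ u ∘ₗ LinearMap.mulRight ℂ v =
      ∑ k, (T.ka k).smulRight (u * T.X k * v) := by
    ext a
    simp only [LinearMap.comp_apply, LinearMap.mulLeft_apply, LinearMap.mulRight_apply,
      LinearMap.sum_apply, LinearMap.smulRight_apply]
    calc u * (a * v) = u * (T.F * a * T.F) * v := by
          nth_rewrite 1 [← hu, ← hv]; simp only [mul_assoc]
      _ = _ := by
        rw [T.expa, Finset.mul_sum, Finset.sum_mul]
        simp only [mul_smul_comm, smul_mul_assoc]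
  rw [this, map_sum]
  simp only [LinearMap.trace_smulRight]
lemma sq : ∑ i, W.chi i T.F * W.chi i T.F = Fintype.card K := by
  rw [T.tr W _ _ T.FF T.FF]
  simp [T.F_X, T.X_F, T.ka_X]
lemma regular (a : A) : ∑ i, W.chi i T.F * W.chi i (T.F * a * T.F) = Fintype.card K * T.ka 1 a := by
  rw [T.tr W _ _ T.FF (by rw [← mul_assoc, ← mul_assoc, T.FF])]
  have : ∀ k, T.ka k (T.F * T.X k * (T.F * a * T.F)) = T.ka 1 a := by
    intro k
    rw [T.F_X, T.expa, Finset.mul_sum, map_sum, Finset.sum_eq_single 1]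
    · rw [mul_smul_comm, T.X_one, T.X_F, map_smul, T.ka_X, if_pos rfl, smul_eq_mul, mul_one]
    · intro h _ hh
      rw [mul_smul_comm, T.X_mul, map_smul, map_smul, T.ka_X, if_neg, smul_zero, smul_zero]
      intro h2; exact hh (by simpa using h2.symm)
    · simp
  simp [this]
/-- rescaling -/
noncomputable def scale (μ : K → ℂ) (h0 : ∀ k, μ k ≠ 0) (h1 : μ 1 = 1) : TS A K where
  F := T.F
  X k := μ k • T.X k
  al g h := μ g * μ h * T.al g h * (μ (g * h))⁻¹
  ka k := (μ k)⁻¹ • T.ka k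
  al_ne g h := by simp [h0, T.al_ne]
  X_one := by rw [h1, one_smul, T.X_one]
  X_mul g h := by
    rw [smul_mul_smul_comm, T.X_mul, smul_smul, smul_smul, mul_assoc _ (μ (g * h))⁻¹,
      inv_mul_cancel₀ (h0 _), mul_one]
  F_X g := by rw [mul_smul_comm, T.F_X]
  X_F g := by rw [smul_mul_assoc, T.X_F]
  expa a := by
    rw [T.expa]
    refine Finset.sum_congr rfl fun k _ => ?_
    rw [LinearMap.smul_apply, smul_smul, smul_eq_mul, mul_right_comm, inv_mul_cancel₀ (h0 k), one_mul]
  ka_X k h := by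
    rw [LinearMap.smul_apply, map_smul, T.ka_X, smul_smul]
    by_cases hk : k = h
    · subst hk; simp [h0]
    · simp [hk]
lemma exists_norm : ∃ T' : TS A K, T'.F = T.F ∧ ∀ g h, T'.al g h ^ (Fintype.card K) = 1 := by
  have hn : Fintype.card K ≠ 0 := Fintype.card_ne_zero
  have : ∀ k : K, ∃ z : ℂ, z ^ (Fintype.card K) = ∏ h, T.al k h := fun k =>
    IsAlgClosed.exists_pow_nat_eq _ (Nat.pos_of_ne_zero hn)
  choose ν hν using this
  have hν0 : ∀ k, ν k ≠ 0 := by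
    intro k h
    have := hν k
    rw [h, zero_pow hn] at this
    exact (Finset.prod_ne_zero_iff.mpr fun h _ => T.al_ne k h) this.symm
  have hν1 : ν 1 ^ (Fintype.card K) = 1 := by rw [hν]; simp [T.al_one]
  have key : ∀ g h, T.al g h ^ (Fintype.card K) * ∏ x, T.al (g * h) x =
      (∏ x, T.al g x) * ∏ x, T.al h x := by
    intro g h
    rw [← Finset.card_univ, ← Finset.prod_const, ← Finset.prod_mul_distrib]
    simp only [T.coc g h]
    rw [Finset.prod_mul_distrib]
    congr 1
    exact Fintype.prod_equiv (Equiv.mulLeft h) _ _ (fun x => rfl)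
  refine ⟨T.scale (fun k => ν 1 * (ν k)⁻¹) (fun k => mul_ne_zero (hν0 1) (inv_ne_zero (hν0 k)))
    (mul_inv_cancel₀ (hν0 1)), rfl, ?_⟩
  intro g h
  simp only [scale, mul_pow, inv_pow, hν1, one_mul, hν, mul_inv, inv_inv, inv_one]
  have h1 : ∏ x, T.al g x ≠ 0 := Finset.prod_ne_zero_iff.mpr fun h _ => T.al_ne _ h
  have h2 : ∏ x, T.al h x ≠ 0 := Finset.prod_ne_zero_iff.mpr fun h _ => T.al_ne _ h
  field_simp
  rw [key]
end TS
lemma trace_int {n : ℕ} (B : Matrix (Fin n) (Fin n) ℂ) {m : ℕ} (hm : 0 < m) {ρ : ℂ}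
    (hρ : IsIntegral ℤ ρ) (h : B ^ (m + 1) = ρ • B) : IsIntegral ℤ B.trace := by
  rw [Matrix.trace_eq_sum_roots_charpoly]
  refine Multiset.sum_induction _ _ (fun _ _ => IsIntegral.add) isIntegral_zero ?_
  intro r hr
  rw [Polynomial.mem_roots (Matrix.charpoly_monic B).ne_zero, Polynomial.IsRoot,
    Matrix.eval_charpoly] at hr
  obtain ⟨v, hv, hv2⟩ := Matrix.exists_mulVec_eq_zero_iff.mpr hr
  have h1 : B.mulVec v = r • v := by
    rw [Matrix.sub_mulVec, sub_eq_zero] at hv2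
    rw [← hv2]; ext x; simp [Matrix.scalar_apply, Matrix.mulVec_diagonal]
  have h2 : ∀ k : ℕ, (B ^ k).mulVec v = r ^ k • v := by
    intro k
    induction k with
    | zero => simp
    | succ k ih => rw [pow_succ', ← Matrix.mulVec_mulVec, ih, Matrix.mulVec_smul, h1, smul_smul, pow_succ]
  have h3 := h2 (m + 1)
  rw [h, Matrix.smul_mulVec, h1, smul_smul] at h3
  have h4 : ρ * r = r ^ (m + 1) := smul_left_injective ℂ hv h3
  by_cases h0 : r = 0
  · rw [h0]; exact isIntegral_zero
  · refine IsIntegral.of_pow hm ?_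
    have : r ^ m = ρ := by
      apply mul_right_cancel₀ h0; rw [h4, pow_succ]
    rwa [this]

namespace TS
variable {A : Type} [Ring A] [Algebra ℂ A] {K : Type} [Group K] [Fintype K] [DecidableEq K]
  (T : TS A K) (W : Wed A)
lemma X_pow (hn : ∀ g h, T.al g h ^ (Fintype.card K) = 1) (g : K) (j : ℕ) :
    ∃ ρ : ℂ, ρ ^ (Fintype.card K) = 1 ∧ T.X g ^ (j + 1) = ρ • T.X (g ^ (j + 1)) := by
  induction j with
  | zero => exact ⟨1, by simp, by simp⟩
  | succ j ih =>
    obtain ⟨ρ, h1, h2⟩ := ih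
    refine ⟨ρ * T.al (g ^ (j + 1)) g, by rw [mul_pow, h1, hn, one_mul], ?_⟩
    rw [pow_succ, h2, smul_mul_assoc, T.X_mul, smul_smul, pow_succ g (j + 1)]
lemma int_of_root {n : ℕ} (hn : 0 < n) {z : ℂ} (h : z ^ n = 1) : IsIntegral ℤ z :=
  IsIntegral.of_pow hn (by rw [h]; exact isIntegral_one)
lemma chi_X_int (hn : ∀ g h, T.al g h ^ (Fintype.card K) = 1) (g : K) (i) :
    IsIntegral ℤ (W.chi i (T.X g)) := by
  obtain ⟨ρ, h1, h2⟩ := T.X_pow hn g (Fintype.card K)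
  rw [Wed.chi_def]
  refine trace_int _ Fintype.card_pos (int_of_root Fintype.card_pos h1) (m := Fintype.card K) ?_
  rw [← map_pow, h2, map_smul, pow_succ g, pow_card_eq_one, one_mul]
theorem dvd_card {c : ℕ} {i} (hc : W.chi i T.F = c) (hc0 : c ≠ 0) : c ∣ Fintype.card K := by
  obtain ⟨T', hF, hn⟩ := T.exists_norm
  rw [← hF] at hc
  clear hF
  have hK : 0 < Fintype.card K := Fintype.card_pos
  set ε := W.eps i * T'.F with hε
  have hFε : T'.F * ε * T'.F = ε := by
    rw [hε, ← mul_assoc, ← W.eps_comm, mul_assoc, mul_assoc, T'.FF, T'.FF]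
  have hεc : ∀ k, ε * T'.X k = T'.X k * ε := by
    intro k
    rw [hε, mul_assoc, T'.F_X, W.eps_comm, W.eps_comm, ← mul_assoc, T'.X_F]
  have hεε : ε * ε = ε := by
    rw [hε, mul_assoc, ← mul_assoc T'.F, ← W.eps_comm, mul_assoc, T'.FF, ← mul_assoc, W.eps_idem]
  have hMε : W.chi i ε = c := by
    rw [hε, Wed.chi_def, map_mul, W.M_eps, one_mul, ← Wed.chi_def, hc]
  have hε0 : ε ≠ 0 := by
    intro h; rw [h, map_zero] at hMε; exact hc0 (by exact_mod_cast hMε.symm)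
  let Y : K → A := fun k => (T'.al k k⁻¹)⁻¹ • T'.X k⁻¹
  have hka : ∀ k, (Fintype.card K : ℂ) * T'.ka k ε = c * W.chi i (Y k) := by
    intro k
    have h1 : T'.ka k ε = T'.ka 1 (ε * Y k) := by
      nth_rewrite 2 [← hFε]
      rw [T'.expa, Finset.sum_mul, map_sum, Finset.sum_eq_single k]
      · simp only [Y, smul_mul_assoc, mul_smul_comm, T'.X_mul, map_smul, smul_smul]
        rw [mul_left_comm, inv_mul_cancel₀ (T'.al_ne _ _), mul_inv_cancel, T'.ka_X]; simp
      · intro h _ hh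
        simp only [Y, smul_mul_assoc, mul_smul_comm, T'.X_mul, map_smul]
        rw [T'.ka_X, if_neg]
        · simp
        · intro h2; exact hh (by rwa [eq_comm, mul_inv_eq_one] at h2)
      · simp
    have hFY : T'.F * (ε * Y k) * T'.F = ε * Y k := by
      rw [← hFε]; simp only [Y, mul_smul_comm, smul_mul_assoc, mul_assoc, T'.X_F, T'.F_X]
      rw [← mul_assoc T'.F T'.F, T'.FF]
    rw [h1, ← T'.regular W, hFY, Finset.sum_eq_single i]
    · rw [hc]; congr 1
      simp only [Y, hε, mul_smul_comm, map_smul, mul_assoc, T'.F_X]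
      rw [Wed.chi_def, map_mul, W.M_eps, one_mul, Wed.chi_def]
    · intro j _ hj
      have : W.chi j (ε * Y k) = 0 := by
        rw [hε, Wed.chi_def, map_mul, map_mul, W.M_eps_ne hj]; simp
      rw [this, mul_zero]
    · simp
  have hcC : (c : ℂ) ≠ 0 := by exact_mod_cast hc0
  set lam : ℂ := (Fintype.card K : ℂ) / c with hlam
  have hlε : lam • ε = ∑ k, W.chi i (Y k) • T'.X k := by
    nth_rewrite 1 [← hFε]
    rw [T'.expa, Finset.smul_sum]
    refine Finset.sum_congr rfl fun k _ => ?_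
    rw [smul_smul]; congr 1
    rw [hlam]; field_simp; rw [hka]
  have hYint : ∀ k, IsIntegral ℤ (W.chi i (Y k)) := by
    intro k
    simp only [Y, map_smul, smul_eq_mul]
    refine IsIntegral.mul (int_of_root hK (by rw [inv_pow, hn, inv_one])) (T'.chi_X_int W hn _ _)
  let O := integralClosure ℤ ℂ
  have hOs : ∀ (z : ℂ) (hz : IsIntegral ℤ z) (a : A), z • a = (⟨z, hz⟩ : O) • a := fun _ _ _ => rfl
  let N : Submodule O A := Submodule.span O (Set.range fun k => T'.X k * ε)
  have hmem : ∀ k, T'.X k * ε ∈ N := fun k => Submodule.subset_span ⟨k, rfl⟩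
  have hint : IsIntegral O lam := by
    refine isIntegral_of_smul_mem_submodule (N := N) ?_ ?_ lam ?_
    · intro h
      have h2 := hmem 1
      rw [h, Submodule.mem_bot, T'.X_one, hε, ← mul_assoc, ← W.eps_comm, mul_assoc, T'.FF] at h2
      exact hε0 h2
    · exact Submodule.fg_span (Set.finite_range _)
    · intro a ha
      induction ha using Submodule.span_induction with
      | mem x hx =>
        obtain ⟨k, rfl⟩ := hx
        have : lam • (T'.X k * ε) = ∑ h, W.chi i (Y h) • (T'.al k h • (T'.X (k * h) * ε)) := by
          calc lam • (T'.X k * ε) = T'.X k * (lam • ε) * ε := by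
                rw [mul_smul_comm, smul_mul_assoc, mul_assoc, hεε]
            _ = _ := by
              rw [hlε, Finset.mul_sum, Finset.sum_mul]
              refine Finset.sum_congr rfl fun h _ => ?_
              rw [mul_smul_comm, T'.X_mul, smul_mul_assoc, smul_mul_assoc]
        show lam • (T'.X k * ε) ∈ N
        rw [this]
        refine Submodule.sum_mem _ fun h _ => ?_
        rw [hOs _ (int_of_root hK (hn k h)), hOs _ (hYint h)]
        exact Submodule.smul_mem _ _ (Submodule.smul_mem _ _ (hmem _))
      | zero => rw [smul_zero]; exact Submodule.zero_mem _
      | add x y _ _ hx hy => rw [smul_add]; exact Submodule.add_mem _ hx hy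
      | smul r x _ hx => rw [smul_comm]; exact Submodule.smul_mem _ _ hx
  have hint2 : IsIntegral ℤ lam := isIntegral_trans (A := O) lam hint
  have hq : lam = algebraMap ℚ ℂ ((Fintype.card K : ℚ) / c) := by rw [hlam]; simp
  rw [hq, isIntegral_algebraMap_iff (algebraMap ℚ ℂ).injective,
    IsIntegrallyClosed.isIntegral_iff] at hint2
  obtain ⟨y, hy⟩ := hint2
  have h3 : (Fintype.card K : ℤ) = c * y := by
    have hcQ : (c : ℚ) ≠ 0 := by exact_mod_cast hc0
    rw [eq_div_iff hcQ] at hy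
    have : ((Fintype.card K : ℤ) : ℚ) = ((c * y : ℤ) : ℚ) := by
      push_cast; rw [← hy]; simp [mul_comm]
    exact_mod_cast this
  exact_mod_cast Dvd.intro y h3.symm
end TS

lemma sq_ineq {ι : Type} [Fintype ι] (l : ℕ) (hl : Fintype.card ι = l) (h2 : 0 < l) (m : ι → ℕ) (c : ℕ)
    (hc : c = ∑ j, m j) : (c : ℤ) ^ 2 ≤ l * ∑ j, (m j : ℤ) ^ 2 ∧
    (¬ l ∣ c → (c : ℤ) ^ 2 + (l - 1) ≤ l * ∑ j, (m j : ℤ) ^ 2) := by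
  set a := c / l
  set b := c % l
  have hab : (c : ℤ) = l * a + b := by exact_mod_cast (Nat.div_add_mod c l).symm
  have hbl : (b : ℤ) < l := by exact_mod_cast Nat.mod_lt c h2
  have h0 : ∀ x : ℤ, 0 ≤ (x - a) * (x - a - 1) := by
    intro x
    rcases le_or_gt x a with h | h
    · nlinarith
    · nlinarith
  have h1 : 0 ≤ ∑ j, ((m j : ℤ) - a) * (m j - a - 1) := Finset.sum_nonneg fun j _ => h0 _
  have h3 : ∑ j, ((m j : ℤ) - a) * (m j - a - 1) = ∑ j, (m j : ℤ) ^ 2 - (2 * a + 1) * c + l * (a * (a + 1)) := by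
    have : (c : ℤ) = ∑ j, (m j : ℤ) := by rw [hc]; push_cast; rfl
    rw [this, Finset.mul_sum, ← hl, ← Finset.card_univ, ← nsmul_eq_mul, ← Finset.sum_const,
      ← Finset.sum_sub_distrib, ← Finset.sum_add_distrib]
    exact Finset.sum_congr rfl fun j _ => by ring
  rw [h3] at h1
  have hl0 : (0 : ℤ) < l := by exact_mod_cast h2
  have hb0 : (0 : ℤ) ≤ b := by positivity
  have h4 : (c : ℤ) ^ 2 + b * (l - b) ≤ l * ∑ j, (m j : ℤ) ^ 2 := by
    have := mul_nonneg hl0.le h1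
    have e : (l : ℤ) * (∑ j, (m j : ℤ) ^ 2 - (2 * a + 1) * c + l * (a * (a + 1))) =
      l * ∑ j, (m j : ℤ) ^ 2 - (c ^ 2 + b * (l - b)) := by rw [hab]; ring
    rw [e] at this; linarith
  constructor
  · nlinarith
  · intro hd
    have : (1 : ℤ) ≤ b := by
      have : b ≠ 0 := fun h => hd (Nat.dvd_of_mod_eq_zero h)
      have : 1 ≤ b := Nat.one_le_iff_ne_zero.mpr this
      exact_mod_cast this
    nlinarith
namespace TS
variable {A : Type} [Ring A] [Algebra ℂ A] {K : Type} [Group K] [Fintype K] [DecidableEq K]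
  (T : TS A K) (W : Wed A)
lemma X_pow' (g : K) (j : ℕ) :
    ∃ ρ : ℂ, ρ ≠ 0 ∧ T.X g ^ (j + 1) = ρ • T.X (g ^ (j + 1)) := by
  induction j with
  | zero => exact ⟨1, by simp, by simp⟩
  | succ j ih =>
    obtain ⟨ρ, h1, h2⟩ := ih
    refine ⟨ρ * T.al (g ^ (j + 1)) g, mul_ne_zero h1 (T.al_ne _ _), ?_⟩
    rw [pow_succ, h2, smul_mul_assoc, T.X_mul, smul_smul, pow_succ g (j + 1)]
lemma exists_z (x : K) (l : ℕ) [Fact l.Prime] (hx : x ^ l = 1) : ∃ z : ZMod l → A,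
    z 0 = T.F ∧ (∀ k k', z k * z k' = z (k + k')) ∧
    (∀ k, ∃ ρ : ℂ, z k = ρ • T.X (x ^ k.val)) := by
  have hl : 0 < l := (Fact.out : l.Prime).pos
  obtain ⟨ρ, h1, h2⟩ := T.X_pow' x (l - 1)
  rw [Nat.sub_add_cancel hl, hx, T.X_one] at h2
  obtain ⟨s, hs⟩ := IsAlgClosed.exists_pow_nat_eq ρ⁻¹ hl
  set xb := s • T.X x with hxb
  have hxl : xb ^ l = T.F := by rw [hxb, smul_pow, h2, hs, smul_smul, inv_mul_cancel₀ h1, one_smul]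
  have hFx : T.F * xb = xb := by rw [hxb, mul_smul_comm, T.F_X]
  have hxF : xb * T.F = xb := by rw [hxb, smul_mul_assoc, T.X_F]
  have hcomm : ∀ n : ℕ, xb ^ n * T.F = T.F * xb ^ n := fun n =>
    ((show Commute xb T.F from hxF.trans hFx.symm).pow_left n)
  have hmod : ∀ n : ℕ, T.F * xb ^ n = T.F * xb ^ (n % l) := by
    intro n
    have hq : ∀ q : ℕ, T.F * T.F ^ q = T.F := by
      intro q; induction q with
      | zero => simp
      | succ q ih => rw [pow_succ, ← mul_assoc, ih, T.FF]
    conv_lhs => rw [← Nat.div_add_mod n l, pow_add, pow_mul, hxl, ← mul_assoc, hq]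
  refine ⟨fun k => T.F * xb ^ k.val, by simp, ?_, ?_⟩
  · intro k k'
    show T.F * xb ^ k.val * (T.F * xb ^ k'.val) = T.F * xb ^ (k + k').val
    rw [ZMod.val_add, ← hmod, pow_add, ← mul_assoc, mul_assoc T.F, hcomm, ← mul_assoc, T.FF, mul_assoc]
  · intro k
    show ∃ ρ : ℂ, T.F * xb ^ k.val = ρ • T.X (x ^ k.val)
    rcases Nat.eq_zero_or_pos k.val with h | h
    · rw [h]; exact ⟨1, by simp [T.X_one]⟩
    · obtain ⟨ρ', -, h4⟩ := T.X_pow' x (k.val - 1)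
      rw [Nat.sub_add_cancel h] at h4
      exact ⟨s ^ k.val * ρ', by rw [hxb, smul_pow, h4, smul_smul, mul_smul_comm, T.F_X]⟩
open scoped Classical in
theorem count (x : K) (l : ℕ) [Fact l.Prime] (hx : x ^ l = 1) (c : Fin W.n → ℕ)
    (hc : ∀ i, W.chi i T.F = c i) :
    (Finset.univ.filter fun i => ¬ l ∣ c i).card ≤ Nat.card {h : K // x * h = h * x} := by
  have hl : 0 < l := (Fact.out : l.Prime).pos
  have hlC : (l : ℂ) ≠ 0 := by exact_mod_cast hl.ne'
  obtain ⟨z, z0, zz, zX⟩ := T.exists_z x l hx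
  have zF : ∀ k, z k * T.F = z k := fun k => by rw [← z0, zz, add_zero]
  have Fz : ∀ k, T.F * z k = z k := fun k => by rw [← z0, zz, zero_add]
  set Cx := Nat.card {h : K // x * h = h * x} with hCx
  have htr : ∀ k : ZMod l, k ≠ 0 → ‖∑ i, W.chi i (z k) * W.chi i (z (-k))‖ ≤ Cx := by
    intro k hk
    rw [T.tr W _ _ (zF k) (Fz (-k))]
    have hx' : x ^ k.val * x ^ (-k).val = 1 := by
      have h1 : (k.val + (-k).val) % l = 0 := by rw [← ZMod.val_add]; simp
      rw [← pow_add, ← Nat.div_add_mod (k.val + (-k).val) l, h1, add_zero, pow_mul, hx, one_pow]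
    have hgen : ∃ m : ℕ, (x ^ k.val) ^ m = x := by
      refine ⟨(k⁻¹).val, ?_⟩
      have h1 : (k.val * (k⁻¹).val) % l = 1 := by
        rw [← ZMod.val_mul, mul_inv_cancel₀ hk, ZMod.val_one]
      rw [← pow_mul, ← Nat.div_add_mod (k.val * (k⁻¹).val) l, h1, pow_add, pow_mul, hx, one_pow, one_mul,
        pow_one]
    have hb : ∀ h : K, ‖T.ka h (z k * T.X h * z (-k))‖ ≤ if x * h = h * x then 1 else 0 := by
      intro h
      obtain ⟨ρ, hρ⟩ := zX k
      obtain ⟨ρ', hρ'⟩ := zX (-k)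
      have h1 : ∃ lam : ℂ, z k * T.X h * z (-k) = lam • T.X (x ^ k.val * h * x ^ (-k).val) := by
        rw [hρ, hρ']
        exact ⟨_, by rw [smul_mul_assoc, smul_mul_assoc, mul_smul_comm, T.X_mul, smul_mul_assoc, T.X_mul,
          smul_smul, smul_smul, smul_smul]⟩
      obtain ⟨lam, hlam⟩ := h1
      rw [eq_inv_of_mul_eq_one_right hx'] at hlam
      split_ifs with hcom
      · have hcom' : x ^ k.val * h = h * x ^ k.val := (Commute.pow_left (show Commute x h from hcom) _)
        rw [hcom', mul_inv_cancel_right] at hlam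
        have hj : ∀ j : ℕ, z (j * k) * T.X h * z (-(j * k)) = lam ^ j • T.X h := by
          intro j; induction j with
          | zero => simp [z0, T.F_X, T.X_F]
          | succ j ih =>
            calc z (((j + 1 : ℕ) : ZMod l) * k) * T.X h * z (-(((j + 1 : ℕ) : ZMod l) * k))
                = z k * (z (j * k) * T.X h * z (-(j * k))) * z (-k) := by
                  have e1 : ((j + 1 : ℕ) : ZMod l) * k = k + j * k := by push_cast; ring
                  have e2 : -(((j + 1 : ℕ) : ZMod l) * k) = -(j * k) + -k := by push_cast; ring
                  rw [e2, e1, ← zz, ← zz]; simp only [mul_assoc]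
              _ = _ := by rw [ih, mul_smul_comm, smul_mul_assoc, hlam, smul_smul, pow_succ]
        have h5 := hj l
        rw [CharP.cast_eq_zero, zero_mul, neg_zero, z0, T.F_X, T.X_F] at h5
        have h6 : lam ^ l = 1 := by
          apply T.smul_X_inj (k := h); rw [one_smul, ← h5]
        rw [hlam, map_smul, T.ka_X, if_pos rfl, smul_eq_mul, mul_one]
        exact (Complex.norm_eq_one_of_pow_eq_one h6 hl.ne').le
      · rw [hlam, map_smul, T.ka_X, if_neg, smul_zero, norm_zero]
        intro h3
        apply hcom
        have h4 : Commute (x ^ k.val) h := by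
          show x ^ k.val * h = h * x ^ k.val
          nth_rewrite 2 [h3]; simp
        obtain ⟨m, hm⟩ := hgen
        rw [← hm]
        exact h4.pow_left m
    refine (norm_sum_le _ _).trans ((Finset.sum_le_sum fun h _ => hb h).trans ?_)
    rw [Finset.sum_boole, hCx, Nat.card_eq_fintype_card, Fintype.card_subtype]
  set ψ := ZMod.stdAddChar (N := l)
  have hψ : ∀ b : ZMod l, ∑ j, ψ (j * b) = if b = 0 then (l : ℂ) else 0 := by
    intro b
    have := AddChar.sum_mulShift b (ZMod.isPrimitive_stdAddChar l)
    rw [this, ZMod.card]; push_cast; rfl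
  let e : ZMod l → A := fun j => (l : ℂ)⁻¹ • ∑ k, ψ (j * (-k)) • z k
  have hee : ∀ j, e j * e j = e j := by
    intro j
    simp only [e]
    rw [smul_mul_smul_comm, Finset.sum_mul]
    have : ∀ k, (ψ (j * (-k)) • z k) * ∑ k', ψ (j * (-k')) • z k' = ∑ k', ψ (j * (-k')) • z k' := by
      intro k
      rw [Finset.mul_sum]
      refine Fintype.sum_equiv (Equiv.addLeft k) _ _ fun k' => ?_
      rw [smul_mul_smul_comm, zz, ← AddChar.map_add_eq_mul, Equiv.coe_addLeft]
      congr 2; ring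
    simp only [this]
    rw [Finset.sum_const, Finset.card_univ, ZMod.card, ← Nat.cast_smul_eq_nsmul ℂ, smul_smul, mul_assoc,
      inv_mul_cancel₀ hlC, mul_one]
  choose m hm using fun i j => W.idem_nat (hee j) i
  have hchi : ∀ i j, W.chi i (e j) = (l : ℂ)⁻¹ * ∑ k, ψ (j * (-k)) * W.chi i (z k) := by
    intro i j; simp only [e, map_smul, map_sum, smul_eq_mul]
  have hcm : ∀ i, c i = ∑ j, m i j := by
    intro i
    have : (c i : ℂ) = ∑ j, W.chi i (e j) := by
      simp only [hchi]
      rw [← Finset.mul_sum, Finset.sum_comm]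
      simp only [← Finset.sum_mul, hψ, neg_eq_zero]
      simp [z0, hc, hlC]
    simp only [hm] at this
    exact_mod_cast this
  have hpars : ∀ i, (l : ℂ) * ∑ j, (m i j : ℂ) ^ 2 = ∑ k, W.chi i (z k) * W.chi i (z (-k)) := by
    intro i
    have : ∀ j : ZMod l, ((l : ℂ)⁻¹ * ∑ k, ψ (j * (-k)) * W.chi i (z k)) *
        ((l : ℂ)⁻¹ * ∑ k, ψ (j * (-k)) * W.chi i (z k)) =
        (l : ℂ)⁻¹ * (l : ℂ)⁻¹ * ∑ k, ∑ k', ψ (j * (-(k + k'))) * (W.chi i (z k) * W.chi i (z k')) := by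
      intro j
      rw [mul_mul_mul_comm, Finset.sum_mul_sum]
      congr 1
      refine Finset.sum_congr rfl fun k _ => Finset.sum_congr rfl fun k' _ => ?_
      rw [show j * (-(k + k')) = j * (-k) + j * (-k') by ring, AddChar.map_add_eq_mul]; ring
    rw [Finset.sum_congr rfl fun j _ => show (m i j : ℂ) ^ 2 = _ by rw [← hm, hchi, pow_two, this]]
    rw [← Finset.mul_sum]
    have h2 : ∀ k, ∑ j, ∑ k', ψ (j * (-(k + k'))) * (W.chi i (z k) * W.chi i (z k')) =
        l * (W.chi i (z k) * W.chi i (z (-k))) := by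
      intro k
      rw [Finset.sum_comm]
      simp only [← Finset.sum_mul, hψ]
      rw [Finset.sum_eq_single (-k)]
      · simp
      · intro b _ hb; rw [if_neg, zero_mul]
        intro h; apply hb
        have : k + b = 0 := neg_eq_zero.mp h
        exact (neg_eq_of_add_eq_zero_right this).symm
      · simp
    have h3 : ∑ j, ∑ k, ∑ k', ψ (j * (-(k + k'))) * (W.chi i (z k) * W.chi i (z k')) =
        l * ∑ k, (W.chi i (z k) * W.chi i (z (-k))) := by
      rw [Finset.sum_comm, Finset.mul_sum]
      exact Finset.sum_congr rfl fun k _ => h2 k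
    rw [h3]
    field_simp
  have hsplit : ∑ i, (∑ k, W.chi i (z k) * W.chi i (z (-k)) - (c i : ℂ) ^ 2) =
      ∑ k ∈ Finset.univ.erase (0 : ZMod l), ∑ i, W.chi i (z k) * W.chi i (z (-k)) := by
    rw [Finset.sum_comm]
    refine Finset.sum_congr rfl fun i _ => ?_
    rw [← Finset.sum_erase_add _ _ (Finset.mem_univ (0 : ZMod l)), neg_zero, z0, hc]; ring
  have hZ : ((∑ i, ((l : ℤ) * ∑ j, (m i j : ℤ) ^ 2 - (c i : ℤ) ^ 2) : ℤ) : ℂ) =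
      ∑ k ∈ Finset.univ.erase (0 : ZMod l), ∑ i, W.chi i (z k) * W.chi i (z (-k)) := by
    rw [← hsplit]; push_cast
    refine Finset.sum_congr rfl fun i _ => ?_
    rw [← hpars]
  have hup : (∑ i, ((l : ℤ) * ∑ j, (m i j : ℤ) ^ 2 - (c i : ℤ) ^ 2) : ℤ) ≤ (l - 1) * Cx := by
    have h1 : ‖((∑ i, ((l : ℤ) * ∑ j, (m i j : ℤ) ^ 2 - (c i : ℤ) ^ 2) : ℤ) : ℂ)‖ ≤ (l - 1) * Cx := by
      rw [hZ]
      refine (norm_sum_le _ _).trans ((Finset.sum_le_sum fun k hk => htr k (Finset.ne_of_mem_erase hk)).trans ?_)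
      rw [Finset.sum_const, Finset.card_erase_of_mem (Finset.mem_univ _), Finset.card_univ, ZMod.card,
        nsmul_eq_mul, Nat.cast_sub hl, Nat.cast_one]
    rw [Complex.norm_intCast] at h1
    have := (le_abs_self _).trans h1
    exact_mod_cast this
  have hlow : ((l : ℤ) - 1) * (Finset.univ.filter fun i => ¬ l ∣ c i).card ≤
      ∑ i, ((l : ℤ) * ∑ j, (m i j : ℤ) ^ 2 - (c i : ℤ) ^ 2) := by
    rw [Finset.card_filter]; push_cast; rw [Finset.mul_sum]
    refine Finset.sum_le_sum fun i _ => ?_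
    have := sq_ineq l (ZMod.card l) hl (m i) (c i) (hcm i)
    split_ifs with h
    · rw [mul_zero]; linarith [this.1]
    · rw [mul_one]; linarith [this.2 h]
  have h2 : (0 : ℤ) < (l : ℤ) - 1 := by
    have := (Fact.out : l.Prime).two_le
    omega
  have := le_of_mul_le_mul_left (hlow.trans hup) h2
  exact_mod_cast this
end TS

section
variable {G H : Type} [Group G] [Group H] (φ : G →* H) [Finite G]
lemma corner_prim (j : Fin (wed φ.ker).n) {a : CA G} (ha : a ∈ comp φ 1) :
    ∃ c : ℂ, Fj φ j * a * Fj φ j = c • Fj φ j := by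
  have ha' : a ∈ comp φ (φ 1) := by rwa [map_one]
  obtain ⟨b, rfl⟩ := comp_eq φ ha'
  refine ⟨(wed φ.ker).M j b 0 0, ?_⟩
  rw [map_one, mul_one, Fj, ← map_mul, ← map_mul, Wed.f_prim, map_smul]
lemma corner_out {j : Fin (wed φ.ker).n} {g : G} (hg : g ∉ StabG φ j) :
    Fj φ j * ofG g * Fj φ j = 0 := by
  rw [Fj, mul_assoc, of_io, ← mul_assoc, ← map_mul]
  have : (wed φ.ker).f j * cj φ g ((wed φ.ker).f j) = 0 := by
    rw [← Wed.eps_f, map_mul, ← mul_assoc, Wed.eps_comm, mul_assoc ((wed φ.ker).f j), cj_orth φ hg, mul_zero,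
      zero_mul]
  rw [this, map_zero, zero_mul]
lemma corner_ex {j : Fin (wed φ.ker).n} {g : G} (hg : g ∈ StabG φ j) :
    ∃ X Y : CA G, X ∈ comp φ (φ g) ∧ Y ∈ comp φ (φ g)⁻¹ ∧ Fj φ j * X = X ∧ X * Fj φ j = X ∧
      Fj φ j * Y = Y ∧ Y * Fj φ j = Y ∧ X * Y = Fj φ j ∧ Y * X = Fj φ j := by
  let f := (wed φ.ker).f j
  let f' := cj φ g f
  have ff : f * f = f := Wed.f_idem _ _
  have ff' : f' * f' = f' := by simp only [f']; rw [← map_mul, ff]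
  have fne : f' ≠ 0 := by
    intro h; have := congrArg (cj φ g⁻¹) h
    rw [cj_inv', map_zero] at this; exact Wed.f_ne _ _ this
  have hef : (wed φ.ker).eps j * f' = f' := by
    nth_rewrite 1 [← (mem_StabG φ).mp hg]
    simp only [f']; rw [← map_mul]; congr 1; exact Wed.eps_f _ _
  have hMf : (wed φ.ker).M j f' ≠ 0 := by
    intro h; apply fne; apply Wed.ext'; intro i
    by_cases hi : i = j
    · subst hi; rw [h, map_zero]
    · rw [← hef, map_mul, Wed.M_eps_ne _ hi, zero_mul, map_zero]
  obtain ⟨b, hb⟩ : ∃ b, f * b * f' ≠ 0 := by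
    by_contra! h
    apply hMf
    ext u v
    obtain ⟨b, hb⟩ := (wed φ.ker).M_surj j (Matrix.single 0 u 1)
    have h1 := congrArg ((wed φ.ker).M j) (h b)
    rw [map_mul, map_mul, hb, map_zero, show (wed φ.ker).M j f = _ from Wed.M_f _ _] at h1
    have h2 := congrFun (congrFun h1 0) v
    simpa [Matrix.single_mul_single_same] using h2
  let x := f * b * f'
  have hfx : f * x = x := by simp only [x]; rw [← mul_assoc, ← mul_assoc, ff]
  have hxf : x * f' = x := by simp only [x]; rw [mul_assoc, ff']
  obtain ⟨y0, hy0⟩ := (wed φ.ker).f_inv hfx hb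
  let y := f' * y0 * f
  have hxy : x * y = f := by
    simp only [y]; rw [← mul_assoc, ← mul_assoc, hxf, hy0]; exact ff
  have hfy : f' * y = y := by simp only [y]; rw [← mul_assoc, ← mul_assoc, ff']
  have hyf : y * f = y := by simp only [y]; rw [mul_assoc, ff]
  have hyx : y * x = f' := by
    obtain ⟨c, hc⟩ : ∃ c : ℂ, f' * (y * x) * f' = c • f' := by
      refine ⟨(wed φ.ker).M j (cj φ g⁻¹ (y * x)) 0 0, ?_⟩
      have := congrArg (cj φ g) ((wed φ.ker).f_prim j (cj φ g⁻¹ (y * x)))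
      rw [map_mul, map_mul, cj_inv, map_smul] at this
      exact this
    rw [← mul_assoc, hfy, mul_assoc, hxf] at hc
    have h2 : y * x * (y * x) = y * x := by
      rw [mul_assoc, ← mul_assoc x, hxy, hfx]
    rw [hc, smul_mul_smul_comm, ff'] at h2
    have h3 : c * c = c := smul_left_injective ℂ fne h2
    have h0 : c ≠ 0 := by
      intro h0
      rw [h0, zero_smul] at hc
      have : x * y * x = x := by rw [hxy, hfx]
      rw [mul_assoc, hc, mul_zero] at this
      exact hb this.symm
    rw [hc, mul_left_cancel₀ h0 (h3.trans (mul_one c).symm), one_smul]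
  have hF : Fj φ j = io φ f := rfl
  have h1 : φ g = 1 * φ g := (one_mul _).symm
  have hof : ofG g * io φ f = io φ f' * ofG g := of_io φ g f
  have hof' : io φ f * ofG g⁻¹ = ofG g⁻¹ * io φ f' := by
    have := io_cj φ g f
    change io φ f' = _ at this
    rw [this, ← mul_assoc, ← mul_assoc, ofG_inv_mul, one_mul]
  refine ⟨io φ x * ofG g, ofG g⁻¹ * io φ y, ?_, ?_, ?_, ?_, ?_, ?_, ?_, ?_⟩
  · rw [h1]; exact comp_mul φ (comp_io φ _) (comp_of φ g)
  · rw [← mul_one (φ g)⁻¹, ← map_inv]; exact comp_mul φ (comp_of φ _) (comp_io φ _)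
  · rw [hF, ← mul_assoc, ← map_mul, hfx]
  · rw [hF, mul_assoc, hof, ← mul_assoc, ← map_mul, hxf]
  · rw [hF, ← mul_assoc, hof', mul_assoc, ← map_mul, hfy]
  · rw [hF, mul_assoc, ← map_mul, hyf]
  · rw [hF, mul_assoc, ← mul_assoc (ofG g), ofG_mul_inv, one_mul, ← map_mul, hxy]
  · rw [hF, mul_assoc, ← mul_assoc (io φ y), ← map_mul, hyx, ← hof, ← mul_assoc, ofG_inv_mul, one_mul]
/-- inertia quotient -/
def KJ (j : Fin (wed φ.ker).n) : Subgroup H := (StabG φ j).map φ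
lemma F_comp (j : Fin (wed φ.ker).n) : Fj φ j ∈ comp φ 1 := comp_io φ _
lemma F_coeff (j : Fin (wed φ.ker).n) : (Fj φ j).coeff 1 ≠ 0 := by
  rw [Fj, io_coeff_one]
  intro h
  have := f_coeff (G := φ.ker) j
  rw [h, mul_zero] at this
  exact NeZero.ne ((wed φ.ker).d j) (by exact_mod_cast this)
lemma ker_le_StabG (j : Fin (wed φ.ker).n) : φ.ker ≤ StabG φ j := by
  intro g hg
  change ofG g * Zj φ j * ofG g⁻¹ = Zj φ j
  have : ofG g = io φ (ofG ⟨g, hg⟩) := (io_of φ ⟨g, hg⟩).symm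
  rw [this, Zj, ← map_mul, ← Wed.eps_comm, map_mul, mul_assoc, io_of]
  simp [ofG_mul_inv]
lemma mem_StabG_of (j : Fin (wed φ.ker).n) {g : G} (h : φ g ∈ KJ φ j) : g ∈ StabG φ j := by
  obtain ⟨g', h1, h2⟩ := h
  have h3 : g * g'⁻¹ ∈ φ.ker := by rw [MonoidHom.mem_ker, map_mul, map_inv, h2, mul_inv_cancel]
  have := (StabG φ j).mul_mem (ker_le_StabG φ j h3) h1
  simpa using this
theorem exists_TS (j : Fin (wed φ.ker).n) [Fintype (KJ φ j)] [DecidableEq (KJ φ j)] :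
    ∃ T : TS (CA G) (KJ φ j), T.F = Fj φ j := by
  have hex : ∀ k : KJ φ j, ∃ XY : CA G × CA G, XY.1 ∈ comp φ k ∧ XY.2 ∈ comp φ (k : H)⁻¹ ∧ Fj φ j * XY.1 = XY.1 ∧
      XY.1 * Fj φ j = XY.1 ∧
      Fj φ j * XY.2 = XY.2 ∧ XY.2 * Fj φ j = XY.2 ∧ XY.1 * XY.2 = Fj φ j ∧ XY.2 * XY.1 = Fj φ j ∧ (k = 1 → XY.1 = Fj φ j) := by
    intro k
    by_cases hk : k = 1
    · have hF := Fj_idem φ j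
      have hc := F_comp φ j
      refine ⟨(Fj φ j, Fj φ j), ?_⟩
      subst hk
      simp [hF, hc]
    · obtain ⟨g, h1, h2⟩ := k.2
      obtain ⟨X, Y, h⟩ := corner_ex φ h1
      rw [h2] at h
      exact ⟨(X, Y), by tauto⟩
  choose XY hX hY hFX hXF hFY hYF hXY hYX h1 using hex
  have hF0 := F_coeff φ j
  have hcoef : ∀ k h, (if k = h then (1 : ℂ) else 0) = ((XY h).1 * (XY k).2).coeff 1 / (Fj φ j).coeff 1 := by
    intro k h
    split_ifs with hh
    · rw [hh, hXY, div_self hF0]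
    · rw [comp_coeff_one φ _ (comp_mul φ (hX h) (hY k)), zero_div]
      intro h3; apply hh; rw [mul_inv_eq_one] at h3; exact (Subtype.ext h3).symm
  have hsc : ∀ (k : KJ φ j) a, a ∈ comp φ k → ∃ c : ℂ, Fj φ j * a * Fj φ j = c • (XY k).1 := by
    intro k a ha
    have h2 : a * (XY k).2 ∈ comp φ 1 := by
      have := comp_mul φ ha (hY k); rwa [mul_inv_cancel] at this
    obtain ⟨c, hc⟩ := corner_prim φ j h2
    refine ⟨c, ?_⟩
    calc Fj φ j * a * Fj φ j = Fj φ j * a * ((XY k).2 * (XY k).1) := by rw [hYX]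
      _ = Fj φ j * (a * (XY k).2) * Fj φ j * (XY k).1 := by
        rw [mul_assoc _ (Fj φ j) (XY k).1, hFX]; simp only [mul_assoc]
      _ = _ := by rw [hc, smul_mul_assoc, hFX]
  have hXX : ∀ g h : KJ φ j, ∃ c : ℂ, c ≠ 0 ∧ (XY g).1 * (XY h).1 = c • (XY (g * h)).1 := by
    intro g h
    obtain ⟨c, hc⟩ := hsc (g * h) _ (comp_mul φ (hX g) (hX h))
    rw [← mul_assoc, hFX, mul_assoc, hXF] at hc
    refine ⟨c, ?_, hc⟩
    rintro rfl
    rw [zero_smul] at hc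
    have : (XY g).2 * ((XY g).1 * (XY h).1) * (XY h).2 = Fj φ j := by
      rw [← mul_assoc, hYX, hFX, hXY]
    rw [hc] at this
    exact Fj_ne φ j (by simpa using this.symm)
  choose al hal hal2 using hXX
  let lk : KJ φ j → CA G →ₗ[ℂ] ℂ := fun k =>
    { toFun := fun a => (Fj φ j * a * Fj φ j * (XY k).2).coeff 1 / (Fj φ j).coeff 1
      map_add' := by
        intro x y
        rw [mul_add, add_mul, add_mul, MonoidAlgebra.coeff_add, Finsupp.add_apply, add_div]
      map_smul' := by
        intro r x
        rw [mul_smul_comm, smul_mul_assoc, smul_mul_assoc, MonoidAlgebra.coeff_smul, Finsupp.smul_apply, smul_eq_mul,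
          mul_div_assoc, RingHom.id_apply, smul_eq_mul] }
  have hlk : ∀ k a, lk k a = (Fj φ j * a * Fj φ j * (XY k).2).coeff 1 / (Fj φ j).coeff 1 := fun _ _ => rfl
  refine ⟨TS.mk (Fj φ j) (fun k => (XY k).1) al lk hal (h1 1 rfl) hal2 hFX hXF ?_ ?_, rfl⟩
  · intro a
    induction a using CA_ind with
    | h1 g =>
      by_cases hg : φ g ∈ KJ φ j
      · obtain ⟨c, hc⟩ := hsc ⟨φ g, hg⟩ (ofG g) (comp_of φ g)
        have : ∀ k, lk k (ofG g) = c * if k = ⟨φ g, hg⟩ then (1 : ℂ) else 0 := by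
          intro k
          rw [hlk, hc, hcoef, smul_mul_assoc, MonoidAlgebra.coeff_smul, Finsupp.smul_apply, smul_eq_mul, mul_div_assoc]
        simp only [this, hc]
        simp
      · have : g ∉ StabG φ j := fun h => hg ⟨g, h, rfl⟩
        simp only [hlk, corner_out φ this]
        simp
    | h2 x y hx hy => rw [mul_add, add_mul, hx, hy, ← Finset.sum_add_distrib]; simp only [map_add, add_smul]
    | h3 r x hx => rw [mul_smul_comm, smul_mul_assoc, hx, Finset.smul_sum]; simp only [map_smul, smul_assoc]
  · intro k h
    rw [hlk, hFX, hXF, hcoef]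
end

section
variable {G H : Type} [Group G] [Group H] (φ : G →* H) [Finite G]
lemma KJ_index (hφ : Function.Surjective φ) (j : Fin (wed φ.ker).n) : (KJ φ j).index = (StabG φ j).index := by
  rw [KJ, Subgroup.index_map, MonoidHom.range_eq_top.mpr hφ, Subgroup.index_top, mul_one,
    sup_eq_left.mpr (ker_le_StabG φ j)]
lemma Fj_nat (j : Fin (wed φ.ker).n) (i : Fin (wed G).n) : ∃ m : ℕ, (wed G).chi i (Fj φ j) = m :=
  (wed G).idem_nat (Fj_idem φ j) i
lemma clifford_nat {i : Fin (wed G).n} {j : Fin (wed φ.ker).n} {c : ℕ} (hc : (wed G).chi i (Fj φ j) = c)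
    (h0 : c ≠ 0) : (wed G).d i = (StabG φ j).index * ((wed φ.ker).d j * c) := by
  have := clifford φ i j (by rw [hc]; exact_mod_cast h0)
  rw [hc] at this
  exact_mod_cast this
theorem T1 (j : Fin (wed φ.ker).n) : ∃ d' ∈ charDegrees G, (StabG φ j).index * (wed φ.ker).d j ∣ d' := by
  obtain ⟨i, hi⟩ := (wed G).idem_exists (Fj_idem φ j) (Fj_ne φ j)
  obtain ⟨m, hm⟩ := Fj_nat φ j i
  have h0 : m ≠ 0 := by rintro rfl; rw [hm] at hi; simp at hi
  exact ⟨_, wed_mem i, m, by rw [clifford_nat φ hm h0, mul_assoc]⟩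
theorem pkg (hφ : Function.Surjective φ) (j : Fin (wed φ.ker).n) [Fintype (KJ φ j)] [DecidableEq (KJ φ j)] :
    ∃ (T : TS (CA G) (KJ φ j)) (c : Fin (wed G).n → ℕ), (∀ i, (wed G).chi i T.F = c i) ∧
      (∀ i, c i ≠ 0 → (wed G).d i = (KJ φ j).index * ((wed φ.ker).d j * c i)) ∧
      ∑ i, c i ^ 2 = Fintype.card (KJ φ j) ∧ ∀ i, c i ≠ 0 → c i ∣ Fintype.card (KJ φ j) := by
  obtain ⟨T, hT⟩ := exists_TS φ j
  choose c hc using Fj_nat φ j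
  rw [← hT] at hc
  refine ⟨T, c, hc, fun i hi => ?_, ?_, fun i hi => T.dvd_card (wed G) (hc i) hi⟩
  · rw [KJ_index φ hφ]; rw [hT] at hc; exact clifford_nat φ (hc i) hi
  · have := T.sq (wed G)
    simp only [hc] at this
    simp only [pow_two]
    exact_mod_cast this
lemma exists_under (i : Fin (wed G).n) : ∃ j, (wed G).chi i (Fj φ j) ≠ 0 := by
  by_contra! h
  have h1 : (wed G).chi i 1 = 0 := by
    rw [← map_one (io φ), ← Wed.sum_eps, map_sum, map_sum]
    refine Finset.sum_eq_zero fun j _ => ?_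
    have := (wed φ.ker).trl_eps j ((wed G).chi i ∘ₗ (io φ).toLinearMap) 
      (by intro a b; simp only [LinearMap.comp_apply, AlgHom.toLinearMap_apply, map_mul]; exact Wed.chi_mul_comm _ _ _ _)
    simp only [LinearMap.comp_apply, AlgHom.toLinearMap_apply] at this
    rw [this, show (wed G).chi i (io φ ((wed φ.ker).f j)) = 0 from h j, mul_zero]
  rw [Wed.chi_one] at h1
  exact NeZero.ne ((wed G).d i) (by exact_mod_cast h1)
theorem T3' (hφ : Function.Surjective φ) {t d : ℕ} (ht : t.Prime) (hd : d ∈ charDegrees G) (htd : t ∣ d) :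
    t ∣ Nat.card H ∨ ∃ n ∈ charDegrees φ.ker, t ∣ n := by
  classical
  have := Finite.of_surjective _ hφ
  have := Fintype.ofFinite H
  obtain ⟨i, rfl⟩ := cd_exists hd
  obtain ⟨j, hj⟩ := exists_under φ i
  obtain ⟨T, hT⟩ := exists_TS φ j
  obtain ⟨c, hc⟩ := Fj_nat φ j i
  have h0 : c ≠ 0 := by rintro rfl; rw [hc] at hj; simp at hj
  rw [clifford_nat φ hc h0, ← KJ_index φ hφ, mul_left_comm] at htd
  rcases (Nat.Prime.dvd_mul ht).mp htd with h | h
  · exact Or.inr ⟨_, wed_mem j, h⟩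
  · left
    refine h.trans ?_
    rw [← (KJ φ j).index_mul_card]
    rw [← hT] at hc
    have := T.dvd_card (wed G) hc h0
    rw [← Nat.card_eq_fintype_card] at this
    exact Nat.mul_dvd_mul_left _ this
lemma sum_sq : ∑ i, (wed G).d i ^ 2 = Nat.card G := by
  have h := chi_ortho (G := G) 1 1
  simp only [map_one, Wed.chi_one] at h
  have h2 : Nat.card {z : G // 1 * z * 1 = z} = Nat.card G :=
    Nat.card_congr (Equiv.subtypeUnivEquiv fun z => by simp)
  rw [h2] at h
  simp only [pow_two]
  exact_mod_cast h
theorem deg_dvd {d : ℕ} (hd : d ∈ charDegrees G) : d ∣ Nat.card G := by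
  classical
  have := Fintype.ofFinite G
  obtain ⟨i, rfl⟩ := cd_exists hd
  let φ := MonoidHom.id G
  have hk : φ.ker = ⊥ := (MonoidHom.ker_eq_bot_iff φ).mpr Function.injective_id
  have hs : ∀ j, (wed φ.ker).d j = 1 := by
    intro j
    have h1 := sum_sq (G := φ.ker)
    have hc1 : Nat.card φ.ker = 1 := by rw [hk]; simp
    rw [hc1] at h1
    have h2 := Finset.single_le_sum (f := fun i => (wed φ.ker).d i ^ 2) (fun i _ => Nat.zero_le _) (Finset.mem_univ j)
    rw [h1] at h2
    have h3 := NeZero.ne ((wed φ.ker).d j)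
    nlinarith [Nat.pos_of_ne_zero h3]
  obtain ⟨j, hj⟩ := exists_under φ i
  obtain ⟨T, hT⟩ := exists_TS φ j
  obtain ⟨c, hc⟩ := Fj_nat φ j i
  have h0 : c ≠ 0 := by rintro rfl; rw [hc] at hj; simp at hj
  rw [clifford_nat φ hc h0, ← KJ_index φ Function.surjective_id, hs, one_mul]
  rw [← (KJ φ j).index_mul_card]
  rw [← hT] at hc
  have := T.dvd_card (wed G) hc h0
  rw [← Nat.card_eq_fintype_card] at this
  exact Nat.mul_dvd_mul_left _ this
lemma cd_equiv {A B : Type} [Group A] [Group B] [Finite A] [Finite B] (e : A ≃* B) {d : ℕ} (hd : d ∈ charDegrees A) : d ∈ charDegrees B :=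
  cd_of_surj e.symm.toMonoidHom e.symm.surjective hd
theorem T1N (N : Subgroup G) [N.Normal] {d : ℕ} (hd : d ∈ charDegrees N) : ∃ d' ∈ charDegrees G, d ∣ d' := by
  have h1 := cd_equiv (MulEquiv.subgroupCongr (QuotientGroup.ker_mk' N).symm) hd
  obtain ⟨j, rfl⟩ := cd_exists h1
  obtain ⟨d', h2, h3⟩ := T1 (QuotientGroup.mk' N) j
  exact ⟨d', h2, (Dvd.intro_left _ rfl).trans h3⟩
theorem T3 (N : Subgroup G) [N.Normal] {t d : ℕ} (ht : t.Prime) (hd : d ∈ charDegrees G) (htd : t ∣ d) :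
    t ∣ N.index ∨ ∃ n ∈ charDegrees N, t ∣ n := by
  rcases T3' (QuotientGroup.mk' N) (QuotientGroup.mk'_surjective N) ht hd htd with h | ⟨n, h1, h2⟩
  · exact Or.inl h
  · exact Or.inr ⟨n, cd_equiv (MulEquiv.subgroupCongr (QuotientGroup.ker_mk' N)) h1, h2⟩
end

section
/-- numeric data about the simple group -/
structure NumD (S : Type) [Group S] (p k N r s b c a a' : ℕ) : Prop where
  hp : p.Prime
  hr : r.Prime
  hs : s.Prime
  p2 : p ≠ 2
  r2 : r ≠ 2
  s2 : s ≠ 2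
  pr : p ≠ r
  ps : p ≠ s
  rs : r ≠ s
  q : p ^ k = 2 * N + 1
  N3 : 3 ≤ N
  Nr : N = 2 ^ a * r ^ b
  Ns : N + 1 = 2 ^ a' * s ^ c
  b0 : b ≠ 0
  c0 : c ≠ 0
  cardS : Nat.card S = (2 * N + 1) * N * (2 * N + 2)
  cr : ∀ x : S, orderOf x = r → Nat.card {h : S // x * h = h * x} ≤ N
  cs : ∀ x : S, orderOf x = s → Nat.card {h : S // x * h = h * x} ≤ N + 1
variable {S : Type} [Group S] {p k N r s b c a a' : ℕ}
lemma NumD.cd (h : NumD S p k N r s b c a a') {D : ℕ} (hD : D ∣ Nat.card S) (h2 : ¬ 2 ∣ D) :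
    (¬ r ∣ D → ¬ s ∣ D → D ≤ 2 * N + 1) ∧ (¬ p ∣ D → ¬ s ∣ D → D ≤ N) ∧ (¬ p ∣ D → ¬ r ∣ D → D ≤ N + 1) := by
  have hh : Nat.card S = 2 * 2 ^ a * 2 ^ a' * (p ^ k * r ^ b * s ^ c) := by
    rw [h.cardS]
    calc (2 * N + 1) * N * (2 * N + 2) = (2 * N + 1) * N * (2 * (N + 1)) := by ring
      _ = p ^ k * (2 ^ a * r ^ b) * (2 * (2 ^ a' * s ^ c)) := by rw [← h.q, ← h.Nr, ← h.Ns]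
      _ = _ := by ring
  have c2 : Nat.Coprime D 2 := ((Nat.Prime.coprime_iff_not_dvd Nat.prime_two).mpr h2).symm
  have hD1 : D ∣ p ^ k * r ^ b * s ^ c := by
    rw [hh] at hD
    refine Nat.Coprime.dvd_of_dvd_mul_left ?_ hD
    exact (c2.mul_right (c2.pow_right a)).mul_right (c2.pow_right a')
  have N0 : 0 < N := by have := h.N3; omega
  have cop : ∀ {t e}, t.Prime → ¬ t ∣ D → Nat.Coprime D (t ^ e) := fun ht hn =>
    (((Nat.Prime.coprime_iff_not_dvd ht).mpr hn).symm).pow_right _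
  have l2 : ∀ x y : ℕ, 0 < 2 ^ x * y → y ≤ 2 ^ x * y := fun x y _ => Nat.le_mul_of_pos_left _ (by positivity)
  have lr : r ^ b ≤ N := by rw [h.Nr]; exact l2 _ _ (by rw [← h.Nr]; exact N0)
  have ls : s ^ c ≤ N + 1 := by rw [h.Ns]; exact l2 _ _ (by rw [← h.Ns]; omega)
  refine ⟨fun h1 h2 => ?_, fun h1 h2 => ?_, fun h1 h2 => ?_⟩
  · rw [← h.q]
    exact Nat.le_of_dvd (by rw [h.q]; omega) ((cop h.hr h1).dvd_of_dvd_mul_right ((cop h.hs h2).dvd_of_dvd_mul_right hD1))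
  · refine le_trans (Nat.le_of_dvd (pow_pos h.hr.pos _) ?_) lr
    exact (cop h.hp h1).dvd_of_dvd_mul_left ((cop h.hs h2).dvd_of_dvd_mul_right hD1)
  · refine le_trans (Nat.le_of_dvd (pow_pos h.hs.pos _) ?_) ls
    rw [mul_assoc] at hD1
    exact (cop h.hr h2).dvd_of_dvd_mul_left ((cop h.hp h1).dvd_of_dvd_mul_left hD1)
lemma centr_le (S : Type) [Group S] [Finite S] (K : Subgroup S) (x : K) :
    Nat.card {h : K // x * h = h * x} ≤ Nat.card {h : S // (x : S) * h = h * x} := by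
  refine Nat.card_le_card_of_injective (fun h => ⟨h.1, by have := h.2; exact_mod_cast congrArg Subtype.val this⟩) ?_
  intro h h' e
  exact Subtype.ext (Subtype.ext (Subtype.mk.inj e))
lemma count_bound {A : Type} [Ring A] [Algebra ℂ A] (W : Wed A) [Finite S] (K : Subgroup S) [Fintype K] [DecidableEq K] (T : TS A K)
    {l B : ℕ} (hl : l.Prime) (hi : ¬ l ∣ K.index) (hd : l ∣ Nat.card S)
    (hB : ∀ x : S, orderOf x = l → Nat.card {h : S // x * h = h * x} ≤ B) (c : Fin W.n → ℕ)
    (hc : ∀ i, W.chi i T.F = c i) : (Finset.univ.filter fun i => ¬ l ∣ c i).card ≤ B := by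
  have := Fact.mk hl
  rw [← K.index_mul_card] at hd
  have h1 := ((Nat.Prime.dvd_mul hl).mp hd).resolve_left hi
  obtain ⟨x, hx⟩ := exists_prime_orderOf_dvd_card' l h1
  refine (T.count W x l (by rw [← hx]; exact pow_orderOf_eq_one x) c hc).trans ((centr_le S K x).trans (hB _ ?_))
  rw [Subgroup.orderOf_coe]; exact hx
theorem T6 (h : NumD S p k N r s b c a a') {G : Type} [Group G] [Finite G] (φ : G →* S) (hφ : Function.Surjective φ)
    (npr : ∀ d ∈ charDegrees G, ¬ p * r ∣ d) (nps : ∀ d ∈ charDegrees G, ¬ p * s ∣ d)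
    (nrs : ∀ d ∈ charDegrees G, ¬ r * s ∣ d) {n : ℕ} (hn : n ∈ charDegrees φ.ker) :
    ∃ d ∈ charDegrees G, 2 * n ∣ d := by
  classical
  have := Finite.of_surjective _ hφ
  have := Fintype.ofFinite S
  obtain ⟨j, rfl⟩ := cd_exists hn
  by_contra! hno
  obtain ⟨T, c, hc, hdeg, hsum, hdvd⟩ := pkg φ hφ j
  set ix := (KJ φ j).index with hix
  have hixK : ix * Fintype.card (KJ φ j) = Nat.card S := by
    rw [← Nat.card_eq_fintype_card]; exact (KJ φ j).index_mul_card
  have hD2 : ∀ i, c i ≠ 0 → ¬ 2 ∣ ix * c i := by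
    intro i hi h2
    refine hno _ (wed_mem i) ?_
    rw [hdeg i hi, mul_left_comm, mul_comm]
    exact Nat.mul_dvd_mul_left _ h2
  have hDd : ∀ i, c i ≠ 0 → ix * c i ∣ (wed G).d i := fun i hi => by
    rw [hdeg i hi, mul_left_comm]; exact Dvd.intro_left _ rfl
  have two : ∀ {x y : ℕ}, x.Prime → y.Prime → x ≠ y → (∀ d ∈ charDegrees G, ¬ x * y ∣ d) → ∀ i, c i ≠ 0 →
      x ∣ ix * c i → ¬ y ∣ ix * c i := by
    intro x y hx hy hxy hnn i hi h1 h2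
    refine hnn _ (wed_mem i) (dvd_trans ?_ (hDd i hi))
    exact Nat.Coprime.mul_dvd_of_dvd_of_dvd ((Nat.coprime_primes hx hy).mpr hxy) h1 h2
  have tpr := two h.hp h.hr h.pr npr
  have tps := two h.hp h.hs h.ps nps
  have trs := two h.hr h.hs h.rs nrs
  have hbd := fun i (hi : c i ≠ 0) => h.cd (D := ix * c i)
    (by rw [← hixK]; exact Nat.mul_dvd_mul_left _ (hdvd i hi)) (hD2 i hi)
  have hsq : ∑ i, (ix * c i) ^ 2 = ix * Nat.card S := by
    simp only [mul_pow]
    rw [← Finset.mul_sum, hsum, ← hixK]; ring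
  have hix0 : 0 < ix := Nat.pos_of_ne_zero (KJ φ j).index_ne_zero_of_finite
  have hge : (2 * N + 1) * N * (2 * N + 2) ≤ ∑ i, (ix * c i) ^ 2 := by
    rw [hsq, h.cardS]; exact Nat.le_mul_of_pos_left _ hix0
  have hrS : r ∣ Nat.card S := by
    rw [h.cardS]; refine Dvd.dvd.mul_right (Dvd.dvd.mul_left ?_ _) _
    rw [h.Nr]; exact Dvd.dvd.mul_left (dvd_pow_self _ h.b0) _
  have hsS : s ∣ Nat.card S := by
    rw [h.cardS, show 2 * N + 2 = 2 * (N + 1) by ring]; refine Dvd.dvd.mul_left (Dvd.dvd.mul_left ?_ _) _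
    rw [h.Ns]; exact Dvd.dvd.mul_left (dvd_pow_self _ h.c0) _
  have main : ∀ x y : ℕ, (∀ i, c i ≠ 0 → (ix * c i) ^ 2 ≤ (if ¬ r ∣ c i then x else 0) + if ¬ s ∣ c i then y else 0) →
      (2 * N + 1) * N * (2 * N + 2) ≤ (Finset.univ.filter fun i => ¬ r ∣ c i).card * x +
        (Finset.univ.filter fun i => ¬ s ∣ c i).card * y := by
    intro x y hxy
    refine hge.trans ?_
    rw [← smul_eq_mul (Finset.card _), ← smul_eq_mul (Finset.card _), ← Finset.sum_const, ← Finset.sum_const, Finset.sum_filter,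
      Finset.sum_filter, ← Finset.sum_add_distrib]
    refine Finset.sum_le_sum fun i _ => ?_
    by_cases hi : c i = 0
    · simp [hi]
    · exact hxy i hi
  have N3 := h.N3
  have dvc : ∀ {l i}, l ∣ c i → l ∣ ix * c i := fun hl => Dvd.dvd.mul_left hl _
  have dvi : ∀ {l i}, l ∣ ix → l ∣ ix * c i := fun hl => Dvd.dvd.mul_right hl _
  by_cases hr : r ∣ ix
  · have hs : ¬ s ∣ ix := by
      intro hs
      have : ∃ i, c i ≠ 0 := by
        by_contra! h0
        rw [Finset.sum_eq_zero (fun i _ => by rw [h0 i, mul_zero]; rfl)] at hge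
        have hN : 0 < N := by omega
        exact absurd hge (not_le.mpr (by positivity))
      obtain ⟨i, hi⟩ := this
      exact trs i hi (dvi hr) (dvi hs)
    have h1 := main 0 (N ^ 2) (fun i hi => by
      have : ¬ s ∣ c i := fun hh => trs i hi (dvi hr) (dvc hh)
      rw [if_pos this, ite_self, zero_add]
      exact Nat.pow_le_pow_left ((hbd i hi).2.1 (fun hh => tpr i hi hh (dvi hr)) (trs i hi (dvi hr))) 2)
    have h2 := count_bound (wed G) (KJ φ j) T h.hs hs hsS h.cs c hc
    nlinarith [Nat.mul_le_mul_right (N ^ 2) h2]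
  · have hcr := count_bound (wed G) (KJ φ j) T h.hr hr hrS h.cr c hc
    by_cases hs : s ∣ ix
    · have h1 := main ((N + 1) ^ 2) 0 (fun i hi => by
        have : ¬ r ∣ c i := fun hh => trs i hi (dvc hh) (dvi hs)
        rw [if_pos this, ite_self, add_zero]
        exact Nat.pow_le_pow_left ((hbd i hi).2.2 (fun hh => tps i hi hh (dvi hs)) (fun hh => trs i hi hh (dvi hs))) 2)
      nlinarith [Nat.mul_le_mul_right ((N + 1) ^ 2) hcr]
    · have hcs := count_bound (wed G) (KJ φ j) T h.hs hs hsS h.cs c hc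
      have h1 := main ((N + 1) * (3 * N + 1)) (N ^ 2) (fun i hi => by
        by_cases h1 : r ∣ c i
        · have h2 : ¬ s ∣ c i := fun hh => trs i hi (dvc h1) (dvc hh)
          rw [if_pos h2, if_neg (not_not.mpr h1), zero_add]
          exact Nat.pow_le_pow_left ((hbd i hi).2.1 (fun hh => tpr i hi hh (dvc h1)) (trs i hi (dvc h1))) 2
        · have h1' : ¬ r ∣ ix * c i := fun hh => ((Nat.Prime.dvd_mul h.hr).mp hh).elim hr h1
          by_cases h2 : s ∣ c i
          · rw [if_pos h1, if_neg (not_not.mpr h2), add_zero]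
            have := Nat.pow_le_pow_left ((hbd i hi).2.2 (fun hh => tps i hi hh (dvc h2)) h1') 2
            nlinarith
          · have h2' : ¬ s ∣ ix * c i := fun hh => ((Nat.Prime.dvd_mul h.hs).mp hh).elim hs h2
            rw [if_pos h1, if_pos h2]
            have := Nat.pow_le_pow_left ((hbd i hi).1 h1' h2') 2
            nlinarith)
      nlinarith [Nat.mul_le_mul_right ((N + 1) * (3 * N + 1)) hcr, Nat.mul_le_mul_right (N ^ 2) hcs]
end

section
variable {F : Type} [Field F]
abbrev SL2 (F : Type) [Field F] := Matrix.SpecialLinearGroup (Fin 2) F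
lemma SL2_card [Finite F] : Nat.card (SL2 F) = Nat.card F * (Nat.card F ^ 2 - 1) := by
  have := Fintype.ofFinite F
  have h1 : Nat.card (SL2 F) = Nat.card (Matrix.GeneralLinearGroup.det : Matrix.GeneralLinearGroup (Fin 2) F →* Fˣ).ker := by
    rw [← Nat.card_range_of_injective (Matrix.SpecialLinearGroup.toGL_injective (n := Fin 2) (R := F)),
      Matrix.SpecialLinearGroup.range_toGL]
    rfl
  have h2 := (Matrix.GeneralLinearGroup.det : Matrix.GeneralLinearGroup (Fin 2) F →* Fˣ).ker.index_mul_card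
  rw [Subgroup.index_ker, MonoidHom.range_eq_top.mpr, ← h1, Matrix.card_GL_field] at h2
  · classical
    rw [Nat.card_congr (Equiv.subtypeUnivEquiv fun _ => Subgroup.mem_top _), Nat.card_eq_fintype_card (α := Fˣ),
      Fin.prod_univ_two, Fintype.card_units] at h2
    rw [Nat.card_eq_fintype_card (α := F)]
    have hq : 1 < Fintype.card F := Fintype.one_lt_card
    generalize Fintype.card F = q at *
    have : 0 < q - 1 := by omega
    apply Nat.eq_of_mul_eq_mul_left this
    rw [h2]
    obtain ⟨u, rfl⟩ : ∃ u, q = u + 2 := ⟨q - 2, by omega⟩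
    simp only [Fin.val_zero, Fin.val_one, pow_zero, pow_one]
    have e1 : (u + 2) ^ 2 - (u + 2) = (u + 2) * (u + 1) := by rw [Nat.sub_eq_iff_eq_add] <;> nlinarith
    rw [e1, show u + 2 - 1 = u + 1 by omega]; ring
  · intro u
    refine ⟨⟨!![u, 0; 0, 1], !![(u⁻¹ : Fˣ), 0; 0, 1], ?_, ?_⟩, ?_⟩
    · ext i j; fin_cases i <;> fin_cases j <;> simp [Matrix.mul_apply]
    · ext i j; fin_cases i <;> fin_cases j <;> simp [Matrix.mul_apply]
    · ext; simp [Matrix.det_fin_two]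
lemma SL2_center (A : SL2 F) : A ∈ Subgroup.center (SL2 F) ↔ A = 1 ∨ A = -1 := by
  rw [Matrix.SpecialLinearGroup.mem_center_iff]
  constructor
  · rintro ⟨r, h1, h2⟩
    simp only [Fintype.card_fin] at h1
    rcases (show r = 1 ∨ r = -1 by simpa using h1) with h | h
    · left; apply Subtype.ext; rw [← h2, h]; simp
    · right; apply Subtype.ext; rw [← h2, h]; ext i j; fin_cases i <;> fin_cases j <;> simp
  · rintro (rfl | rfl)
    · exact ⟨1, by simp, by simp⟩
    · exact ⟨-1, by simp, by ext i j; fin_cases i <;> fin_cases j <;> simp⟩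
def pj : SL2 F →* PSL2 F := QuotientGroup.mk' _
lemma pj_surj : Function.Surjective (pj (F := F)) := QuotientGroup.mk'_surjective _
lemma pj_eq {A B : SL2 F} : pj A = pj B ↔ A = B ∨ A = -B := by
  rw [eq_comm]
  change (QuotientGroup.mk B : PSL2 F) = QuotientGroup.mk A ↔ _
  rw [QuotientGroup.eq, SL2_center, inv_mul_eq_one, inv_mul_eq_iff_eq_mul, mul_neg, mul_one, @eq_comm _ B]
lemma neg_ne (h2 : (2 : F) ≠ 0) (A : SL2 F) : -A ≠ A := by
  intro h
  have h1 : (-1 : SL2 F) = 1 := by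
    have := congrArg (A⁻¹ * ·) h
    simpa using this
  have := congrArg (fun A : SL2 F => A.1 0 0) h1
  simp at this
  apply h2
  linear_combination -this
lemma PSL2_card [Finite F] (h2 : (2 : F) ≠ 0) : 2 * Nat.card (PSL2 F) = Nat.card F * (Nat.card F ^ 2 - 1) := by
  rw [← SL2_card, Subgroup.card_eq_card_quotient_mul_card_subgroup (Subgroup.center (SL2 F)), mul_comm]
  congr 1
  have : (Subgroup.center (SL2 F) : Set (SL2 F)) = {1, -1} := by
    ext A; simp [SL2_center]
  have h3 := Set.ncard_pair (neg_ne h2 1).symm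
  rw [← this] at h3
  exact h3.symm
end

section
variable {F : Type} [Field F]
lemma comm_form (X H : SL2 F) (hX : X ∉ Subgroup.center (SL2 F)) (h : X * H = H * X) :
    ∃ a b : F, H.1 = a • (1 : Matrix (Fin 2) (Fin 2) F) + b • X.1 := by
  have hd := X.2
  rw [Matrix.det_fin_two] at hd
  have h' := congrArg Subtype.val h
  change X.1 * H.1 = H.1 * X.1 at h'
  have e00 := congrFun (congrFun h' 0) 0
  have e01 := congrFun (congrFun h' 0) 1
  have e10 := congrFun (congrFun h' 1) 0
  simp only [Matrix.mul_apply, Fin.sum_univ_two] at e00 e01 e10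
  by_cases h1 : X.1 0 1 = 0
  · by_cases h2 : X.1 1 0 = 0
    · have h3 : X.1 0 0 - X.1 1 1 ≠ 0 := by
        intro h3
        apply hX
        rw [Matrix.SpecialLinearGroup.mem_center_iff]
        refine ⟨X.1 0 0, ?_, ?_⟩
        · rw [h1, zero_mul, sub_zero] at hd
          rw [Fintype.card_fin]; linear_combination hd + X.1 0 0 * h3
        · ext i j; fin_cases i <;> fin_cases j <;> simp [h1, h2]
          linear_combination h3
      rw [h1] at e01; rw [h2] at e10
      have k1 : H.1 0 1 = 0 := by
        have : (X.1 0 0 - X.1 1 1) * H.1 0 1 = 0 := by linear_combination e01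
        exact (mul_eq_zero.mp this).resolve_left h3
      have k2 : H.1 1 0 = 0 := by
        have : (X.1 0 0 - X.1 1 1) * H.1 1 0 = 0 := by linear_combination -e10
        exact (mul_eq_zero.mp this).resolve_left h3
      refine ⟨H.1 0 0 - (H.1 0 0 - H.1 1 1) / (X.1 0 0 - X.1 1 1) * X.1 0 0, (H.1 0 0 - H.1 1 1) / (X.1 0 0 - X.1 1 1), ?_⟩
      ext i j; fin_cases i <;> fin_cases j <;> simp [h1, h2, k1, k2]
      field_simp
      ring
    · refine ⟨H.1 0 0 - H.1 1 0 / X.1 1 0 * X.1 0 0, H.1 1 0 / X.1 1 0, ?_⟩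
      ext i j; fin_cases i <;> fin_cases j <;> simp [h2]
      · field_simp; linear_combination -e00
      · field_simp; linear_combination -e10
  · refine ⟨H.1 0 0 - H.1 0 1 / X.1 0 1 * X.1 0 0, H.1 0 1 / X.1 0 1, ?_⟩
    ext i j; fin_cases i <;> fin_cases j <;> simp [h1]
    · field_simp; linear_combination e00
    · field_simp; linear_combination e01
lemma SL_card_comm [Finite F] (X : SL2 F) (hX : X ∉ Subgroup.center (SL2 F)) (hp : X.1.trace ^ 2 ≠ 4) :
    Nat.card {H : SL2 F // X * H = H * X} ≤ 2 + Nat.card {m : F // 1 + m * X.1.trace + m ^ 2 ≠ 0} := by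
  classical
  choose a b hab using fun H : {H : SL2 F // X * H = H * X} => comm_form X H.1 hX H.2
  set τ := X.1.trace with hτ
  have hdX := X.2
  rw [Matrix.det_fin_two] at hdX
  rw [Matrix.trace_fin_two] at hτ
  have heq : ∀ H, a H ^ 2 + a H * b H * τ + b H ^ 2 = 1 := by
    intro H
    have := H.1.2
    rw [hab H, Matrix.det_fin_two] at this
    simp at this
    rw [hτ]
    linear_combination this - (b H) ^ 2 * hdX
  have hm : ∀ H, a H ≠ -1 → a H * (1 + b H / (a H + 1) * τ + (b H / (a H + 1)) ^ 2) = 1 - (b H / (a H + 1)) ^ 2 := by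
    intro H ha
    have ha' : a H + 1 ≠ 0 := fun h => ha (by linear_combination h)
    have h1 := heq H
    field_simp
    linear_combination (a H + 1) * h1
  have hne : ∀ H, a H ≠ -1 → 1 + b H / (a H + 1) * τ + (b H / (a H + 1)) ^ 2 ≠ 0 := by
    intro H ha h0
    have := hm H ha
    rw [h0, mul_zero] at this
    generalize b H / (a H + 1) = m at *
    apply hp
    have h1 : m ^ 2 = 1 := by linear_combination this
    have h2 : m * τ = -2 := by linear_combination h0 - h1
    calc τ ^ 2 = (m * τ) ^ 2 - (m ^ 2 - 1) * τ ^ 2 := by ring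
      _ = 4 := by rw [h2, h1]; ring
  have hinj : ∀ H H', a H = a H' → b H = b H' → H = H' := by
    intro H H' h1 h2
    apply Subtype.ext; apply Subtype.ext
    rw [hab H, hab H', h1, h2]
  let f : {H : SL2 F // X * H = H * X} → Fin 2 ⊕ {m : F // 1 + m * τ + m ^ 2 ≠ 0} := fun H =>
    if h : a H = -1 then Sum.inl (if b H = 0 then 0 else 1) else Sum.inr ⟨b H / (a H + 1), hne H h⟩
  have hf : Function.Injective f := by
    intro H H' hh
    simp only [f] at hh
    by_cases h : a H = -1
    · by_cases h' : a H' = -1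
      · rw [dif_pos h, dif_pos h'] at hh
        have e1 := heq H
        have e2 := heq H'
        rw [h] at e1; rw [h'] at e2
        have k1 : b H * (b H - τ) = 0 := by linear_combination e1
        have k2 : b H' * (b H' - τ) = 0 := by linear_combination e2
        refine hinj _ _ (h.trans h'.symm) ?_
        by_cases z : b H = 0 <;> by_cases z' : b H' = 0
        · rw [z, z']
        · simp [z, z'] at hh
        · simp [z, z'] at hh
        · have := (mul_eq_zero.mp k1).resolve_left z
          have := (mul_eq_zero.mp k2).resolve_left z'
          grind
      · rw [dif_pos h, dif_neg h'] at hh; simp at hh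
    · by_cases h' : a H' = -1
      · rw [dif_neg h, dif_pos h'] at hh; simp at hh
      · rw [dif_neg h, dif_neg h'] at hh
        have hm1 := hm H h
        have hm2 := hm H' h'
        have hn := hne H h
        simp only [Sum.inr.injEq, Subtype.mk.injEq] at hh
        rw [← hh] at hm2
        have ha : a H = a H' := mul_right_cancel₀ hn (hm1.trans hm2.symm)
        refine hinj _ _ ha ?_
        rw [← ha] at hh
        have ha' : a H + 1 ≠ 0 := fun h3 => h (by linear_combination h3)
        field_simp at hh
        exact hh
  have := Nat.card_le_card_of_injective f hf
  rwa [Nat.card_sum, Nat.card_fin] at this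
lemma PSL_card_comm [Finite F] (h2 : (2 : F) ≠ 0) {r : ℕ} (hr : Odd r) (X : SL2 F) (hX : X ^ r = 1) :
    2 * Nat.card {h : PSL2 F // pj X * h = h * pj X} ≤ Nat.card {H : SL2 F // X * H = H * X} := by
  have key : ∀ h : {h : PSL2 F // pj X * h = h * pj X}, ∃ H : SL2 F, pj H = h.1 ∧ X * H = H * X := by
    rintro ⟨h, hh⟩
    obtain ⟨H, rfl⟩ := pj_surj h
    refine ⟨H, rfl, ?_⟩
    rw [← map_mul, ← map_mul, pj_eq] at hh
    refine hh.resolve_right fun h1 => ?_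
    have h3 : H⁻¹ * X * H = - X := by rw [mul_assoc, h1, mul_neg, ← mul_assoc]; simp
    have h4 : (H⁻¹ * X * H) ^ r = 1 := by
      have := conj_pow (i := r) (a := H⁻¹) (b := X)
      rw [inv_inv] at this
      rw [this, hX]; simp
    rw [h3, hr.neg_pow, hX] at h4
    exact neg_ne h2 _ h4
  choose L hL hL2 using key
  have h1 : Function.Injective (fun x : Bool × {h : PSL2 F // pj X * h = h * pj X} =>
      (⟨if x.1 then L x.2 else - L x.2, by split_ifs <;> simp [hL2]⟩ : {H : SL2 F // X * H = H * X})) := by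
    rintro ⟨u, h⟩ ⟨u', h'⟩ he
    simp only [Subtype.mk.injEq] at he
    have hneg : ∀ A : SL2 F, pj (-A) = pj A := fun A => pj_eq.mpr (Or.inr rfl)
    have hh : h = h' := by
      have := congrArg pj he
      apply Subtype.ext
      split_ifs at this <;> simpa [hneg, hL] using this
    subst hh
    have := neg_ne h2 (L h)
    cases u <;> cases u' <;> simp at he ⊢
    · exact this he
    · exact this he.symm
  have := Nat.card_le_card_of_injective _ h1
  rw [Nat.card_prod] at this
  simpa using this
end

section
variable {F : Type} [Field F]
lemma pj_neg (A : SL2 F) : pj (-A) = pj A := pj_eq.mpr (Or.inr rfl)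
lemma lift_odd {r : ℕ} (hr : Odd r) {x : PSL2 F} (hx : x ^ r = 1) : ∃ X : SL2 F, pj X = x ∧ X ^ r = 1 := by
  obtain ⟨X, rfl⟩ := pj_surj x
  rw [← map_pow, ← map_one (pj (F := F)), pj_eq] at hx
  rcases hx with h | h
  · exact ⟨X, rfl, h⟩
  · exact ⟨-X, pj_neg X, by rw [hr.neg_pow, h, neg_neg]⟩
lemma SL_CH (X : SL2 F) : X.1 * X.1 = X.1.trace • X.1 - 1 := by
  have hdX := X.2
  rw [Matrix.det_fin_two] at hdX
  ext i j; fin_cases i <;> fin_cases j <;> simp [Matrix.mul_apply, Matrix.trace_fin_two] <;> first | (ring; done) | linear_combination -hdX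
lemma tr_ne {p : ℕ} [Fact p.Prime] [CharP F p] {l : ℕ} (hl : l.Prime) (hlp : l ≠ p) (X : SL2 F) (hX : orderOf (pj X) = l) :
    X.1.trace ^ 2 ≠ 4 := by
  intro h
  have hp : p.Prime := Fact.out
  obtain ⟨ε, h1, h2⟩ : ∃ ε : F, ε ^ 2 = 1 ∧ X.1.trace = 2 * ε := by
    have : (X.1.trace - 2) * (X.1.trace + 2) = 0 := by linear_combination h
    rcases mul_eq_zero.mp this with h | h
    · exact ⟨1, by ring, by linear_combination h⟩
    · exact ⟨-1, by ring, by linear_combination h⟩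
  have h3 : (X.1 - ε • 1) ^ 2 = 0 := by
    rw [pow_two, sub_mul, mul_sub, mul_sub, SL_CH, h2]
    simp only [mul_smul_comm, smul_mul_assoc, mul_one, one_mul, smul_smul]
    rw [show ε * ε = 1 by rw [← pow_two, h1]]
    module
  have h4 : (X.1 - ε • 1) ^ p = 0 := by
    obtain ⟨m, hm⟩ := Nat.exists_eq_add_of_le hp.two_le
    rw [hm, pow_add, h3, zero_mul]
  rw [sub_pow_char_of_commute (p := p) ((Commute.one_right X.1).smul_right ε), smul_pow, one_pow, sub_eq_zero] at h4
  have h5 : ε ^ p = 1 ∨ ε ^ p = -1 := by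
    have : (ε ^ p) ^ 2 = 1 := by rw [← pow_mul, mul_comm, pow_mul, h1, one_pow]
    simpa using this
  have h6 : X ^ p = 1 ∨ X ^ p = -1 := by
    rcases h5 with h5 | h5
    · left; apply Subtype.ext; rw [Matrix.SpecialLinearGroup.coe_pow, h4, h5]; simp
    · right; apply Subtype.ext; rw [Matrix.SpecialLinearGroup.coe_pow, h4, h5]; simp
  have h7 : pj X ^ p = 1 := by rw [← map_pow, ← map_one (pj (F := F)), pj_eq]; exact h6
  have h8 := orderOf_dvd_of_pow_eq_one h7
  rw [hX] at h8
  exact hlp ((Nat.prime_dvd_prime_iff_eq hl hp).mp h8)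
lemma split_root [Fintype F] (X : SL2 F) (hX : X ^ (Fintype.card F - 1) = 1) : ∃ u : F, u ^ 2 - X.1.trace * u + 1 = 0 := by
  open Polynomial in
  have h1 : (X ^ Fintype.card F) = X := by
    have : Fintype.card F = Fintype.card F - 1 + 1 := by have := Fintype.card_pos (α := F); omega
    rw [this, pow_succ, hX, one_mul]
  have h2 : aeval X.1 (Polynomial.X ^ Fintype.card F - Polynomial.X : F[X]) = 0 := by
    rw [map_sub, map_pow, aeval_X, ← Matrix.SpecialLinearGroup.coe_pow, h1, sub_self]
  have h3 := Polynomial.C_leadingCoeff_mul_prod_multiset_X_sub_C (p := (Polynomial.X ^ Fintype.card F - Polynomial.X : F[X]))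
    (by rw [FiniteField.roots_X_pow_card_sub_X, FiniteField.X_pow_card_sub_X_natDegree_eq F Fintype.one_lt_card]; rfl)
  rw [FiniteField.roots_X_pow_card_sub_X, ((show (Polynomial.X ^ Fintype.card F - Polynomial.X : F[X]).leadingCoeff = 1 from
      Polynomial.Monic.leadingCoeff (Polynomial.monic_X_pow_sub (by rw [degree_X]; exact_mod_cast Fintype.one_lt_card (α := F))))),
    map_one, one_mul] at h3
  have h4 : (Matrix.detMonoidHom.comp ((aeval X.1 : F[X] →ₐ[F] _) : F[X] →* Matrix (Fin 2) (Fin 2) F)) (Polynomial.X ^ Fintype.card F - Polynomial.X : F[X]) = 0 := by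
    change (aeval X.1 _).det = 0
    rw [h2, Matrix.det_zero]
  rw [← h3, map_multiset_prod, Multiset.prod_eq_zero_iff, Multiset.mem_map] at h4
  obtain ⟨P, hP, h5⟩ := h4
  obtain ⟨u, _, rfl⟩ := Multiset.mem_map.mp hP
  refine ⟨u, ?_⟩
  change (aeval X.1 _).det = 0 at h5
  rw [map_sub, aeval_X, aeval_C, Matrix.det_fin_two] at h5
  have hdX := X.2
  rw [Matrix.det_fin_two] at hdX
  simp [Matrix.trace_fin_two, Matrix.algebraMap_matrix_apply] at h5 ⊢
  linear_combination h5 - hdX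
variable [Fintype F] {p : ℕ} [Fact p.Prime] [CharP F p] 
lemma centr_base (h2 : (2 : F) ≠ 0) {l : ℕ} (hl : l.Prime) (ho : Odd l) (hlp : l ≠ p) (x : PSL2 F) (hx : orderOf x = l) :
    ∃ X : SL2 F, X.1.trace ^ 2 ≠ 4 ∧ X ^ l = 1 ∧ 
      2 * Nat.card {h : PSL2 F // x * h = h * x} ≤ 2 + Nat.card {m : F // 1 + m * X.1.trace + m ^ 2 ≠ 0} := by
  obtain ⟨X, rfl, hX⟩ := lift_odd ho (hx ▸ pow_orderOf_eq_one x)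
  have h4 := tr_ne (p := p) hl hlp X hx
  refine ⟨X, h4, hX, (PSL_card_comm h2 ho X hX).trans (SL_card_comm X ?_ h4)⟩
  intro hc
  have : pj X = 1 := (QuotientGroup.eq_one_iff X).mpr hc
  rw [this, orderOf_one] at hx
  exact hl.one_lt.ne hx
lemma centr_s {N : ℕ} (hN : Fintype.card F = 2 * N + 1) (h2 : (2 : F) ≠ 0) {l : ℕ} (hl : l.Prime) (ho : Odd l) (hlp : l ≠ p) (x : PSL2 F) (hx : orderOf x = l) :
    Nat.card {h : PSL2 F // x * h = h * x} ≤ N + 1 := by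
  obtain ⟨X, h4, _, h5⟩ := centr_base (p := p) h2 hl ho hlp x hx
  have h6 : Nat.card {m : F // 1 + m * X.1.trace + m ^ 2 ≠ 0} ≤ Nat.card F := Finite.card_subtype_le _
  rw [Nat.card_eq_fintype_card (α := F), hN] at h6
  omega
lemma centr_r {N : ℕ} (hN0 : 0 < N) (hN : Fintype.card F = 2 * N + 1) (h2 : (2 : F) ≠ 0) {l : ℕ} (hl : l.Prime) (ho : Odd l) (hlp : l ≠ p) (hd : l ∣ N) (x : PSL2 F) (hx : orderOf x = l) :
    Nat.card {h : PSL2 F // x * h = h * x} ≤ N := by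
  classical
  obtain ⟨X, h4, hX, h5⟩ := centr_base (p := p) h2 hl ho hlp x hx
  obtain ⟨u, hu⟩ := split_root X (by
    rw [hN]; obtain ⟨m, rfl⟩ := hd
    rw [show 2 * (l * m) + 1 - 1 = l * (2 * m) by rw [Nat.add_sub_cancel]; ring, pow_mul, hX, one_pow])
  have h6 : Nat.card {m : F // 1 + m * X.1.trace + m ^ 2 ≠ 0} ≤ Fintype.card F - 2 := by
    rw [Nat.card_eq_fintype_card, Fintype.card_subtype]
    have hne : -u ≠ u - X.1.trace := by
      intro h; apply h4
      have : X.1.trace = 2 * u := by linear_combination h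
      rw [this] at hu ⊢
      linear_combination -4 * hu
    have hcc := Finset.card_compl ({-u, u - X.1.trace} : Finset F)
    rw [Finset.card_pair hne] at hcc
    refine le_trans (Finset.card_le_card ?_) hcc.le
    intro m hm
    rw [Finset.mem_filter] at hm
    rw [Finset.mem_compl, Finset.mem_insert, Finset.mem_singleton]
    rintro (rfl | rfl)
    · apply hm.2; linear_combination hu
    · apply hm.2; linear_combination hu
  omega
end

section FT
variable {R : Type} [CommRing R] [Fintype R] [DecidableEq R] {A : Type} [Ring A] [Algebra ℂ A]
noncomputable def ft (ψ : AddChar R ℂ) (z : R → A) (j : R) : A :=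
  (Fintype.card R : ℂ)⁻¹ • ∑ k, ψ (j * (-k)) • z k
variable {ψ : AddChar R ℂ} {z : R → A}
lemma z_ft (hz : ∀ k l, z k * z l = z (k + l)) (k j : R) : z k * ft ψ z j = ψ (j * k) • ft ψ z j := by
  rw [ft, mul_smul_comm, Finset.mul_sum, smul_comm (ψ (j * k)) _ (∑ k, ψ (j * (-k)) • z k), Finset.smul_sum (r := ψ (j * k))]
  refine congrArg (fun y : A => (Fintype.card R : ℂ)⁻¹ • y) (Fintype.sum_equiv (Equiv.addLeft k) _ _ fun l => ?_)
  rw [mul_smul_comm, hz, smul_smul, ← AddChar.map_add_eq_mul]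
  simp only [Equiv.coe_addLeft]
  congr 2; ring
lemma ft_z (hz : ∀ k l, z k * z l = z (k + l)) (k j : R) : ft ψ z j * z k = ψ (j * k) • ft ψ z j := by
  rw [← z_ft hz, ft, smul_mul_assoc, mul_smul_comm, Finset.mul_sum, Finset.sum_mul]
  congr 1
  refine Finset.sum_congr rfl fun l _ => ?_
  rw [mul_smul_comm, smul_mul_assoc, hz, hz, add_comm]
lemma ft_mul (hψ : ψ.IsPrimitive) (hz : ∀ k l, z k * z l = z (k + l)) (j l : R) :
    ft ψ z j * ft ψ z l = if j = l then ft ψ z j else 0 := by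
  have h : ft ψ z j * ft ψ z l = ((Fintype.card R : ℂ)⁻¹ * ∑ k, ψ (k * (l - j))) • ft ψ z l := by
    conv_lhs => rw [ft, smul_mul_assoc, Finset.sum_mul]
    rw [mul_smul, Finset.sum_smul]
    congr 1
    refine Finset.sum_congr rfl fun k _ => ?_
    rw [smul_mul_assoc, z_ft hz, smul_smul, ← AddChar.map_add_eq_mul]
    congr 2; ring
  rw [h, AddChar.sum_mulShift _ hψ]
  have hc : (Fintype.card R : ℂ) ≠ 0 := by simp
  by_cases hjl : j = l
  · subst hjl; simp [hc]
  · rw [if_neg (sub_ne_zero.2 (Ne.symm hjl)), if_neg hjl]; simp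
lemma ft_sum (hψ : ψ.IsPrimitive) (h0 : z 0 = 1) : ∑ j, ft ψ z j = 1 := by
  have hc : (Fintype.card R : ℂ) ≠ 0 := by simp
  simp only [ft]
  rw [← Finset.smul_sum, Finset.sum_comm]
  rw [Finset.sum_congr rfl (fun k _ => (Finset.sum_smul (f := fun j => ψ (j * (-k))) (s := Finset.univ) (x := z k)).symm)]
  rw [Finset.sum_congr rfl (fun k _ => by rw [AddChar.sum_mulShift _ hψ])]
  rw [Finset.sum_eq_single 0]
  · simp [hc, h0]
  · intro b _ hb; rw [if_neg (neg_ne_zero.2 hb)]; simp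
  · simp
lemma ft_conj {x : A} (u : Rˣ) (h : ∀ k, x * z k = z (u * k) * x) (j : R) :
    x * ft ψ z j = ft ψ z (j * ↑u⁻¹) * x := by
  rw [ft, ft, mul_smul_comm, smul_mul_assoc, Finset.mul_sum, Finset.sum_mul]
  congr 1
  refine Fintype.sum_equiv (Units.mulLeft u) _ _ fun l => ?_
  rw [mul_smul_comm, smul_mul_assoc, h]
  simp only [Units.mulLeft_apply]
  congr 2
  have : (↑u⁻¹ : R) * u = 1 := by simp
  linear_combination (j * l) * this
end FT
namespace Wed
variable {A : Type} [Ring A] [Algebra ℂ A] (W : Wed A)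
lemma rank_le {e f : A} (he : e * e = e) (hf : f * f = f) {ι : Type} [Fintype ι] (v : ι → A)
    (hv : ∀ a, e * a * f ∈ Submodule.span ℂ (Set.range v)) {c c' : Fin W.n → ℕ}
    (hc : ∀ i, W.chi i e = c i) (hc' : ∀ i, W.chi i f = c' i) :
    ∑ i, c i * c' i ≤ Fintype.card ι := by
  haveI := W.fd
  set P := LinearMap.mulLeft ℂ e ∘ₗ LinearMap.mulRight ℂ f with hP
  have h1 : IsIdempotentElem P := by
    ext a
    simp only [hP, LinearMap.mulLeft_apply, LinearMap.mulRight_apply, LinearMap.comp_apply,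
      Module.End.mul_apply]
    simp only [← mul_assoc]
    rw [he, mul_assoc _ f f, hf]
  have h2 : LinearMap.trace ℂ A P = Module.finrank ℂ (LinearMap.range P) :=
    (LinearMap.IsIdempotentElem.isProj_range P h1).trace
  rw [hP, W.trace_two, ← hP] at h2
  have h3 : Module.finrank ℂ (LinearMap.range P) ≤ Fintype.card ι := by
    have : LinearMap.range P ≤ Submodule.span ℂ (Set.range v) := by
      rintro _ ⟨a, rfl⟩
      have := hv a
      rwa [mul_assoc] at this
    exact (Submodule.finrank_mono this).trans (finrank_range_le_card v)
  have h4 : (∑ i, c i * c' i : ℕ) = Module.finrank ℂ (LinearMap.range P) := by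
    have : ((∑ i, c i * c' i : ℕ) : ℂ) = (Module.finrank ℂ (LinearMap.range P) : ℂ) := by
      rw [← h2]; push_cast; simp [hc, hc']
    exact_mod_cast this
  omega
lemma comm_rank {e : A} (hcm : ∀ a b, (e * a * e) * (e * b * e) = (e * b * e) * (e * a * e))
    (he : e * e = e) {i} {m : ℕ} (hm : W.chi i e = m) : m ≤ 1 := by
  set P := W.M i e with hP
  have hPP : P * P = P := by rw [hP, ← map_mul, he]
  have hc : ∀ X Y, P * X * P * Y * P = P * Y * P * X * P := by
    intro X Y
    obtain ⟨a, rfl⟩ := W.M_surj i X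
    obtain ⟨b, rfl⟩ := W.M_surj i Y
    have h := congrArg (W.M i) (hcm a b)
    simp only [map_mul, ← hP] at h
    have k : ∀ X Y, P * X * P * Y * P = P * X * P * (P * Y * P) := fun X Y => by
      simp only [← mul_assoc]; rw [mul_assoc (P * X) P P, hPP]
    rw [k, k, h]
  have hen : ∀ a k l x j b, P a k * P l x * P j b = P a x * P j k * P l b := by
    intro a k l x j b
    have h := congrFun (congrFun (hc (Matrix.single k l 1) (Matrix.single x j 1)) a) b
    have e1 : ∀ k l x j, (P * Matrix.single k l (1 : ℂ) * P * Matrix.single x j (1 : ℂ) * P : Matrix (Fin (W.d i)) (Fin (W.d i)) ℂ) a b = P a k * P l x * P j b := by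
      intro k l x j
      rw [Matrix.mul_apply]
      simp [Matrix.mul_apply, Matrix.single_apply, Finset.sum_mul, Finset.mul_sum, ite_and]
    rw [e1, e1] at h
    exact h
  have hPa : ∀ a b, ∑ x, P a x * P x b = P a b := fun a b => by
    rw [← Matrix.mul_apply, hPP]
  have htr : ∑ a, P a a = m := by rw [← hm]; rfl
  have h1 : ∀ l x j b, (m : ℂ) * (P l x * P j b) = P j x * P l b := by
    intro l x j b
    rw [← htr, Finset.sum_mul, ← hPa j x, Finset.sum_mul]
    exact Finset.sum_congr rfl fun a _ => by linear_combination hen a a l x j b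
  have h2 : ∀ j b, (m : ℂ) * (m * P j b) = P j b := by
    intro j b
    have : (m : ℂ) * P j b = ∑ a, P a a * P j b := by rw [← Finset.sum_mul, htr]
    rw [this, Finset.mul_sum]
    conv_rhs => rw [← hPa j b]
    exact Finset.sum_congr rfl fun a _ => h1 a a j b
  have h3 : (m : ℂ) * (m * m) = m := by
    have : (m : ℂ) * (m * ∑ a, P a a) = ∑ a, P a a := by
      rw [Finset.mul_sum, Finset.mul_sum]
      exact Finset.sum_congr rfl fun a _ => h2 a a
    rwa [htr] at this
  have h4 : m * (m * m) = m := by exact_mod_cast h3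
  nlinarith
end Wed

structure BN (S : Type) [Group S] (F : Type) [Field F] (N : ℕ) where
  n : F → S
  t : S
  w : S
  g : Fˣ
  sg : S → S
  n_add : ∀ b c, n b * n c = n (b + c)
  n0 : n 0 = 1
  tN : t ^ N = 1
  tn : ∀ b, t * n b = n ((g ^ 2 : Fˣ) * b) * t
  wt : w * t = t⁻¹ * w
  bru : ∀ s, ∃ b, ∃ m : ℕ, s = n b * t ^ m ∨ ∃ c, s = n b * t ^ m * w * n c
  nt : ∀ b (m : ℕ), n b * t ^ m = 1 → b = 0 ∧ N ∣ m
  opp : ∀ b c (m : ℕ), w⁻¹ * n b * w = n c * t ^ m → b = 0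
  sg_mul : ∀ x y, sg (x * y) = sg y * sg x
  sg_n : ∀ b, sg (n b) = n b
  sg_t : sg t = t⁻¹
  sg_w : sg w = w
  gen : ∀ x : Fˣ, x ∈ Subgroup.zpowers g
  cF : Nat.card F = 2 * N + 1
  N3 : 3 ≤ N
  cS : Nat.card S = (2 * N + 1) * N * (2 * N + 2)

lemma span_of {S : Type} [Group S] {ι : Type} {v : ι → CA S} {e f : CA S}
    (h : ∀ s, e * ofG s * f ∈ Submodule.span ℂ (Set.range v)) (a : CA S) :
    e * a * f ∈ Submodule.span ℂ (Set.range v) := by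
  induction a using CA_ind with
  | h1 g => exact h g
  | h2 x y hx hy => rw [mul_add, add_mul]; exact Submodule.add_mem _ hx hy
  | h3 c x hx => rw [mul_smul_comm, smul_mul_assoc]; exact Submodule.smul_mem _ _ hx
namespace BN
variable {S : Type} [Group S] {F : Type} [Field F] [Fintype F] [DecidableEq F] {N : ℕ} [NeZero N] (B : BN S F N)
lemma tm (m : ℕ) (b : F) : B.t ^ m * B.n b = B.n ((B.g ^ (2 * m) : Fˣ) * b) * B.t ^ m := by
  induction m generalizing b with
  | zero => simp
  | succ m ih =>
    rw [pow_succ, mul_assoc, B.tn, ← mul_assoc, ih, mul_assoc]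
    congr 2
    rw [mul_add, pow_add]; push_cast; ring
lemma wtm (m : ℕ) : B.w * B.t ^ m = (B.t ^ m)⁻¹ * B.w := by
  induction m with
  | zero => simp
  | succ m ih => rw [pow_succ, ← mul_assoc, ih, mul_assoc, B.wt, mul_inv_rev, ← mul_assoc, ← mul_inv_rev, ← mul_inv_rev, ← pow_succ, ← pow_succ']
lemma ordg : orderOf B.g = 2 * N := by
  rw [orderOf_eq_card_of_forall_mem_zpowers B.gen, Nat.card_units, B.cF]; rfl
lemma tm_one {m : ℕ} (h : N ∣ m) : B.t ^ m = 1 := by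
  obtain ⟨c, rfl⟩ := h; rw [pow_mul, B.tN, one_pow]
lemma tm_iff {m : ℕ} : B.t ^ m = 1 ↔ N ∣ m :=
  ⟨fun h => (B.nt 0 m (by rw [h, B.n0, mul_one])).2, B.tm_one⟩
lemma g2 {m : ℕ} (h : B.g ^ (2 * m) = 1) : N ∣ m := by
  have := orderOf_dvd_of_pow_eq_one h
  rw [B.ordg] at this
  exact Nat.dvd_of_mul_dvd_mul_left two_pos this
noncomputable def zU (b : F) : CA S := ofG (B.n b)
noncomputable def zT (m : ZMod N) : CA S := ofG (B.t ^ m.val)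
lemma zU_mul (b c : F) : B.zU b * B.zU c = B.zU (b + c) := by
  rw [zU, zU, zU, ← map_mul, B.n_add]
lemma zU0 : B.zU 0 = 1 := by rw [zU, B.n0, map_one]
lemma zT_cast (m : ℕ) : B.zT (m : ZMod N) = ofG (B.t ^ m) := by
  rw [zT, ZMod.val_natCast]
  congr 1
  exact (pow_eq_pow_mod m B.tN).symm
lemma zT_mul (b c : ZMod N) : B.zT b * B.zT c = B.zT (b + c) := by
  conv_rhs => rw [← ZMod.natCast_zmod_val b, ← ZMod.natCast_zmod_val c, ← Nat.cast_add, zT_cast]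
  rw [zT, zT, ← map_mul, pow_add]
lemma zT0 : B.zT 0 = 1 := by simp [zT]
variable (ψ : AddChar F ℂ)
noncomputable def U (a : F) : CA S := ft ψ B.zU a
noncomputable def T (j : ZMod N) : CA S := ft ZMod.stdAddChar B.zT j
noncomputable def E (j : ZMod N) : CA S := B.U ψ 0 * B.T j
variable {ψ}
lemma T_mul (j l) : B.T j * B.T l = if j = l then B.T j else 0 :=
  ft_mul (ZMod.isPrimitive_stdAddChar N) B.zT_mul j l
lemma T_sum : ∑ j, B.T j = 1 := ft_sum (ZMod.isPrimitive_stdAddChar N) B.zT0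
lemma tU (m : ℕ) (a : F) : ofG (B.t ^ m) * B.U ψ a = B.U ψ (a * ↑(B.g ^ (2 * m))⁻¹) * ofG (B.t ^ m) := by
  refine ft_conj (B.g ^ (2 * m)) (fun k => ?_) a
  rw [zU, zU, ← map_mul, ← map_mul, B.tm]
lemma tU0 (m : ℕ) : ofG (B.t ^ m) * B.U ψ 0 = B.U ψ 0 * ofG (B.t ^ m) := by
  rw [tU, zero_mul]
lemma TU (j) : B.T j * B.U ψ 0 = B.U ψ 0 * B.T j := by
  rw [T, ft, smul_mul_assoc, mul_smul_comm, Finset.sum_mul, Finset.mul_sum]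
  congr 1
  refine Finset.sum_congr rfl fun k _ => ?_
  rw [smul_mul_assoc, mul_smul_comm, zT, tU0]
lemma nU (b a) : ofG (B.n b) * B.U ψ a = ψ (a * b) • B.U ψ a := z_ft B.zU_mul b a
lemma Un (b a) : B.U ψ a * ofG (B.n b) = ψ (a * b) • B.U ψ a := ft_z B.zU_mul b a
lemma En (j b) : B.E ψ j * ofG (B.n b) = B.E ψ j := by
  rw [E, ← TU, mul_assoc, Un, zero_mul]; simp
lemma nE (j b) : ofG (B.n b) * B.E ψ j = B.E ψ j := by
  rw [E, ← mul_assoc, nU, zero_mul]; simp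
lemma Et (j) (m : ℕ) : B.E ψ j * ofG (B.t ^ m) = ZMod.stdAddChar (j * (m : ZMod N)) • B.E ψ j := by
  rw [E, mul_assoc, ← zT_cast, T, ft_z B.zT_mul, mul_smul_comm]
lemma tE (j) (m : ℕ) : ofG (B.t ^ m) * B.E ψ j = ZMod.stdAddChar (j * (m : ZMod N)) • B.E ψ j := by
  rw [E, ← TU, ← mul_assoc, ← zT_cast, T, z_ft B.zT_mul, smul_mul_assoc]
lemma smul_cancel {x : CA S} {c c' : ℂ} (h : c • x = c' • x) (hc : c ≠ c') : x = 0 := by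
  have : (c - c') • x = 0 := by rw [sub_smul, h, sub_self]
  exact (smul_eq_zero.1 this).resolve_left (sub_ne_zero.2 hc)
/- general: vector fixed by U, eigen for t -/
lemma EwE {e' : CA S} {m' : ℕ} (ht : ofG B.t * e' = ZMod.stdAddChar (m' : ZMod N) • e')
    (hm : (m' : ZMod N) ≠ -1) : B.E ψ 1 * ofG B.w * e' = 0 := by
  have h1 : B.E ψ 1 * ofG B.w * (ofG B.t * e') = ZMod.stdAddChar (-1 : ZMod N) • (B.E ψ 1 * ofG B.w * e') := by
    have : ofG B.w * ofG B.t = ofG (B.t ^ (N - 1)) * ofG B.w := by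
      rw [← map_mul, ← map_mul, B.wt]
      congr 2
      refine inv_eq_of_mul_eq_one_right ?_
      rw [← pow_succ', Nat.sub_add_cancel NeZero.one_le, B.tN]
    rw [mul_assoc, ← mul_assoc (ofG B.w), this, ← mul_assoc, ← mul_assoc, Et]
    rw [Nat.cast_sub NeZero.one_le]
    simp [mul_assoc]
  rw [ht, mul_smul_comm] at h1
  exact smul_cancel h1 fun h => hm (ZMod.injective_stdAddChar h)
end BN

noncomputable def c1 {S : Type} [Group S] : CA S →ₗ[ℂ] ℂ where
  toFun y := y.coeff 1
  map_add' x y := by rw [MonoidAlgebra.coeff_add, Finsupp.add_apply]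
  map_smul' c x := by rw [MonoidAlgebra.coeff_smul_apply]; rfl
lemma c1_of {S : Type} [Group S] [DecidableEq S] (s : S) : c1 (ofG s) = if s = 1 then 1 else 0 := by
  show (ofG s).coeff 1 = _
  rw [ofG_eq, MonoidAlgebra.coeff_single, Finsupp.single_apply]
namespace BN
variable {S : Type} [Group S] {F : Type} [Field F] [Fintype F] [DecidableEq F] {N : ℕ} [NeZero N] (B : BN S F N)
variable {ψ : AddChar F ℂ}
lemma c1_U (a : F) : c1 (B.U ψ a) = (2 * N + 1 : ℂ)⁻¹ := by
  classical
  have hc : (Fintype.card F : ℂ) = 2 * N + 1 := by rw [← Nat.card_eq_fintype_card, B.cF]; push_cast; ring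
  rw [U, ft, map_smul, map_sum, Finset.sum_eq_single 0, hc]
  · have h1 : c1 (1 : CA S) = 1 := by rw [← map_one ofG, c1_of, if_pos rfl]
    simp [zU0, h1]
  · intro b _ hb
    rw [map_smul, zU, c1_of, if_neg, smul_zero]
    intro h
    exact hb (B.nt b 0 (by simpa using h)).1
  · simp
lemma c1_E (j) : c1 (B.E ψ j) = (2 * N + 1 : ℂ)⁻¹ * (N : ℂ)⁻¹ := by
  classical
  have hc : (Fintype.card F : ℂ) = 2 * N + 1 := by rw [← Nat.card_eq_fintype_card, B.cF]; push_cast; ring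
  rw [E, U, T, ft, ft, smul_mul_smul_comm, map_smul, hc, ZMod.card, Finset.sum_mul_sum, map_sum, smul_eq_mul]
  conv_rhs => rw [← mul_one (_ * _)]
  congr 1
  rw [Finset.sum_eq_single 0, map_sum, Finset.sum_eq_single 0]
  · have h1 : c1 (1 : CA S) = 1 := by rw [← map_one ofG, c1_of, if_pos rfl]
    simp [zU0, zT0, h1]
  · intro m _ hm
    rw [smul_mul_smul_comm, map_smul, zU, zT, ← map_mul, c1_of, if_neg, smul_zero]
    intro h
    have := (B.nt _ _ h).2
    rw [← ZMod.natCast_eq_zero_iff, ZMod.natCast_zmod_val] at this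
    exact hm this
  · simp
  · intro b _ hb
    rw [map_sum]
    refine Finset.sum_eq_zero fun m _ => ?_
    rw [smul_mul_smul_comm, map_smul, zU, zT, ← map_mul, c1_of, if_neg, smul_zero]
    intro h
    exact hb (B.nt _ _ h).1
  · simp
lemma U_mul (hψ : ψ.IsPrimitive) (j l) : B.U ψ j * B.U ψ l = if j = l then B.U ψ j else 0 := ft_mul hψ B.zU_mul j l
lemma U_idem (hψ : ψ.IsPrimitive) (j) : B.U ψ j * B.U ψ j = B.U ψ j := by rw [U_mul B hψ, if_pos rfl]
lemma U_sum (hψ : ψ.IsPrimitive) : ∑ j, B.U ψ j = 1 := ft_sum hψ B.zU0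
lemma E_mul (hψ : ψ.IsPrimitive) (j l) : B.E ψ j * B.E ψ l = if j = l then B.E ψ j else 0 := by
  rw [E, E, mul_assoc, ← mul_assoc (B.T j), TU, mul_assoc, ← mul_assoc, U_idem B hψ, T_mul]
  split_ifs <;> simp
lemma E_idem (hψ : ψ.IsPrimitive) (j) : B.E ψ j * B.E ψ j = B.E ψ j := by rw [E_mul B hψ, if_pos rfl]
lemma E_ne (hψ : ψ.IsPrimitive) (j) : B.E ψ j ≠ 0 := by
  intro h
  have h1 := B.c1_E (ψ := ψ) j
  rw [h, map_zero] at h1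
  have h2 : (2 * N + 1 : ℂ) ≠ 0 := by exact_mod_cast Nat.succ_ne_zero (2 * N)
  have h3 : (N : ℂ) ≠ 0 := by exact_mod_cast NeZero.ne N
  exact mul_ne_zero (inv_ne_zero h2) (inv_ne_zero h3) h1.symm
lemma E1_prim (hψ : ψ.IsPrimitive) (a : CA S) : ∃ c : ℂ, B.E ψ 1 * a * B.E ψ 1 = c • B.E ψ 1 := by
  have h := span_of (v := fun _ : Unit => B.E ψ 1) (e := B.E ψ 1) (f := B.E ψ 1) (fun s => ?_) a
  · simp only [Set.range_const, Submodule.mem_span_singleton] at h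
    obtain ⟨c, hc⟩ := h; exact ⟨c, hc.symm⟩
  simp only [Set.range_const, Submodule.mem_span_singleton]
  obtain ⟨b, m, rfl | ⟨c, rfl⟩⟩ := B.bru s
  · rw [map_mul, ← mul_assoc, En, Et, smul_mul_assoc, E_idem B hψ]; exact ⟨_, rfl⟩
  · refine ⟨0, ?_⟩
    rw [map_mul, map_mul, map_mul, ← mul_assoc, ← mul_assoc, ← mul_assoc, En, Et, mul_assoc _ (ofG (B.n c)), nE,
      smul_mul_assoc, smul_mul_assoc, B.EwE (m' := 1)]
    · simp
    · have := B.tE (ψ := ψ) 1 1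
      simpa using this
    · intro h
      have h2 : ((2 : ℕ) : ZMod N) = 0 := by
        push_cast at h ⊢; linear_combination h
      rw [ZMod.natCast_eq_zero_iff] at h2
      have := Nat.le_of_dvd two_pos h2
      have := B.N3
      omega
lemma T8a (hψ : ψ.IsPrimitive) [Finite S] : ∃ i, (wed S).chi i (B.E ψ 1) = 1 ∧ (∀ k, k ≠ i → (wed S).chi k (B.E ψ 1) = 0) ∧
    (wed S).eps i * B.E ψ 1 = B.E ψ 1 ∧ (wed S).d i = 2 * N + 2 := by
  obtain ⟨i, h1, h2, h3, h4⟩ := deg_prim (B.E_idem hψ 1) (B.E_ne hψ 1) (B.E1_prim hψ)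
  refine ⟨i, h1, h2, h3, ?_⟩
  have h5 : (B.E ψ 1).coeff 1 = (2 * N + 1 : ℂ)⁻¹ * (N : ℂ)⁻¹ := B.c1_E 1
  have e2 : (2 * N + 1 : ℂ) ≠ 0 := by exact_mod_cast Nat.succ_ne_zero (2 * N)
  have e3 : (N : ℂ) ≠ 0 := by exact_mod_cast NeZero.ne N
  rw [h5, B.cS] at h4
  push_cast at h4
  field_simp at h4
  have : (((wed S).d i : ℕ) : ℂ) = ((2 * N + 2 : ℕ) : ℂ) := by push_cast; linear_combination h4
  exact_mod_cast this
lemma UtU (hψ : ψ.IsPrimitive) (a b : F) (m : ℕ) : B.U ψ a * ofG (B.t ^ m) * B.U ψ b =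
    if a = b * ↑(B.g ^ (2 * m))⁻¹ then B.U ψ a * ofG (B.t ^ m) else 0 := by
  rw [mul_assoc, tU, ← mul_assoc, U_mul B hψ]
  split_ifs <;> simp
lemma rankEU (hψ : ψ.IsPrimitive) [Finite S] (j) {a : F} (ha : a ≠ 0) {c c' : Fin (wed S).n → ℕ}
    (hc : ∀ i, (wed S).chi i (B.E ψ j) = c i) (hc' : ∀ i, (wed S).chi i (B.U ψ a) = c' i) :
    ∑ i, c i * c' i ≤ 1 := by
  refine (wed S).rank_le (B.E_idem hψ j) (B.U_idem hψ a) (fun _ : Unit => B.E ψ j * ofG B.w * B.U ψ a)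
    (span_of fun s => ?_) hc hc'
  simp only [Set.range_const, Submodule.mem_span_singleton]
  obtain ⟨b, m, rfl | ⟨c, rfl⟩⟩ := B.bru s
  · rw [map_mul, ← mul_assoc, En, Et, smul_mul_assoc]
    refine ⟨0, ?_⟩
    rw [E, ← TU, mul_assoc (B.T j) _ (B.U ψ a), U_mul B hψ, if_neg ha.symm]
    simp
  · rw [map_mul, map_mul, map_mul, ← mul_assoc, ← mul_assoc, ← mul_assoc, En, Et, mul_assoc _ (ofG (B.n c)), nU]
    simp only [mul_smul_comm, smul_mul_assoc, smul_smul]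
    exact ⟨_, rfl⟩
lemma rankUU (hψ : ψ.IsPrimitive) [Finite S] {a a' : F} (ha : a ≠ 0)
    (hne : ∀ m : ℕ, a ≠ a' * ↑(B.g ^ (2 * m))⁻¹) {c c' : Fin (wed S).n → ℕ}
    (hc : ∀ i, (wed S).chi i (B.U ψ a) = c i) (hc' : ∀ i, (wed S).chi i (B.U ψ a') = c' i) :
    ∑ i, c i * c' i ≤ N := by
  rw [← ZMod.card N]
  refine (wed S).rank_le (B.U_idem hψ a) (B.U_idem hψ a') (fun m : ZMod N => B.U ψ a * B.zT m * ofG B.w * B.U ψ a')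
    (span_of fun s => ?_) hc hc'
  obtain ⟨b, m, rfl | ⟨c, rfl⟩⟩ := B.bru s
  · rw [map_mul, ← mul_assoc, Un, smul_mul_assoc, smul_mul_assoc, UtU B hψ, if_neg (hne m), smul_zero]
    exact Submodule.zero_mem _
  · rw [map_mul, map_mul, map_mul, ← mul_assoc, ← mul_assoc, ← mul_assoc, Un, mul_assoc _ (ofG (B.n c)), nU]
    simp only [mul_smul_comm, smul_mul_assoc, smul_smul]
    rw [← zT_cast]
    exact Submodule.smul_mem _ _ (Submodule.subset_span ⟨(m : ZMod N), rfl⟩)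
lemma gm (a : F) (ha : a ≠ 0) (m : ℕ) (h : a = a * ↑(B.g ^ (2 * m))⁻¹) : B.t ^ m = 1 := by
  apply B.tm_one
  apply B.g2
  have : (↑(B.g ^ (2 * m))⁻¹ : F) = 1 := mul_left_cancel₀ ha (by rw [← h, mul_one])
  rw [← Units.val_one, Units.val_inj, inv_eq_one] at this
  exact this
lemma rankU (hψ : ψ.IsPrimitive) [Finite S] {a : F} (ha : a ≠ 0) {c : Fin (wed S).n → ℕ}
    (hc : ∀ i, (wed S).chi i (B.U ψ a) = c i) :
    ∑ i, c i * c i ≤ N + 1 := by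
  have : Fintype.card (Option (ZMod N)) = N + 1 := by simp [ZMod.card]
  rw [← this]
  refine (wed S).rank_le (B.U_idem hψ a) (B.U_idem hψ a)
    (fun m : Option (ZMod N) => m.elim (B.U ψ a) fun m => B.U ψ a * B.zT m * ofG B.w * B.U ψ a)
    (span_of fun s => ?_) hc hc
  obtain ⟨b, m, rfl | ⟨c, rfl⟩⟩ := B.bru s
  · rw [map_mul, ← mul_assoc, Un, smul_mul_assoc, smul_mul_assoc, UtU B hψ]
    split_ifs with h
    · rw [B.gm a ha m h, map_one, mul_one]
      exact Submodule.smul_mem _ _ (Submodule.subset_span ⟨none, rfl⟩)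
    · rw [smul_zero]; exact Submodule.zero_mem _
  · rw [map_mul, map_mul, map_mul, ← mul_assoc, ← mul_assoc, ← mul_assoc, Un, mul_assoc _ (ofG (B.n c)), nU]
    simp only [mul_smul_comm, smul_mul_assoc, smul_smul]
    rw [← zT_cast]
    exact Submodule.smul_mem _ _ (Submodule.subset_span ⟨some (m : ZMod N), rfl⟩)
end BN

namespace BN
variable {S : Type} [Group S] {F : Type} [Field F] [Fintype F] [DecidableEq F] {N : ℕ} [NeZero N] (B : BN S F N)
variable {ψ : AddChar F ℂ}
lemma sg_one : B.sg 1 = 1 := by rw [← B.n0, B.sg_n]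
noncomputable def sgM : S →* (CA S)ᵐᵒᵖ where
  toFun s := MulOpposite.op (ofG (B.sg s))
  map_one' := by rw [sg_one, map_one]; rfl
  map_mul' x y := by rw [B.sg_mul, map_mul, MulOpposite.op_mul]
noncomputable def sgA : CA S →ₐ[ℂ] (CA S)ᵐᵒᵖ := MonoidAlgebra.lift ℂ _ S B.sgM
lemma sgA_of (s : S) : B.sgA (ofG s) = MulOpposite.op (ofG (B.sg s)) := MonoidAlgebra.lift_of _ _
lemma sgA_U (a : F) : B.sgA (B.U ψ a) = MulOpposite.op (B.U ψ a) := by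
  rw [U, ft, map_smul, map_sum, MulOpposite.op_smul, Finset.op_sum]
  congr 1
  refine Finset.sum_congr rfl fun b _ => ?_
  rw [map_smul, zU, sgA_of, B.sg_n, MulOpposite.op_smul]
lemma tinv : B.t⁻¹ = B.t ^ (N - 1) := by
  refine inv_eq_of_mul_eq_one_right ?_
  rw [← pow_succ', Nat.sub_add_cancel NeZero.one_le, B.tN]
lemma sg_tm (m : ℕ) : B.sg (B.t ^ m) = (B.t ^ m)⁻¹ := by
  induction m with
  | zero => simp [sg_one]
  | succ m ih => rw [pow_succ, B.sg_mul, ih, B.sg_t, mul_inv_rev]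
lemma whit (hψ : ψ.IsPrimitive) {a : F} (ha : a ≠ 0) (x : CA S) :
    B.sgA (B.U ψ a * x * B.U ψ a) = MulOpposite.op (B.U ψ a * x * B.U ψ a) := by
  have key : ∀ s, B.U ψ a * ofG (B.sg s) * B.U ψ a = B.U ψ a * ofG s * B.U ψ a := by
    intro s
    obtain ⟨b, m, rfl | ⟨c, rfl⟩⟩ := B.bru s
    · rw [B.sg_mul, B.sg_n, sg_tm, map_mul, map_mul, ← mul_assoc, ← mul_assoc, Un, mul_assoc _ (ofG (B.n b)), nU,
        smul_mul_assoc, smul_mul_assoc, mul_smul_comm]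
      by_cases h1 : B.t ^ m = 1
      · rw [h1, inv_one]
      · rw [UtU B hψ, if_neg (fun h => h1 (B.gm a ha m h)), ← inv_pow, tinv, ← pow_mul, UtU B hψ, if_neg]
        intro h
        have := B.gm a ha _ h
        rw [pow_mul, ← tinv, inv_pow, inv_eq_one] at this
        exact h1 this
    · have : B.sg (B.n b * B.t ^ m * B.w * B.n c) = B.n c * B.t ^ m * B.w * B.n b := by
        rw [B.sg_mul, B.sg_mul, B.sg_mul, B.sg_n, B.sg_n, B.sg_w, sg_tm]
        have := B.wtm m
        rw [← mul_assoc B.w, ← inv_pow] at *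
        rw [inv_pow]
        have h2 : B.w * (B.t ^ m)⁻¹ = B.t ^ m * B.w := by
          rw [mul_inv_eq_iff_eq_mul, mul_assoc, B.wtm, mul_inv_cancel_left]
        rw [h2]; simp only [mul_assoc]
      rw [this]
      simp only [map_mul, ← mul_assoc]
      rw [Un, Un, mul_assoc _ (ofG (B.n b)), mul_assoc _ (ofG (B.n c)), nU, nU]
      simp only [mul_smul_comm, smul_mul_assoc, smul_smul]
      rw [mul_comm]
  induction x using CA_ind with
  | h1 s => rw [map_mul, map_mul, sgA_U, sgA_of, ← MulOpposite.op_mul, ← MulOpposite.op_mul, ← key s, mul_assoc]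
  | h2 x y hx hy => rw [mul_add, add_mul, map_add, hx, hy, MulOpposite.op_add]
  | h3 r x hx => rw [mul_smul_comm, smul_mul_assoc, map_smul, hx, MulOpposite.op_smul]
lemma whit1 [Finite S] (hψ : ψ.IsPrimitive) {a : F} (ha : a ≠ 0) {i} {m : ℕ} (hm : (wed S).chi i (B.U ψ a) = m) : m ≤ 1 := by
  refine (wed S).comm_rank (fun x y => ?_) (B.U_idem hψ a) hm
  have h1 := B.whit hψ ha x
  have h2 := B.whit hψ ha y
  have h3 := B.whit hψ ha (x * B.U ψ a * B.U ψ a * y)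
  have h4 : B.U ψ a * (x * B.U ψ a * B.U ψ a * y) * B.U ψ a = (B.U ψ a * x * B.U ψ a) * (B.U ψ a * y * B.U ψ a) := by
    simp only [mul_assoc]
  rw [h4, map_mul, h1, h2, ← MulOpposite.op_mul] at h3
  exact (MulOpposite.op_injective h3).symm
lemma chiU [Finite S] (i) (a : F) : (wed S).chi i (B.U ψ (a * (B.g : F) ^ 2)) = (wed S).chi i (B.U ψ a) := by
  have h := B.tU (ψ := ψ) 1 (a * (B.g : F) ^ 2)
  have e : a * (B.g : F) ^ 2 * ↑(B.g ^ (2 * 1))⁻¹ = a := by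
    rw [mul_assoc, ← Units.val_pow_eq_pow_val, ← Units.val_mul, mul_one, mul_inv_cancel, Units.val_one, mul_one]
  rw [e] at h
  have h2 : B.U ψ (a * (B.g : F) ^ 2) = ofG (B.t ^ 1)⁻¹ * (B.U ψ a * ofG (B.t ^ 1)) := by
    rw [← h, ← mul_assoc, ofG_inv_mul, one_mul]
  rw [h2, (wed S).chi_mul_comm, mul_assoc, ofG_mul_inv, mul_one]
lemma sumU [Finite S] (hψ : ψ.IsPrimitive) (i) : ((wed S).d i : ℂ) = (wed S).chi i (B.U ψ 0) +
    N * ((wed S).chi i (B.U ψ 1) + (wed S).chi i (B.U ψ (B.g : F))) := by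
  rw [← (wed S).chi_one, ← B.U_sum hψ, map_sum, ← Finset.add_sum_erase _ _ (Finset.mem_univ 0)]
  congr 1
  have h1 : ∑ a ∈ Finset.univ.erase 0, (wed S).chi i (B.U ψ a) = ∑ u : Fˣ, (wed S).chi i (B.U ψ (u : F)) := by
    symm
    refine Finset.sum_bij (fun u _ => (u : F)) (by simp) (fun u _ v _ h => Units.ext h) ?_ (fun _ _ => rfl)
    intro b hb
    exact ⟨Units.mk0 b (Finset.ne_of_mem_erase hb), Finset.mem_univ _, rfl⟩
  rw [h1, ← IsCyclic.image_range_orderOf B.gen, Finset.sum_image, B.ordg]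
  · have : ∀ n, ∑ e ∈ Finset.range (2 * n), (wed S).chi i (B.U ψ ((B.g ^ e : Fˣ) : F)) =
      n * ((wed S).chi i (B.U ψ 1) + (wed S).chi i (B.U ψ (B.g : F))) := by
      have e0 : ∀ n, (wed S).chi i (B.U ψ ((B.g : F) ^ (2 * n))) = (wed S).chi i (B.U ψ 1) := by
        intro n
        induction n with
        | zero => simp
        | succ n ih => rw [mul_add, pow_add, mul_one, chiU, ih]
      have e1 : ∀ n, (wed S).chi i (B.U ψ ((B.g : F) ^ (2 * n + 1))) = (wed S).chi i (B.U ψ (B.g : F)) := by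
        intro n
        induction n with
        | zero => simp
        | succ n ih =>
          rw [show 2 * (n + 1) + 1 = 2 * n + 1 + 2 by ring, pow_add, chiU, ih]
      intro n
      induction n with
      | zero => simp
      | succ n ih =>
        rw [mul_add, mul_one, Finset.sum_range_succ, Finset.sum_range_succ, ih]
        push_cast
        rw [e0, e1]; ring
    exact this N
  · intro x hx y hy h
    exact pow_injOn_Iio_orderOf (by simpa using hx) (by simpa using hy) h
theorem T8b [Finite S] (B : BN S F N) (hψ : ψ.IsPrimitive) : ∃ i, (wed S).d i = 2 * N := by
  choose x hx using fun (j : ZMod N) i => (wed S).idem_nat (B.E_idem hψ j) i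
  choose m hm using fun i => (wed S).idem_nat (B.U_idem hψ 1) i
  choose m' hm' using fun i => (wed S).idem_nat (B.U_idem hψ (B.g : F)) i
  have hg0 : (B.g : F) ≠ 0 := B.g.ne_zero
  have hml : ∀ i, m i ≤ 1 := fun i => B.whit1 hψ one_ne_zero (hm i)
  have hml' : ∀ i, m' i ≤ 1 := fun i => B.whit1 hψ hg0 (hm' i)
  set m1 := fun i => ∑ j, x j i with hm1
  have hU0 : ∑ j, B.E ψ j = B.U ψ 0 := by
    simp only [E]; rw [← Finset.mul_sum, T_sum, mul_one]
  have hd : ∀ i, (wed S).d i = m1 i + N * (m i + m' i) := by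
    intro i
    have := B.sumU hψ i
    rw [← hU0, map_sum, hm, hm', Finset.sum_congr rfl (fun j _ => hx j i)] at this
    exact_mod_cast this
  have r1 : ∀ j, ∑ i, x j i * m i ≤ 1 := fun j => B.rankEU hψ j one_ne_zero (hx j) hm
  have r2 : ∑ i, m i * m i ≤ N + 1 := B.rankU hψ one_ne_zero hm
  have r3 : ∑ i, m i * m' i ≤ N := by
    refine B.rankUU hψ one_ne_zero (fun k h => ?_) hm hm'
    have h1 : B.g ^ (2 * k) = B.g := by
      apply Units.ext
      have h2 := congrArg (fun y => y * ((B.g ^ (2 * k) : Fˣ) : F)) h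
      simp only [one_mul, mul_assoc, Units.inv_mul, mul_one] at h2
      exact h2
    have h3 : B.g ^ (2 * k) = B.g ^ 1 := by rw [h1, pow_one]
    rw [pow_eq_pow_iff_modEq, B.ordg] at h3
    have := (h3.of_mul_right N)
    have h4 := Nat.ModEq.of_mul_right N h3
    have h5 : (2 * k) % 2 = 1 % 2 := h4
    omega
  have tot : ∑ i, (wed S).d i * m i = N * (2 * N + 2) := by
    have h1 := (wed S).trace_right (B.U ψ 1)
    rw [trace_right_CA] at h1
    have h2 : (B.U ψ 1).coeff 1 = (2 * N + 1 : ℂ)⁻¹ := B.c1_U 1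
    have e2 : (2 * N + 1 : ℂ) ≠ 0 := by exact_mod_cast Nat.succ_ne_zero (2 * N)
    rw [h2, B.cS, Finset.sum_congr rfl (fun i _ => by rw [hm i])] at h1
    push_cast at h1
    have h3 : ((∑ i, (wed S).d i * m i : ℕ) : ℂ) = ((N * (2 * N + 2) : ℕ) : ℂ) := by
      push_cast; rw [← h1]; field_simp
    exact_mod_cast h3
  have s1 : ∑ i, m1 i * m i = ∑ j, ∑ i, x j i * m i := by
    rw [Finset.sum_comm]
    exact Finset.sum_congr rfl fun i _ => Finset.sum_mul _ _ _
  have s2 : ∑ j : ZMod N, ∑ i, x j i * m i ≤ N := by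
    refine (Finset.sum_le_sum fun j _ => r1 j).trans ?_
    simp [ZMod.card]
  have tot2 : ∑ i, m1 i * m i + N * (∑ i, m i * m i + ∑ i, m i * m' i) = N * (2 * N + 2) := by
    rw [← tot, mul_add, Finset.mul_sum, Finset.mul_sum, ← Finset.sum_add_distrib, ← Finset.sum_add_distrib]
    refine Finset.sum_congr rfl fun i _ => ?_
    rw [hd]; ring
  have hN : 0 < N := by have := B.N3; omega
  have q1 : ∑ i, m1 i * m i = N := by
    have : N * (∑ i, m i * m i + ∑ i, m i * m' i) ≤ N * (2 * N + 1) := Nat.mul_le_mul_left _ (by omega)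
    nlinarith
  have q3 : ∑ i, m i * m' i = N := by
    have : N * (∑ i, m i * m i + ∑ i, m i * m' i) = N * (2 * N + 1) := by nlinarith
    have := Nat.eq_of_mul_eq_mul_left hN this
    omega
  have q4 : ∑ i, x 1 i * m i = 1 := by
    by_contra hne
    have : ∑ j : ZMod N, ∑ i, x j i * m i < ∑ j : ZMod N, 1 :=
      Finset.sum_lt_sum (fun j _ => r1 j) ⟨1, Finset.mem_univ _, lt_of_le_of_ne (r1 1) hne⟩
    rw [← s1, q1] at this
    simp [ZMod.card] at this
  obtain ⟨i0, a1, a2, -, a4⟩ := B.T8a hψ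
  have b1 : x 1 i0 = 1 := by have := hx 1 i0; rw [a1] at this; exact_mod_cast this.symm
  have b2 : ∀ k, k ≠ i0 → x 1 k = 0 := fun k hk => by
    have := hx 1 k; rw [a2 k hk] at this; exact_mod_cast this.symm
  have b3 : m i0 = 1 := by
    rw [Finset.sum_eq_single i0, b1, one_mul] at q4
    · exact q4
    · intro k _ hk; rw [b2 k hk, zero_mul]
    · simp
  have b4 : 2 ≤ m1 i0 := by
    have h1 := hd i0
    rw [a4, b3] at h1
    have := hml' i0
    have : N * (1 + m' i0) ≤ N * 2 := Nat.mul_le_mul_left _ (by omega)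
    omega
  by_contra hcon
  push Not at hcon
  have hz : ∀ i, m1 i = 0 → m i * m' i = 0 := by
    intro i h0
    by_contra hh
    have h1 := hml i
    have h2 := hml' i
    have h3 := Nat.pos_of_ne_zero (left_ne_zero_of_mul hh)
    have h4 := Nat.pos_of_ne_zero (right_ne_zero_of_mul hh)
    have e1 : m i = 1 := by omega
    have e2 : m' i = 1 := by omega
    exact hcon i (by rw [hd, h0, e1, e2]; ring)
  have : ∑ i, m i * m' i < ∑ i, m1 i * m i := by
    refine Finset.sum_lt_sum (fun i _ => ?_) ⟨i0, Finset.mem_univ _, ?_⟩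
    · by_cases h0 : m1 i = 0
      · rw [hz i h0]; exact Nat.zero_le _
      · have : 1 ≤ m1 i := Nat.pos_of_ne_zero h0
        have := hml' i
        nlinarith [hml i]
    · have := hml' i0
      rw [b3]; omega
  omega
end BN

section MA
variable {S : Type} [Group S]
noncomputable def ma (α : MulAut S) : CA S →ₐ[ℂ] CA S :=
  MonoidAlgebra.mapDomainAlgHom ℂ ℂ (α : S ≃* S).toMonoidHom
lemma ma_of (α : MulAut S) (s : S) : ma α (ofG s) = ofG (α s) := by
  simp [ma, ofG_eq, MonoidAlgebra.mapDomainAlgHom]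
lemma ma_mul (α β : MulAut S) (x : CA S) : ma (α * β) x = ma α (ma β x) := by
  induction x using CA_ind with
  | h1 s => rw [ma_of, ma_of, ma_of]; rfl
  | h2 x y hx hy => simp only [map_add, hx, hy]
  | h3 r x hx => simp only [map_smul, hx]
lemma ma_one (x : CA S) : ma (1 : MulAut S) x = x := by
  induction x using CA_ind with
  | h1 s => rw [ma_of]; rfl
  | h2 x y hx hy => simp only [map_add, hx, hy]
  | h3 r x hx => simp only [map_smul, hx]
lemma ma_conj (u : S) (x : CA S) : ma (MulAut.conj u) x = ofG u * x * ofG u⁻¹ := by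
  induction x using CA_ind with
  | h1 s => rw [ma_of, ← map_mul, ← map_mul]; rfl
  | h2 x y hx hy => simp only [map_add, hx, hy, mul_add, add_mul]
  | h3 r x hx => simp only [map_smul, hx, mul_smul_comm, smul_mul_assoc]
lemma aut_smul {p : ℕ} (α : MulAut S) (s : S) (P : Sylow p S) : α • s • P = (α s) • α • P := by
  rw [Sylow.smul_def, Sylow.smul_def, smul_smul, smul_smul]
  congr 1
  ext x
  simp
end MA
lemma Wed.simple {A : Type} [Ring A] [Algebra ℂ A] (W : Wed A) {i} {e f : A} (he : W.M i e ≠ 0) (hf : W.M i f ≠ 0) :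
    ∃ a, e * a * f ≠ 0 := by
  by_contra! h
  have h1 : ∀ X, W.M i e * X * W.M i f = 0 := fun X => by
    obtain ⟨a, rfl⟩ := W.M_surj i X
    rw [← map_mul, ← map_mul, h, map_zero]
  apply he
  ext a k
  by_contra hk
  apply hf
  ext l b
  have h2 := congrFun (congrFun (h1 (Matrix.single k l 1)) a) b
  rw [Matrix.mul_apply] at h2
  simp [Matrix.mul_apply, Matrix.single_apply, ite_and] at h2
  exact h2.resolve_left hk
namespace BN
variable {S : Type} [Group S] {F : Type} [Field F] [Fintype F] [DecidableEq F] {N : ℕ} [NeZero N] (B : BN S F N)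
variable {p : ℕ} {P0 : Sylow p S} 
lemma n_inv (b : F) : (B.n b)⁻¹ = B.n (-b) :=
  inv_eq_of_mul_eq_one_right (by rw [B.n_add, add_neg_cancel, B.n0])
lemma st_def {s : S} : s • P0 = P0 ↔ ∀ h, h ∈ P0 ↔ s * h * s⁻¹ ∈ P0 := by
  rw [Sylow.smul_eq_iff_mem_normalizer]; exact Subgroup.mem_normalizer_iff (H := P0.1)
lemma n_st (hP : ∀ x, x ∈ P0 ↔ ∃ b, B.n b = x) (b : F) : B.n b • P0 = P0 :=
  Sylow.smul_eq_iff_mem_normalizer.2 (Subgroup.le_normalizer ((hP _).2 ⟨b, rfl⟩))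
lemma t_st (hP : ∀ x, x ∈ P0 ↔ ∃ b, B.n b = x) : B.t • P0 = P0 := by
  rw [st_def]
  intro h
  have key : ∀ b, B.t * B.n b * B.t⁻¹ = B.n ((B.g ^ 2 : Fˣ) * b) := fun b => by
    rw [B.tn, mul_inv_cancel_right]
  constructor
  · intro hh
    obtain ⟨b, rfl⟩ := (hP h).1 hh
    exact (hP _).2 ⟨_, (key b).symm⟩
  · intro hh
    obtain ⟨b, hb⟩ := (hP _).1 hh
    refine (hP h).2 ⟨((B.g ^ 2)⁻¹ : Fˣ) * b, ?_⟩
    have := key (((B.g ^ 2)⁻¹ : Fˣ) * b)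
    rw [Units.mul_inv_cancel_left, hb] at this
    exact mul_left_cancel (mul_right_cancel this)
lemma tm_st (hP : ∀ x, x ∈ P0 ↔ ∃ b, B.n b = x) (m : ℕ) : B.t ^ m • P0 = P0 := by
  induction m with
  | zero => simp
  | succ m ih => rw [pow_succ, mul_smul, B.t_st hP, ih]
lemma tmw (hP : ∀ x, x ∈ P0 ↔ ∃ b, B.n b = x) (m : ℕ) : B.t ^ m • B.w • P0 = B.w • P0 := by
  have h2 : B.t ^ m * B.w = B.w * (B.t ^ m)⁻¹ := by
    rw [eq_mul_inv_iff_mul_eq, mul_assoc, B.wtm, mul_inv_cancel_left]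
  rw [smul_smul, h2, mul_smul, inv_smul_eq_iff.2 (B.tm_st hP m).symm]
lemma st_iff (hP : ∀ x, x ∈ P0 ↔ ∃ b, B.n b = x) (s : S) (h : s • P0 = P0) : ∃ b, ∃ m : ℕ, s = B.n b * B.t ^ m := by
  obtain ⟨b, m, h1 | ⟨c, rfl⟩⟩ := B.bru s
  · exact ⟨b, m, h1⟩
  exfalso
  rw [mul_smul, mul_smul, mul_smul, B.n_st hP, B.tmw hP] at h
  rw [← eq_inv_smul_iff, n_inv, B.n_st hP, ← eq_inv_smul_iff, eq_comm, st_def] at h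
  obtain ⟨b', hb'⟩ := (hP _).1 ((h (B.n 1)).1 ((hP _).2 ⟨1, rfl⟩))
  have := B.opp 1 b' 0 (by rw [hb', pow_zero, mul_one, inv_inv])
  exact one_ne_zero this
lemma nw (hP : ∀ x, x ∈ P0 ↔ ∃ b, B.n b = x) {b : F} (h : B.n b • B.w • P0 = B.w • P0) : b = 0 := by
  rw [← inv_smul_eq_iff, smul_smul, smul_smul] at h
  obtain ⟨c, m, h1⟩ := B.st_iff hP _ h
  exact B.opp b c m (by rw [← h1])
lemma nw2 (hP : ∀ x, x ∈ P0 ↔ ∃ b, B.n b = x) {b c : F} (h : B.n b • B.w • P0 = B.n c • B.w • P0) : b = c := by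
  rw [← inv_smul_eq_iff, smul_smul, n_inv, B.n_add] at h
  have := B.nw hP h
  linear_combination this
lemma st2 (hP : ∀ x, x ∈ P0 ↔ ∃ b, B.n b = x) (s : S) (h : s • P0 = P0) (h' : s • B.w • P0 = B.w • P0) :
    ∃ m : ℕ, s = B.t ^ m := by
  obtain ⟨b, m, rfl⟩ := B.st_iff hP s h
  rw [mul_smul, B.tmw hP] at h'
  have := B.nw hP h'
  subst this
  exact ⟨m, by rw [B.n0, one_mul]⟩
lemma nwne (hP : ∀ x, x ∈ P0 ↔ ∃ b, B.n b = x) (b : F) : B.n b • B.w • P0 ≠ P0 := by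
  intro h
  rw [← eq_inv_smul_iff, n_inv, B.n_st hP] at h
  have := B.nw hP (b := 1) (by rw [h, B.n_st hP])
  exact one_ne_zero this
lemma pts [Finite S] [Fact p.Prime] (hP : ∀ x, x ∈ P0 ↔ ∃ b, B.n b = x) (Q : Sylow p S) : Q = P0 ∨ ∃ b, Q = B.n b • B.w • P0 := by
  obtain ⟨s, rfl⟩ := MulAction.exists_smul_eq S P0 Q
  obtain ⟨b, m, rfl | ⟨c, rfl⟩⟩ := B.bru s
  · left; rw [mul_smul, B.tm_st hP, B.n_st hP]
  · right; refine ⟨b, ?_⟩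
    rw [mul_smul, mul_smul, mul_smul, B.n_st hP, B.tmw hP]
lemma cardX [Finite S] [Fact p.Prime] (hP : ∀ x, x ∈ P0 ↔ ∃ b, B.n b = x) [Finite F] : Nat.card (Sylow p S) = 2 * N + 2 := by
  have : Function.Bijective (fun o : Option F => o.elim P0 fun b => B.n b • B.w • P0) := by
    constructor
    · rintro (_ | b) (_ | c) h
      · rfl
      · exact absurd h.symm (B.nwne hP c)
      · exact absurd h (B.nwne hP b)
      · exact congrArg some (B.nw2 hP h)
    · intro Q
      obtain rfl | ⟨b, rfl⟩ := B.pts hP Q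
      · exact ⟨none, rfl⟩
      · exact ⟨some b, rfl⟩
  rw [← Nat.card_congr (Equiv.ofBijective _ this), Finite.card_option, B.cF]
lemma aut_mem {α : MulAut S} (h : α • P0 = P0) {x : S} (hx : x ∈ P0) : α x ∈ P0 := by
  have h1 : α x ∈ ((α • P0 : Sylow p S) : Subgroup S) := Subgroup.smul_mem_pointwise_smul x α P0.1 hx
  rwa [h] at h1
lemma aut_t (hP : ∀ x, x ∈ P0 ↔ ∃ b, B.n b = x) {α : MulAut S} (h : α • P0 = P0)
    (h' : α • B.w • P0 = B.w • P0) : ∃ m : ℕ, α B.t = B.t ^ m := by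
  refine B.st2 hP _ ?_ ?_
  · conv_lhs => rw [← h]
    rw [← aut_smul, B.t_st hP, h]
  · conv_lhs => rw [← h']
    have := B.tmw hP 1
    rw [pow_one] at this
    rw [← aut_smul, this, h']
lemma all_fixed (hP : ∀ x, x ∈ P0 ↔ ∃ b, B.n b = x) {α : MulAut S} (h : ∀ P : Sylow p S, α • P = P) : α = 1 := by
  ext s
  show α s = s
  have hy : ∀ P : Sylow p S, (s⁻¹ * α s) • P = P := by
    intro P
    rw [mul_smul, inv_smul_eq_iff]
    conv_lhs => rw [← h P]
    rw [← aut_smul, h]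
  obtain ⟨m, hm⟩ := B.st2 hP _ (hy _) (hy _)
  have h1 := hy (B.n 1 • B.w • P0)
  rw [hm, smul_smul, B.tm, mul_smul, B.tmw hP] at h1
  have h2 := B.nw2 hP h1
  rw [mul_one, ← Units.val_one, Units.val_inj] at h2
  rw [B.tm_one (B.g2 h2), inv_mul_eq_one] at hm
  exact hm.symm
end BN

namespace BN
variable {S : Type} [Group S] {F : Type} [Field F] [Fintype F] [DecidableEq F] {N : ℕ} [NeZero N] (B : BN S F N)
variable {p : ℕ} {P0 : Sylow p S} {ψ : AddChar F ℂ}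
lemma aut_pm [Finite S] (hψ : ψ.IsPrimitive) {i : Fin (wed S).n} (hi : (wed S).eps i * B.E ψ 1 = B.E ψ 1)
    {α : MulAut S} (hα : ma α ((wed S).eps i) = (wed S).eps i)
    (hn : ∀ b, ∃ c, α⁻¹ (B.n b) = B.n c) {m : ℕ} (hm : α⁻¹ B.t = B.t ^ m) :
    (m : ZMod N) = 1 ∨ (m : ZMod N) = -1 := by
  set e' := ma α (B.E ψ 1) with he'
  have hE0 : B.E ψ 1 ≠ 0 := B.E_ne hψ 1
  have hM : ∀ x : CA S, x ≠ 0 → (wed S).eps i * x = x → (wed S).M i x ≠ 0 := by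
    intro x hx hxe h0
    apply hx
    apply (wed S).ext'
    intro j
    rw [map_zero]
    by_cases hj : j = i
    · subst hj; exact h0
    · rw [← hxe, map_mul, Wed.M_eps_ne _ hj, zero_mul]
  have he0 : e' ≠ 0 := by
    intro h0
    apply hE0
    have : ma α⁻¹ e' = B.E ψ 1 := by rw [he', ← ma_mul, inv_mul_cancel, ma_one]
    rw [← this, h0, map_zero]
  have hee : (wed S).eps i * e' = e' := by
    conv_rhs => rw [he', ← hi, map_mul, hα]
  have hne : ∀ b, ofG (B.n b) * e' = e' := by
    intro b
    obtain ⟨c, hc⟩ := hn b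
    have : ofG (B.n b) = ma α (ofG (B.n c)) := by rw [ma_of, ← hc, MulAut.apply_inv_self]
    rw [this, he', ← map_mul, nE]
  have hte : ofG B.t * e' = ZMod.stdAddChar (m : ZMod N) • e' := by
    have : ofG B.t = ma α (ofG (B.t ^ m)) := by rw [ma_of, ← hm, MulAut.apply_inv_self]
    rw [this, he', ← map_mul, tE, map_smul, one_mul]
  by_contra! hcon
  have hw := B.EwE (ψ := ψ) hte hcon.2
  have h1 : B.E ψ 1 * e' = 0 := by
    have h := B.Et (ψ := ψ) 1 1
    rw [pow_one] at h
    have h2 : B.E ψ 1 * ofG B.t * e' = B.E ψ 1 * (ofG B.t * e') := mul_assoc _ _ _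
    rw [h, hte, smul_mul_assoc, mul_smul_comm] at h2
    refine smul_cancel h2 fun h => hcon.1 ?_
    have := ZMod.injective_stdAddChar h
    simpa using this.symm
  obtain ⟨a, ha⟩ := (wed S).simple (hM _ hE0 hi) (hM _ he0 hee)
  apply ha
  have := span_of (v := fun _ : Unit => (0 : CA S)) (e := B.E ψ 1) (f := e') (fun s => ?_) a
  · simpa using this
  simp only [Set.range_const, Submodule.span_zero_singleton, Submodule.mem_bot]
  obtain ⟨b, k, rfl | ⟨c, rfl⟩⟩ := B.bru s
  · rw [map_mul, ← mul_assoc, En, Et, smul_mul_assoc, h1, smul_zero]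
  · rw [map_mul, map_mul, map_mul, ← mul_assoc, ← mul_assoc, ← mul_assoc, En, Et, mul_assoc _ (ofG (B.n c)), hne,
      smul_mul_assoc, smul_mul_assoc, hw, smul_zero]
lemma L1 [Finite S] [Fact p.Prime] (h2F : (2 : F) ≠ 0) (hP : ∀ x, x ∈ P0 ↔ ∃ b, B.n b = x)
    (hψ : ψ.IsPrimitive) {i : Fin (wed S).n} (hi : (wed S).eps i * B.E ψ 1 = B.E ψ 1)
    {α : MulAut S} (hα : ma α ((wed S).eps i) = (wed S).eps i) {l : ℕ} (hl : Odd l) (hαl : α ^ l = 1)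
    (f1 : α • P0 = P0) (f2 : α • B.w • P0 = B.w • P0) {c : F} (hc : c ≠ 0)
    (f3 : α • B.n c • B.w • P0 = B.n c • B.w • P0) : α = 1 := by
  have g1 : α⁻¹ • P0 = P0 := by rw [inv_smul_eq_iff, f1]
  have g2 : α⁻¹ • B.w • P0 = B.w • P0 := by rw [inv_smul_eq_iff, f2]
  obtain ⟨m, hm⟩ := B.aut_t hP g1 g2
  have hn : ∀ b, ∃ c, α⁻¹ (B.n b) = B.n c := fun b => by
    obtain ⟨c, hc⟩ := (hP _).1 (aut_mem g1 ((hP (B.n b)).2 ⟨b, rfl⟩))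
    exact ⟨c, hc.symm⟩
  have ht' : α⁻¹ B.t = B.t := by
    obtain h | h := B.aut_pm hψ hi hα hn hm
    · rw [hm]
      have : ((m : ℕ) : ZMod N) = ((1 : ℕ) : ZMod N) := by simpa using h
      rw [ZMod.natCast_eq_natCast_iff] at this
      rw [pow_eq_pow_mod m B.tN, this, ← pow_eq_pow_mod 1 B.tN, pow_one]
    · exfalso
      have h1 : α⁻¹ B.t = B.t⁻¹ := by
        rw [hm, eq_inv_iff_mul_eq_one, ← pow_succ]
        apply B.tm_one
        rw [← ZMod.natCast_eq_zero_iff]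
        push_cast; rw [h]; ring
      obtain ⟨r, rfl⟩ := hl
      have h3 : ∀ r, (α⁻¹ ^ (2 * r + 1) : MulAut S) B.t = B.t⁻¹ := by
        intro r
        induction r with
        | zero => simpa using h1
        | succ r ih =>
          rw [show 2 * (r + 1) + 1 = (2 * r + 1) + 1 + 1 by ring, pow_succ, pow_succ, MulAut.mul_apply,
            MulAut.mul_apply, h1, map_inv, h1, inv_inv, ih]
      have h4 := h3 r
      rw [inv_pow, hαl, inv_one, MulAut.one_apply, eq_inv_iff_mul_eq_one, ← pow_two] at h4
      have h5 := Nat.le_of_dvd two_pos (B.tm_iff.1 h4)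
      have := B.N3
      omega
  have ht : α B.t = B.t := by
    conv_lhs => rw [← ht']
    exact MulAut.apply_inv_self _ _ _
  have hnc : α (B.n c) = B.n c := by
    obtain ⟨c', hc'⟩ := (hP _).1 (aut_mem f1 ((hP (B.n c)).2 ⟨c, rfl⟩))
    rw [aut_smul, f2, ← hc'] at f3
    rw [← hc', B.nw2 hP f3]
  have d1 : ∀ k : ℕ, α (B.n ((B.g ^ (2 * k) : Fˣ) * c)) = B.n ((B.g ^ (2 * k) : Fˣ) * c) := by
    intro k
    have h := B.tm k c
    have h' := congrArg α h
    rw [map_mul, map_mul, map_pow, ht, hnc, h] at h'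
    exact (mul_right_cancel h').symm
  have d2 : ∀ y : F, α (B.n (y ^ 2 * c)) = B.n (y ^ 2 * c) := by
    intro y
    by_cases hy : y = 0
    · subst hy; simp [B.n0]
    · obtain ⟨k, hk⟩ := mem_powers_iff_mem_zpowers.2 (B.gen (Units.mk0 y hy))
      have := d1 k
      have e : ((B.g ^ (2 * k) : Fˣ) : F) = y ^ 2 := by
        rw [mul_comm, pow_mul]
        have hk' : B.g ^ k = Units.mk0 y hy := hk
        rw [hk']; simp
      rwa [e] at this
  have d3 : ∀ b : F, α (B.n b) = B.n b := by
    intro b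
    have e : B.n b = B.n (((b / c + 1) / 2) ^ 2 * c) * (B.n (((b / c - 1) / 2) ^ 2 * c))⁻¹ := by
      rw [n_inv, B.n_add]; congr 1; field_simp; ring
    rw [e, map_mul, map_inv, d2, d2]
  refine B.all_fixed hP fun Q => ?_
  obtain rfl | ⟨b, rfl⟩ := B.pts hP Q
  · exact f1
  · rw [aut_smul, d3, f2]
lemma L2 [Finite S] [Fact p.Prime] (h2F : (2 : F) ≠ 0) (hP : ∀ x, x ∈ P0 ↔ ∃ b, B.n b = x)
    (hψ : ψ.IsPrimitive) {i : Fin (wed S).n} (hi : (wed S).eps i * B.E ψ 1 = B.E ψ 1)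
    {α : MulAut S} (hα : ma α ((wed S).eps i) = (wed S).eps i) {l : ℕ} (hl : l.Prime) (hlS : ¬ l ∣ Nat.card S)
    (hαl : α ^ l = 1) : α = 1 := by
  classical
  have hlo : Odd l := by
    refine hl.odd_of_ne_two fun h => hlS ?_
    rw [h, B.cS]; exact Dvd.dvd.mul_left ⟨N + 1, by ring⟩ _
  haveI := Fact.mk hl
  haveI := Fintype.ofFinite (Sylow p S)
  set f : Function.End (Sylow p S) := fun Q => α • Q with hf
  have hfp : f ^ l ^ 1 = 1 := by
    have : ∀ n : ℕ, ∀ Q, (f ^ n : Function.End (Sylow p S)) Q = α ^ n • Q := by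
      intro n
      induction n with
      | zero => intro Q; rw [pow_zero, pow_zero, one_smul]; rfl
      | succ n ih =>
        intro Q
        rw [pow_succ, pow_succ]
        show (f ^ n : Function.End (Sylow p S)) (α • Q) = _
        rw [ih, smul_smul]
    funext Q
    rw [pow_one]
    show (f ^ l : Function.End (Sylow p S)) Q = Q
    rw [this, hαl, one_smul]
  have hc := Equiv.Perm.card_fixedPoints_modEq hfp
  rw [← Nat.card_eq_fintype_card, B.cardX hP] at hc
  have h3 : 2 < Fintype.card f.fixedPoints := by
    by_contra hle
    push Not at hle
    apply hlS
    rw [B.cS]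
    have := (Nat.modEq_iff_dvd' (show Fintype.card f.fixedPoints ≤ 2 * N + 2 by omega)).1 hc.symm
    interval_cases h : Fintype.card f.fixedPoints
    · exact Dvd.dvd.mul_left this _
    · exact ((show l ∣ 2 * N + 1 from this).mul_right _).mul_right _
    · have : l ∣ N := (hlo.coprime_two_right).dvd_of_dvd_mul_left (show l ∣ 2 * N from this)
      exact (this.mul_left _).mul_right _
  obtain ⟨⟨Q1, q1⟩, ⟨Q2, q2⟩, ⟨Q3, q3⟩, h12, h13, h23⟩ := Fintype.two_lt_card_iff.1 h3
  have q1 : α • Q1 = Q1 := q1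
  have q2 : α • Q2 = Q2 := q2
  have q3 : α • Q3 = Q3 := q3
  have h12 : Q1 ≠ Q2 := fun h => h12 (Subtype.ext h)
  have h13 : Q1 ≠ Q3 := fun h => h13 (Subtype.ext h)
  have h23 : Q2 ≠ Q3 := fun h => h23 (Subtype.ext h)
  obtain ⟨s, hs⟩ := MulAction.exists_smul_eq S Q1 P0
  obtain ⟨b, hb⟩ := (B.pts hP (s • Q2)).resolve_left (fun h => h12 (smul_left_cancel s (hs.trans h.symm)))
  set u := B.n (-b) * s with hu
  have u1 : u • Q1 = P0 := by rw [hu, mul_smul, hs, B.n_st hP]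
  have u2 : u • Q2 = B.w • P0 := by
    rw [hu, mul_smul, hb, smul_smul, B.n_add, neg_add_cancel, B.n0, one_smul]
  obtain ⟨c, hc3⟩ := (B.pts hP (u • Q3)).resolve_left (fun h => h13 (smul_left_cancel u (u1.trans h.symm)))
  have hc0 : c ≠ 0 := by
    rintro rfl
    rw [B.n0, one_smul] at hc3
    exact h23 (smul_left_cancel u (u2.trans hc3.symm))
  set α' := MulAut.conj u * α * (MulAut.conj u)⁻¹ with hα'
  have key : ∀ Q : Sylow p S, α • Q = Q → α' • u • Q = u • Q := by
    intro Q hQ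
    rw [hα', Sylow.smul_def, smul_smul, inv_mul_cancel_right, mul_smul, hQ]
  have cen : ∀ v : S, ma (MulAut.conj v) ((wed S).eps i) = (wed S).eps i := by
    intro v
    rw [ma_conj, ← Wed.eps_comm, mul_assoc, ofG_mul_inv, mul_one]
  have : α' = 1 := by
    refine B.L1 h2F hP hψ hi (α := α') ?_ hlo ?_ ?_ ?_ hc0 ?_
    · rw [hα', ← map_inv, ma_mul, ma_mul, cen, hα, cen]
    · rw [hα', conj_pow, hαl]; group
    · have := key _ q1; rwa [u1] at this
    · have := key _ q2; rwa [u2] at this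
    · have := key _ q3; rwa [hc3] at this
  rw [hα', mul_inv_eq_one] at this
  exact mul_left_cancel (this.trans (mul_one _).symm)
end BN
theorem T7 {G H F : Type} [Group G] [Finite G] [Group H] (φ : G →* H) [Field F] [Fintype F] [DecidableEq F] {N : ℕ} [NeZero N]
    (B : BN φ.ker F N) (h2F : (2 : F) ≠ 0) {ψ : AddChar F ℂ} (hψ : ψ.IsPrimitive) {p k : ℕ} (hp : p.Prime)
    (hq : p ^ k = 2 * N + 1) (hk : k ≠ 0)
    (hcen : ∀ g : G, (∀ s ∈ φ.ker, g * s = s * g) → g = 1)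
    {l : ℕ} (hl : l.Prime) (hlG : l ∣ Nat.card G) (hlS : ¬ l ∣ Nat.card φ.ker) :
    ∃ d ∈ charDegrees G, l * (2 * N + 2) ∣ d := by
  haveI := Fact.mk hp
  haveI := Fact.mk hl
  have hU : ∃ P0 : Sylow p φ.ker, ∀ x, x ∈ P0 ↔ ∃ b, B.n b = x := by
    let U : Subgroup φ.ker :=
      { carrier := Set.range B.n
        one_mem' := ⟨0, B.n0⟩
        mul_mem' := by rintro _ _ ⟨b, rfl⟩ ⟨c, rfl⟩; exact ⟨b + c, (B.n_add b c).symm⟩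
        inv_mem' := by rintro _ ⟨b, rfl⟩; exact ⟨-b, (B.n_inv b).symm⟩ }
    have hinj : Function.Injective B.n := by
      intro b c h
      have h1 : B.n (b + -c) * B.t ^ 0 = 1 := by
        rw [← B.n_add, h, B.n_add, add_neg_cancel, B.n0, pow_zero, mul_one]
      have := (B.nt _ _ h1).1
      linear_combination this
    have hUc : Nat.card U = p ^ (Nat.card φ.ker).factorization p := by
      have h1 : Nat.card U = 2 * N + 1 := by
        rw [← B.cF]; exact Nat.card_range_of_injective hinj
      have hpq : p ∣ 2 * N + 1 := hq ▸ dvd_pow_self p hk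
      have hp1 : ¬ p ∣ N * (2 * N + 2) := by
        intro h
        rcases (Nat.Prime.dvd_mul hp).1 h with h | h
        · have h3 : p ∣ 2 * N + 1 - 2 * N := Nat.dvd_sub hpq (h.mul_left 2)
          rw [Nat.add_sub_cancel_left] at h3
          exact hp.one_lt.ne' (Nat.dvd_one.1 h3)
        · have h3 : p ∣ 2 * N + 2 - (2 * N + 1) := Nat.dvd_sub h hpq
          rw [show 2 * N + 2 - (2 * N + 1) = 1 by omega] at h3
          exact hp.one_lt.ne' (Nat.dvd_one.1 h3)
      have hN := B.N3
      rw [h1, B.cS, mul_assoc, Nat.factorization_mul (by omega) (by positivity), Finsupp.add_apply,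
        Nat.factorization_eq_zero_of_not_dvd hp1, add_zero, ← hq, hp.factorization_pow, Finsupp.single_eq_same]
    exact ⟨Sylow.ofCard U hUc, fun x => Iff.rfl⟩
  obtain ⟨P0, hP⟩ := hU
  obtain ⟨i, -, -, hi, hd⟩ := B.T8a hψ
  obtain ⟨d, hdm, hdd⟩ := T1 φ i
  refine ⟨d, hdm, dvd_trans ?_ hdd⟩
  rw [hd]
  refine mul_dvd_mul_right ?_ _
  by_contra hni
  have h1 : l ∣ Nat.card (StabG φ i) := by
    rw [← Subgroup.card_mul_index (StabG φ i)] at hlG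
    exact (hl.dvd_mul.1 hlG).resolve_right hni
  obtain ⟨⟨g, hg⟩, hgo⟩ := exists_prime_orderOf_dvd_card' l h1
  have hgo' : orderOf g = l := by rw [← hgo, ← Subgroup.orderOf_coe]
  rw [mem_StabG] at hg
  have hα : (MulAut.conjNormal g : MulAut φ.ker) = 1 := by
    refine B.L2 h2F hP hψ hi (α := MulAut.conjNormal g) hg hl hlS ?_
    rw [← map_pow, ← hgo', pow_orderOf_eq_one, map_one]
  have : g = 1 := by
    apply hcen
    intro s hs
    have h2 := congrArg (fun y : φ.ker => (y : G)) (DFunLike.congr_fun hα ⟨s, hs⟩)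
    simp only [MulAut.conjNormal_apply, MulAut.one_apply] at h2
    rwa [mul_inv_eq_iff_eq_mul] at h2
  rw [this, orderOf_one] at hgo'
  exact hl.one_lt.ne hgo'

section
variable {F : Type} [Field F]
lemma SL2_ext {A B : SL2 F} (h00 : A.1 0 0 = B.1 0 0) (h01 : A.1 0 1 = B.1 0 1) (h10 : A.1 1 0 = B.1 1 0)
    (h11 : A.1 1 1 = B.1 1 1) : A = B := by
  apply Subtype.ext; ext i j; fin_cases i <;> fin_cases j <;> assumption
def mn (b : F) : SL2 F := ⟨!![1, b; 0, 1], by simp [Matrix.det_fin_two]⟩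
def md0 (u : Fˣ) : SL2 F := ⟨!![(u : F), 0; 0, (u⁻¹ : Fˣ)], by simp [Matrix.det_fin_two]⟩
lemma md0_apply (u : Fˣ) : (md0 u).1 = !![(u : F), 0; 0, (u⁻¹ : Fˣ)] := rfl
def md : Fˣ →* SL2 F where
  toFun := md0
  map_one' := by apply SL2_ext <;> simp [md0_apply]
  map_mul' u v := by apply SL2_ext <;> simp [md0_apply, Matrix.mul_apply, mul_comm]
def mw : SL2 F := ⟨!![0, -1; 1, 0], by simp [Matrix.det_fin_two]⟩
def msg (A : SL2 F) : SL2 F := ⟨!![A.1 1 1, A.1 0 1; A.1 1 0, A.1 0 0], by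
  have := A.2
  rw [Matrix.det_fin_two] at this ⊢
  simp only [Matrix.of_apply, Matrix.cons_val]
  linear_combination this⟩
lemma mn_apply (b : F) : (mn b).1 = !![1, b; 0, 1] := rfl
lemma mw_apply : (mw : SL2 F).1 = !![0, -1; 1, 0] := rfl
lemma msg_apply (A : SL2 F) : (msg A).1 = !![A.1 1 1, A.1 0 1; A.1 1 0, A.1 0 0] := rfl
noncomputable def psg (x : PSL2 F) : PSL2 F := pj (msg (pj_surj x).choose)
lemma psg_pj (A : SL2 F) : psg (pj A) = pj (msg A) := by
  have h := (pj_surj (pj A)).choose_spec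
  unfold psg
  rw [pj_eq] at h ⊢
  rcases h with h | h
  · left; rw [h]
  · right; rw [h]; apply SL2_ext <;> simp [msg_apply]
lemma md_apply (u : Fˣ) : (md u).1 = !![(u : F), 0; 0, (u⁻¹ : Fˣ)] := rfl

lemma exists_BN [Fintype F] {N : ℕ} (hN : Fintype.card F = 2 * N + 1) (h2 : (2 : F) ≠ 0) (h3 : 3 ≤ N) :
    Nonempty (BN (PSL2 F) F N) := by
  classical
  obtain ⟨g, hg⟩ := IsCyclic.exists_generator (α := Fˣ)
  have ho : orderOf g = 2 * N := by
    rw [orderOf_eq_card_of_forall_mem_zpowers hg, Nat.card_eq_fintype_card, Fintype.card_units, hN]; rfl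
  have hgN : g ^ N = -1 := by
    have h1 : (g ^ N) ^ 2 = 1 := by rw [← pow_mul, mul_comm, ← ho, pow_orderOf_eq_one]
    have h1' : (((g ^ N : Fˣ) : F)) ^ 2 = 1 := by simpa using congrArg Units.val h1
    rcases (show ((g ^ N : Fˣ) : F) = 1 ∨ ((g ^ N : Fˣ) : F) = -1 from by simpa using h1') with h | h
    · exfalso
      have : g ^ N = 1 := Units.ext h
      have := Nat.le_of_dvd (by omega) (orderOf_dvd_of_pow_eq_one this)
      omega
    · apply Units.ext; simpa using h
  have hpow : ∀ u : Fˣ, ∃ m : ℕ, g ^ m = u := fun u =>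
    (Submonoid.mem_powers_iff _ _).1 ((mem_powers_iff_mem_zpowers).2 (hg u))
  have hw2 : (mw : SL2 F)⁻¹ = - mw := by
    rw [inv_eq_iff_mul_eq_one]; apply SL2_ext <;> simp [mw_apply, Matrix.mul_apply]
  refine ⟨{
    n := fun b => pj (mn b), t := pj (md g), w := pj mw, g := g, sg := psg,
    n_add := ?_, n0 := ?_, tN := ?_, tn := ?_, wt := ?_, bru := ?_, nt := ?_, opp := ?_, sg_mul := ?_,
    sg_n := ?_, sg_t := ?_, sg_w := ?_, gen := hg, cF := by rw [Nat.card_eq_fintype_card, hN], N3 := h3, cS := ?_ }⟩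
  · intro b c
    rw [← map_mul]; congr 1; apply SL2_ext <;> simp [mn_apply, Matrix.mul_apply, add_comm]
  · rw [← map_one pj]; congr 1; apply SL2_ext <;> simp [mn_apply]
  · rw [← map_pow, ← map_pow, hgN, ← map_one pj, pj_eq]
    right; apply SL2_ext <;> simp [md_apply]
  · intro b
    rw [← map_mul, ← map_mul]; congr 1; apply SL2_ext <;> simp [mn_apply, md_apply, Matrix.mul_apply]
    field_simp
  · rw [← map_mul, ← map_inv, ← map_inv, ← map_mul]; congr 1; apply SL2_ext <;> simp [mw_apply, md_apply, Matrix.mul_apply]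
  · intro s
    obtain ⟨A, rfl⟩ := pj_surj s
    have hd := A.2
    rw [Matrix.det_fin_two] at hd
    by_cases hc : A.1 1 0 = 0
    · rw [hc, mul_zero, sub_zero] at hd
      obtain ⟨m, hm⟩ := hpow ⟨A.1 0 0, A.1 1 1, hd, by rw [mul_comm]; exact hd⟩
      refine ⟨A.1 0 1 * A.1 0 0, m, Or.inl ?_⟩
      rw [← map_pow, ← map_pow, ← map_mul, hm]; congr 1; apply SL2_ext <;> simp [mn_apply, md_apply, Matrix.mul_apply, hc]
      linear_combination (- A.1 0 1) * hd
    · obtain ⟨m, hm⟩ := hpow (Units.mk0 _ hc)⁻¹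
      refine ⟨A.1 0 0 / A.1 1 0, m, Or.inr ⟨A.1 1 1 / A.1 1 0, ?_⟩⟩
      rw [← map_pow, ← map_pow, ← map_mul, ← map_mul, ← map_mul, hm]; congr 1
      apply SL2_ext <;> simp [mn_apply, mw_apply, md_apply, Matrix.mul_apply, hc]
      · field_simp
        linear_combination -hd
      · field_simp
  · intro b m h
    rw [← map_pow, ← map_pow, ← map_mul, ← map_one pj, pj_eq] at h
    generalize hu : g ^ m = u at h
    have hb : b = 0 := by
      rcases h with h | h <;>
      · have := congrArg (fun A : SL2 F => A.1 0 1) h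
        simpa [mn_apply, md_apply, Matrix.mul_apply] using this
    refine ⟨hb, ?_⟩
    have : (g ^ m) ^ 2 = 1 := by
      rw [hu]
      rcases h with h | h <;>
      · have := congrArg (fun A : SL2 F => A.1 0 0) h
        apply Units.ext
        simp [mn_apply, md_apply, Matrix.mul_apply] at this
        simp [this]
    rw [← pow_mul] at this
    have := orderOf_dvd_of_pow_eq_one this
    rw [ho, mul_comm m] at this
    exact Nat.dvd_of_mul_dvd_mul_left two_pos this
  · intro b c m h
    rw [← map_pow, ← map_pow, ← map_inv, ← map_mul, ← map_mul, ← map_mul, hw2, pj_eq] at h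
    generalize g ^ m = u at h
    rcases h with h | h <;>
    · have := congrArg (fun A : SL2 F => A.1 1 0) h
      simpa [mn_apply, mw_apply, md_apply, Matrix.mul_apply] using this
  · intro x y
    obtain ⟨A, rfl⟩ := pj_surj x
    obtain ⟨B, rfl⟩ := pj_surj y
    rw [← map_mul, psg_pj, psg_pj, psg_pj, ← map_mul]; congr 1
    apply SL2_ext <;> simp [msg_apply, Matrix.mul_apply] <;> ring
  · intro b
    rw [psg_pj]; congr 1
  · rw [psg_pj, ← map_inv, ← map_inv]; congr 1
  · rw [psg_pj]; congr 1
  · have := PSL2_card h2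
    rw [Nat.card_eq_fintype_card (α := F), hN] at this
    have e : (2 * N + 1) ^ 2 - 1 = 4 * N * (N + 1) := by rw [Nat.sub_eq_iff_eq_add] <;> nlinarith
    rw [e] at this
    nlinarith

def BN.map {S T : Type} [Group S] [Group T] {N : ℕ} (B : BN S F N) (e : S ≃* T) : BN T F N where
  n b := e (B.n b)
  t := e B.t
  w := e B.w
  g := B.g
  sg x := e (B.sg (e.symm x))
  n_add b c := by rw [← map_mul, B.n_add]
  n0 := by rw [B.n0, map_one]
  tN := by rw [← map_pow, B.tN, map_one]
  tn b := by rw [← map_mul, ← map_mul, B.tn]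
  wt := by rw [← map_inv, ← map_mul, ← map_mul, B.wt]
  bru s := by
    obtain ⟨b, m, h | ⟨c, h⟩⟩ := B.bru (e.symm s)
    · refine ⟨b, m, Or.inl ?_⟩
      rw [← map_pow, ← map_mul, ← h, e.apply_symm_apply]
    · refine ⟨b, m, Or.inr ⟨c, ?_⟩⟩
      rw [← map_pow, ← map_mul, ← map_mul, ← map_mul, ← h, e.apply_symm_apply]
  nt b m h := by
    apply B.nt; apply e.injective; rw [map_mul, map_pow, h, map_one]
  opp b c m h := by
    apply B.opp b c m; apply e.injective; simpa using h
  sg_mul x y := by rw [map_mul, B.sg_mul, map_mul]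
  sg_n b := by rw [e.symm_apply_apply, B.sg_n]
  sg_t := by rw [e.symm_apply_apply, B.sg_t, map_inv]
  sg_w := by rw [e.symm_apply_apply, B.sg_w]
  gen := B.gen
  cF := B.cF
  N3 := B.N3
  cS := by rw [← B.cS]; exact (Nat.card_congr e.toEquiv).symm
end

lemma two_r {n r : ℕ} (hn : n ≠ 0) (hr : r.Prime) (r2 : r ≠ 2) (hrn : r ∣ n) (h : ∀ l, l.Prime → l ∣ n → l = 2 ∨ l = r) :
    ∃ a b : ℕ, b ≠ 0 ∧ n = 2 ^ a * r ^ b := by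
  obtain ⟨a, m, hm, rfl⟩ := Nat.exists_eq_two_pow_mul_odd hn
  have hm0 : m ≠ 0 := by rintro rfl; simp at hn
  have h1 := Nat.eq_prime_pow_of_unique_prime_dvd (p := r) hm0 (fun {l} hl hlm => by
    rcases h l hl (hlm.mul_left _) with rfl | h
    · obtain ⟨x, rfl⟩ := hm; omega
    · exact h)
  refine ⟨a, _, ?_, congrArg _ h1⟩
  intro h0
  rw [h0, pow_zero] at h1
  rw [h1, mul_one] at hrn
  exact r2 ((Nat.prime_dvd_prime_iff_eq hr Nat.prime_two).1 (hr.dvd_of_dvd_pow hrn))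

lemma numerics {p k : ℕ} (hp : p.Prime) (ho : Odd p) (hk : 0 < k) (h1 : ((p ^ k - 1).primeFactors.erase 2).card = 1)
    (h2 : ((p ^ k + 1).primeFactors.erase 2).card = 1) :
    ∃ N r s a a' b c : ℕ, r.Prime ∧ s.Prime ∧ p ≠ 2 ∧ r ≠ 2 ∧ s ≠ 2 ∧ p ≠ r ∧ p ≠ s ∧ r ≠ s ∧ p ^ k = 2 * N + 1 ∧ 3 ≤ N ∧
      N = 2 ^ a * r ^ b ∧ N + 1 = 2 ^ a' * s ^ c ∧ b ≠ 0 ∧ c ≠ 0 := by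
  obtain ⟨N, hN⟩ : Odd (p ^ k) := ho.pow
  rw [hN] at h1 h2
  rw [Nat.add_sub_cancel] at h1
  obtain ⟨r, hr⟩ := Finset.card_eq_one.1 h1
  obtain ⟨s, hs⟩ := Finset.card_eq_one.1 h2
  have hN0 : N ≠ 0 := by rintro rfl; simp at hr
  have mr : ∀ l, l = r ↔ l ≠ 2 ∧ l.Prime ∧ l ∣ 2 * N := by
    intro l
    have := Finset.ext_iff.1 hr l
    rw [Finset.mem_erase, Nat.mem_primeFactors, Finset.mem_singleton] at this
    rw [← this]; simp [hN0]
  have ms : ∀ l, l = s ↔ l ≠ 2 ∧ l.Prime ∧ l ∣ 2 * (N + 1) := by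
    intro l
    have := Finset.ext_iff.1 hs l
    rw [Finset.mem_erase, Nat.mem_primeFactors, Finset.mem_singleton] at this
    rw [← this, show 2 * N + 1 + 1 = 2 * (N + 1) by ring]; simp
  obtain ⟨r2, pr, dr⟩ := (mr r).1 rfl
  obtain ⟨s2, ps, ds⟩ := (ms s).1 rfl
  have cop : ∀ l : ℕ, l.Prime → l ≠ 2 → Nat.Coprime l 2 := fun l hl h => (Nat.coprime_primes hl Nat.prime_two).2 h
  have dr' : r ∣ N := (cop r pr r2).dvd_of_dvd_mul_left dr
  have ds' : s ∣ N + 1 := (cop s ps s2).dvd_of_dvd_mul_left ds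
  obtain ⟨a, b, hb, e1⟩ := two_r hN0 pr r2 dr' (fun l hl hd => by
    by_cases h : l = 2
    · exact Or.inl h
    · exact Or.inr ((mr l).2 ⟨h, hl, hd.mul_left _⟩))
  obtain ⟨a', c, hc, e2⟩ := two_r (Nat.succ_ne_zero N) ps s2 ds' (fun l hl hd => by
    by_cases h : l = 2
    · exact Or.inl h
    · exact Or.inr ((ms l).2 ⟨h, hl, hd.mul_left _⟩))
  have pq : p ∣ 2 * N + 1 := hN ▸ dvd_pow_self p hk.ne'
  have one : ∀ l : ℕ, l.Prime → l ∣ 1 → False := fun l hl h => hl.one_lt.ne' (Nat.dvd_one.1 h)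
  refine ⟨N, r, s, a, a', b, c, pr, ps, ?_, r2, s2, ?_, ?_, ?_, hN, ?_, e1, e2, hb, hc⟩
  · rintro rfl; revert ho; decide
  · rintro rfl; exact one _ hp ((Nat.dvd_add_right dr).1 pq)
  · rintro rfl; exact one _ hp ((Nat.dvd_add_right pq).1 (by rw [show 2 * N + 1 + 1 = 2 * (N + 1) by ring]; exact ds))
  · rintro rfl; exact one _ pr ((Nat.dvd_add_right dr').1 ds')
  · have := Nat.le_of_dvd (by omega) dr'
    have := pr.two_le
    have : r ≠ 2 := r2
    omega
lemma mkNumD {p k N r s a a' b c : ℕ} (F : Type) [Field F] [Fintype F] [Fact p.Prime] [CharP F p] (hcF : Fintype.card F = p ^ k)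
    (hr : r.Prime) (hs : s.Prime) (p2 : p ≠ 2) (r2 : r ≠ 2) (s2 : s ≠ 2) (pr : p ≠ r) (ps : p ≠ s) (rs : r ≠ s)
    (hN : p ^ k = 2 * N + 1) (h3 : 3 ≤ N) (e1 : N = 2 ^ a * r ^ b) (e2 : N + 1 = 2 ^ a' * s ^ c) (hb : b ≠ 0) (hc : c ≠ 0)
    (h2 : (2 : F) ≠ 0) (B : BN (PSL2 F) F N) :
    NumD (PSL2 F) p k N r s b c a a' :=
  { hp := Fact.out, hr := hr, hs := hs, p2 := p2, r2 := r2, s2 := s2, pr := pr, ps := ps, rs := rs, q := hN, N3 := h3,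
    Nr := e1, Ns := e2, b0 := hb, c0 := hc, cardS := B.cS,
    cr := fun x hx => centr_r (p := p) (by omega) (hcF.trans hN) h2 hr (hr.odd_of_ne_two r2) pr.symm
      (e1 ▸ (dvd_pow_self r hb).mul_left _) x hx,
    cs := fun x hx => centr_s (p := p) (hcF.trans hN) h2 hs (hs.odd_of_ne_two s2) ps.symm x hx }

section
variable {G S : Type} [Group G] [Finite G] [Group S]
lemma K1 (R M : Subgroup G) [R.Normal] [M.Normal] (hRM : R ≤ M) (e : M.map (QuotientGroup.mk' R) ≃* S)
    {p k N r s b c a a' : ℕ} (h : NumD S p k N r s b c a a')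
    (npr : ∀ d ∈ charDegrees G, ¬ p * r ∣ d) (nps : ∀ d ∈ charDegrees G, ¬ p * s ∣ d)
    (nrs : ∀ d ∈ charDegrees G, ¬ r * s ∣ d) {n : ℕ} (hn : n ∈ charDegrees R) :
    ∃ d ∈ charDegrees G, 2 * n ∣ d := by
  let φ : M →* S := e.toMonoidHom.comp ((QuotientGroup.mk' R).subgroupMap M)
  have hφ : Function.Surjective φ := e.surjective.comp ((QuotientGroup.mk' R).subgroupMap_surjective M)
  have hk : φ.ker = R.subgroupOf M := by
    ext x
    rw [MonoidHom.mem_ker, Subgroup.mem_subgroupOf]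
    change e _ = 1 ↔ _
    rw [map_eq_one_iff e e.injective, ← Subtype.coe_inj]
    exact QuotientGroup.eq_one_iff (x : G)
  have hn' : n ∈ charDegrees φ.ker :=
    cd_equiv ((Subgroup.subgroupOfEquivOfLe hRM).symm.trans (MulEquiv.subgroupCongr hk.symm)) hn
  have tr : ∀ m : ℕ, (∀ d ∈ charDegrees G, ¬ m ∣ d) → ∀ d ∈ charDegrees M, ¬ m ∣ d := by
    intro m hm d hd hmd
    obtain ⟨d', h1, h2⟩ := T1N M hd
    exact hm d' h1 (hmd.trans h2)
  obtain ⟨d, hd, h2⟩ := T6 h φ hφ (tr _ npr) (tr _ nps) (tr _ nrs) hn'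
  obtain ⟨d', h3, h4⟩ := T1N M hd
  exact ⟨d', h3, h2.trans h4⟩

lemma K2 (R : Subgroup G) [R.Normal] (M' : Subgroup (G ⧸ R)) [M'.Normal] {F : Type} [Field F] [Fintype F] {N : ℕ}
    (B : BN M' F N) (h2F : (2 : F) ≠ 0) {p k : ℕ} (hp : p.Prime) (hq : p ^ k = 2 * N + 1) (hk : k ≠ 0)
    (hcen : Subgroup.centralizer (M' : Set (G ⧸ R)) = ⊥) {l : ℕ} (hl : l.Prime) (hlG : l ∣ R.index) (hlS : ¬ l ∣ Nat.card M') :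
    ∃ d ∈ charDegrees G, l * (2 * N + 2) ∣ d := by
  classical
  have h3 := B.N3
  have : NeZero N := ⟨by omega⟩
  have hk' := QuotientGroup.ker_mk' M'
  have := T7 (QuotientGroup.mk' M') (B.map (MulEquiv.subgroupCongr hk'.symm)) h2F
    (AddChar.FiniteField.primitiveChar_to_Complex_isPrimitive F) hp hq hk (fun g hg => by
      rw [hk'] at hg
      have : g ∈ Subgroup.centralizer (M' : Set (G ⧸ R)) := by
        rw [Subgroup.mem_centralizer_iff]
        intro s hs
        exact (hg s hs).symm
      rwa [hcen, Subgroup.mem_bot] at this) hl hlG (by rwa [hk'])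
  obtain ⟨d, hd, h⟩ := this
  exact ⟨d, cd_of_surj _ (QuotientGroup.mk'_surjective R) hd, h⟩

lemma K3 (R : Subgroup G) [R.Normal] (M' : Subgroup (G ⧸ R)) [M'.Normal] {F : Type} [Field F] [Fintype F] {N : ℕ}
    (B : BN M' F N) : (∃ d ∈ charDegrees G, 2 * N + 2 ∣ d) ∧ (∃ d ∈ charDegrees G, 2 * N ∣ d) := by
  classical
  have h3 := B.N3
  have : NeZero N := ⟨by omega⟩
  have hψ := AddChar.FiniteField.primitiveChar_to_Complex_isPrimitive F
  have up : ∀ i, ∃ d ∈ charDegrees G, (wed M').d i ∣ d := by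
    intro i
    obtain ⟨d', h1, h2⟩ := T1N M' (wed_mem i)
    exact ⟨d', cd_of_surj _ (QuotientGroup.mk'_surjective R) h1, h2⟩
  constructor
  · obtain ⟨i, -, -, -, h⟩ := B.T8a hψ
    rw [← h]; exact up i
  · obtain ⟨i, h⟩ := B.T8b hψ
    rw [← h]; exact up i
end
section
variable {V : Type} (Γ : SimpleGraph V) (P : V → Prop)
lemma tri_P (hodd : ∀ (v : V) (w : Γᶜ.Walk v v), w.IsCycle → Odd w.length → ∀ x ∈ w.support, P x)
    {x y z : V} (xy : x ≠ y) (xz : x ≠ z) (yz : y ≠ z) (h1 : ¬ Γ.Adj x y) (h2 : ¬ Γ.Adj y z) (h3 : ¬ Γ.Adj x z) : P x := by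
  have a1 : Γᶜ.Adj x y := ⟨xy, h1⟩
  have a2 : Γᶜ.Adj y z := ⟨yz, h2⟩
  have a3 : Γᶜ.Adj z x := ⟨xz.symm, fun h => h3 h.symm⟩
  refine hodd x (.cons a1 (.cons a2 (.cons a3 .nil))) ?_ (by simp [Nat.odd_iff]) x (by simp)
  rw [SimpleGraph.Walk.cons_isCycle_iff]
  simp [xy, xz, yz, xy.symm, xz.symm, yz.symm]
lemma pent_P (hodd : ∀ (v : V) (w : Γᶜ.Walk v v), w.IsCycle → Odd w.length → ∀ x ∈ w.support, P x)
    {x y z u v : V} (hn : [x, y, z, u, v].Nodup) (h1 : ¬ Γ.Adj x y) (h2 : ¬ Γ.Adj y z) (h3 : ¬ Γ.Adj z u) (h4 : ¬ Γ.Adj u v)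
    (h5 : ¬ Γ.Adj x v) : P x := by
  simp at hn
  obtain ⟨⟨n1, n2, n3, n4⟩, ⟨n5, n6, n7⟩, ⟨n8, n9⟩, n10⟩ := hn
  have a1 : Γᶜ.Adj x y := ⟨n1, h1⟩
  have a2 : Γᶜ.Adj y z := ⟨n5, h2⟩
  have a3 : Γᶜ.Adj z u := ⟨n8, h3⟩
  have a4 : Γᶜ.Adj u v := ⟨n10, h4⟩
  have a5 : Γᶜ.Adj v x := ⟨Ne.symm n4, fun h => h5 h.symm⟩
  refine hodd x (.cons a1 (.cons a2 (.cons a3 (.cons a4 (.cons a5 .nil))))) ?_ (by simp [Nat.odd_iff]) x (by simp)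
  rw [SimpleGraph.Walk.cons_isCycle_iff]
  simp [n1, n2, n3, n4, n5, n6, n7, n8, n9, n10, Ne.symm n1, Ne.symm n2, Ne.symm n3, Ne.symm n4]
lemma comb (hodd : ∀ (v : V) (w : Γᶜ.Walk v v), w.IsCycle → Odd w.length → ∀ x ∈ w.support, P x)
    (hf : Γ.CliqueFree 4) {z a b c r s : V} (hn : [a, b, c, r, s].Nodup) (hz : ∀ x ∈ [a, b, c, r, s], Γ.Adj z x)
    (ha : ¬ P a) (hb : ¬ P b) (hc : ¬ P c) : False := by
  classical
  have t1 : ∀ x ∈ [a, b, c, r, s], ∀ y ∈ [a, b, c, r, s], ∀ u ∈ [a, b, c, r, s], Γ.Adj x y → Γ.Adj y u → Γ.Adj x u → False := by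
    intro x hx y hy u hu h1 h2 h3
    refine hf (insert z {x, y, u}) (SimpleGraph.IsNClique.insert (SimpleGraph.is3Clique_triple_iff.2 ⟨h1, h3, h2⟩) ?_)
    intro v hv
    simp only [Finset.mem_insert, Finset.mem_singleton] at hv
    rcases hv with rfl | rfl | rfl
    · exact hz _ hx
    · exact hz _ hy
    · exact hz _ hu
  have t2 : ∀ x y u : V, ¬ P x → [x, y, u].Nodup → ¬ Γ.Adj x y → ¬ Γ.Adj y u → ¬ Γ.Adj x u → False := by
    intro x y u hx hn h1 h2 h3
    simp at hn
    exact hx (tri_P Γ P hodd hn.1.1 hn.1.2 hn.2 h1 h2 h3)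
  have t3 : ∀ y z u v : V, [a, y, z, u, v].Nodup → ¬ Γ.Adj a y → ¬ Γ.Adj y z → ¬ Γ.Adj z u → ¬ Γ.Adj u v → ¬ Γ.Adj a v → False :=
    fun y z u v hn h1 h2 h3 h4 h5 => ha (pent_P Γ P hodd hn h1 h2 h3 h4 h5)
  have hsym : ∀ x y, Γ.Adj x y ↔ Γ.Adj y x := fun x y => Γ.adj_comm x y
  have T1 := t1 a (by simp) b (by simp) c (by simp)
  have T2 := t1 a (by simp) b (by simp) r (by simp)
  have T3 := t1 a (by simp) b (by simp) s (by simp)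
  have T4 := t1 a (by simp) c (by simp) r (by simp)
  have T5 := t1 a (by simp) c (by simp) s (by simp)
  have T6 := t1 a (by simp) r (by simp) s (by simp)
  have T7 := t1 b (by simp) c (by simp) r (by simp)
  have T8 := t1 b (by simp) c (by simp) s (by simp)
  have T9 := t1 b (by simp) r (by simp) s (by simp)
  have T10 := t1 c (by simp) r (by simp) s (by simp)
  simp only [List.nodup_cons, List.mem_cons, List.not_mem_nil, or_false, not_or, not_false_eq_true, List.nodup_nil, and_true] at hn
  obtain ⟨⟨n1, n2, n3, n4⟩, ⟨n5, n6, n7⟩, ⟨n8, n9⟩, n10⟩ := hn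
  have U1 := t2 a b c ha (by simp [*])
  have U2 := t2 a b r ha (by simp [*])
  have U3 := t2 a b s ha (by simp [*])
  have U4 := t2 a c r ha (by simp [*])
  have U5 := t2 a c s ha (by simp [*])
  have U6 := t2 a r s ha (by simp [*])
  have U7 := t2 b c r hb (by simp [*])
  have U8 := t2 b c s hb (by simp [*])
  have U9 := t2 b r s hb (by simp [*])
  have U10 := t2 c r s hc (by simp [*])
  have m1 := Ne.symm n5
  have m2 := Ne.symm n6
  have m3 := Ne.symm n7
  have m4 := Ne.symm n8
  have m5 := Ne.symm n9
  have m6 := Ne.symm n10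
  have W1 := t3 b c r s (by simp [*])
  have W2 := t3 b c s r (by simp [*])
  have W3 := t3 b r c s (by simp [*])
  have W4 := t3 b r s c (by simp [*])
  have W5 := t3 b s c r (by simp [*])
  have W6 := t3 b s r c (by simp [*])
  have W7 := t3 c b r s (by simp [*])
  have W8 := t3 c b s r (by simp [*])
  have W9 := t3 c r b s (by simp [*])
  have W10 := t3 c s b r (by simp [*])
  have W11 := t3 r b c s (by simp [*])
  have W12 := t3 r c b s (by simp [*])
  simp only [hsym c b, hsym r b, hsym s b, hsym r c, hsym s c, hsym s r] at W1 W2 W3 W4 W5 W6 W7 W8 W9 W10 W11 W12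
  clear t1 t2 t3 hsym hz hodd hf
  generalize Γ.Adj a b = ab at *
  generalize Γ.Adj a c = ac at *
  generalize Γ.Adj a r = ar at *
  generalize Γ.Adj a s = as at *
  generalize Γ.Adj b c = bc at *
  generalize Γ.Adj b r = br at *
  generalize Γ.Adj b s = bs at *
  generalize Γ.Adj c r = cr at *
  generalize Γ.Adj c s = cs at *
  generalize Γ.Adj r s = rs at *
  clear ha hb hc n1 n2 n3 n4 n5 n6 n7 n8 n9 n10 m1 m2 m3 m4 m5 m6
  by_cases h1 : ab <;> by_cases h2 : ac <;> by_cases h3 : ar <;> by_cases h4 : as <;> simp only [h1, h2, h3, h4, not_true_eq_false, not_false_eq_true, true_implies, false_implies, implies_true] at * <;> by_cases h5 : br <;> by_cases h6 : bs <;> grind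
end

lemma ncol (Q : ℕ → ℕ → Prop) (hsym : ∀ x y, Q x y → Q y x) {p r s : ℕ} (p2 : p ≠ 2) (r2 : r ≠ 2) (s2 : s ≠ 2) (pr : p ≠ r)
    (ps : p ≠ s) (rs : r ≠ s) (q2s : Q 2 s) (q2r : Q 2 r)
    (hcol : ∀ f : ℕ → Bool, (∀ x y : ℕ, (x = 2 ∨ x = p ∨ x = r ∨ x = s) → (y = 2 ∨ y = p ∨ y = r ∨ y = s) → x ≠ y →
      f x = f y → Q x y) → False) : ¬ Q p r ∧ ¬ Q p s ∧ ¬ Q r s := by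
  have main : ∀ f : ℕ → Bool, (f 2 = f p → Q 2 p) → (f 2 = f r → Q 2 r) → (f 2 = f s → Q 2 s) → (f p = f r → Q p r) →
      (f p = f s → Q p s) → (f r = f s → Q r s) → False := by
    intro f g1 g2 g3 g4 g5 g6
    refine hcol f ?_
    intro x y hx hy hxy hf
    rcases hx with hx | hx | hx | hx <;> rcases hy with hy | hy | hy | hy <;> rw [hx, hy] at hf hxy ⊢ <;>
      first
      | exact absurd rfl hxy
      | exact g1 hf
      | exact g2 hf
      | exact g3 hf
      | exact g4 hf
      | exact g5 hf
      | exact g6 hf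
      | exact hsym _ _ (g1 hf.symm)
      | exact hsym _ _ (g2 hf.symm)
      | exact hsym _ _ (g3 hf.symm)
      | exact hsym _ _ (g4 hf.symm)
      | exact hsym _ _ (g5 hf.symm)
      | exact hsym _ _ (g6 hf.symm)
  refine ⟨fun h => ?_, fun h => ?_, fun h => ?_⟩
  · refine main (fun x => decide (x = 2 ∨ x = s)) ?_ ?_ ?_ ?_ ?_ ?_ <;> intro hf <;> first | assumption | (exfalso; simp [p2, r2, ps, rs] at hf)
  · refine main (fun x => decide (x = 2 ∨ x = r)) ?_ ?_ ?_ ?_ ?_ ?_ <;> intro hf <;> first | assumption | (exfalso; simp [p2, s2, pr, rs.symm] at hf)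
  · refine main (fun x => decide (x = p)) ?_ ?_ ?_ ?_ ?_ ?_ <;> intro hf <;> first | assumption | (exfalso; simp [p2.symm, pr.symm, ps.symm] at hf)

theorem stmt16 (G : Type) [Group G] [Finite G]
    (h4 : (charGraph G).CliqueFree 4)
    (h7 : Nat.card ↥(charPrimes G) = 7)
    (M : Subgroup G) (hM : M.Normal) (hRM : solvableRadical G < M)
    (p k : ℕ) (hp : Fact p.Prime) (hpodd : Odd p) (hk : 0 < k)
    (hS : Nonempty (↥(radicalQuotImage M) ≃* PSL2 (GaloisField p k)))
    (hcent : Subgroup.centralizer ((radicalQuotImage M) : Set (G ⧸ solvableRadical G)) = ⊥)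
    (hbip : ¬ (((charGraph G).induce
      {x : ↥(charPrimes G) | (x : ℕ) ∈ (Nat.card ↥(radicalQuotImage M)).primeFactors})ᶜ).Colorable 2)
    (hoddcyc : ∀ (v : ↥(charPrimes G)) (w : ((charGraph G)ᶜ).Walk v v),
      w.IsCycle → Odd w.length →
      ∀ x ∈ w.support, (x : ℕ) ∈ (Nat.card ↥(radicalQuotImage M)).primeFactors) :
    ¬ (((p ^ k - 1).primeFactors.erase 2).card = 1 ∧
       ((p ^ k + 1).primeFactors.erase 2).card = 1) := by
 
  classical
  rintro ⟨h1, h2⟩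
  obtain ⟨N, r, s, a, a', b, c, hr, hs, p2, r2, s2, pr, ps, rs, hN, h3, e1, e2, hb, hc⟩ := numerics hp.out hpodd hk h1 h2
  obtain ⟨e⟩ := hS
  letI : Fintype (GaloisField p k) := Fintype.ofFinite _
  have hcF : Fintype.card (GaloisField p k) = p ^ k := by
    rw [← Nat.card_eq_fintype_card]; exact GaloisField.card p k hk.ne'
  have h2F : (2 : GaloisField p k) ≠ 0 := by
    intro h
    have := (CharP.cast_eq_zero_iff (GaloisField p k) p 2).1 (by exact_mod_cast h)
    exact p2 ((Nat.prime_dvd_prime_iff_eq hp.out Nat.prime_two).1 this)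
  obtain ⟨B0⟩ := exists_BN (F := GaloisField p k) (hcF.trans hN) h2F h3
  have D := mkNumD (GaloisField p k) hcF hr hs p2 r2 s2 pr ps rs hN h3 e1 e2 hb hc h2F B0
  have B : BN (radicalQuotImage M) (GaloisField p k) N := B0.map e.symm
  haveI : (radicalQuotImage M).Normal := hM.map _ (QuotientGroup.mk'_surjective _)
  have hrN : r ∣ N := by rw [e1]; exact (dvd_pow_self r hb).mul_left _
  have hsN : s ∣ N + 1 := by rw [e2]; exact (dvd_pow_self s hc).mul_left _
  obtain ⟨⟨d1, hd1, hd1'⟩, ⟨d2, hd2, hd2'⟩⟩ := K3 (solvableRadical G) (radicalQuotImage M) B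
  have a2s : 2 * s ∣ d1 := (show 2 * s ∣ 2 * N + 2 from mul_dvd_mul_left 2 hsN).trans hd1'
  have a2r : 2 * r ∣ d2 := (mul_dvd_mul_left 2 hrN).trans hd2'
  have hcard : ∀ t : ℕ, t ∈ (Nat.card (radicalQuotImage M)).primeFactors → t = 2 ∨ t = p ∨ t = r ∨ t = s := by
    intro t ht
    rw [B.cS, Nat.mem_primeFactors] at ht
    obtain ⟨tp, td, -⟩ := ht
    have eq : ∀ {u v : ℕ}, u.Prime → t ∣ u ^ v → t = u := fun hu h =>
      (Nat.prime_dvd_prime_iff_eq tp hu).1 (tp.dvd_of_dvd_pow h)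
    rcases tp.dvd_mul.1 td with h | h
    · rcases tp.dvd_mul.1 h with h | h
      · rw [← hN] at h; exact Or.inr (Or.inl (eq hp.out h))
      · rw [e1] at h
        rcases tp.dvd_mul.1 h with h | h
        · exact Or.inl (eq Nat.prime_two h)
        · exact Or.inr (Or.inr (Or.inl (eq hr h)))
    · rw [show 2 * N + 2 = 2 ^ 1 * (N + 1) by ring] at h
      rcases tp.dvd_mul.1 h with h | h
      · exact Or.inl (eq Nat.prime_two h)
      · rw [e2] at h
        rcases tp.dvd_mul.1 h with h | h
        · exact Or.inl (eq Nat.prime_two h)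
        · exact Or.inr (Or.inr (Or.inr (eq hs h)))
  have hcol : ∀ f : ℕ → Bool, (∀ x y : ℕ, (x = 2 ∨ x = p ∨ x = r ∨ x = s) → (y = 2 ∨ y = p ∨ y = r ∨ y = s) → x ≠ y →
      f x = f y → ∃ d ∈ charDegrees G, x * y ∣ d) → False := by
    intro f hf
    apply hbip
    refine SimpleGraph.Coloring.colorable (α := Bool) (SimpleGraph.Coloring.mk (fun x => f x.1.1) ?_)
    intro x y hxy hfe
    have hne : (x.1.1 : ℕ) ≠ y.1.1 := fun h => hxy.1 (Subtype.ext (Subtype.ext h))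
    exact hxy.2 ⟨hne, hf _ _ (hcard _ x.2) (hcard _ y.2) hne hfe⟩
  obtain ⟨npr', nps', nrs'⟩ := ncol (fun x y => ∃ d ∈ charDegrees G, x * y ∣ d)
    (fun x y ⟨d, hd, h⟩ => ⟨d, hd, by rwa [mul_comm]⟩) p2 r2 s2 pr ps rs ⟨d1, hd1, a2s⟩ ⟨d2, hd2, a2r⟩ hcol
  have npr : ∀ d ∈ charDegrees G, ¬ p * r ∣ d := fun d hd h => npr' ⟨d, hd, h⟩
  have nps : ∀ d ∈ charDegrees G, ¬ p * s ∣ d := fun d hd h => nps' ⟨d, hd, h⟩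
  have nrs : ∀ d ∈ charDegrees G, ¬ r * s ∣ d := fun d hd h => nrs' ⟨d, hd, h⟩
  have key : ∀ t ∈ charPrimes G, t ∉ (Nat.card (radicalQuotImage M)).primeFactors → ∃ d ∈ charDegrees G, 2 * t ∣ d := by
    rintro t ⟨tp, d, hd, htd⟩ htS
    rcases T3 (solvableRadical G) tp hd htd with h | ⟨n, hn, htn⟩
    · have htS' : ¬ t ∣ Nat.card (radicalQuotImage M) := fun h =>
        htS (Nat.mem_primeFactors.2 ⟨tp, h, Nat.card_pos.ne'⟩)
      obtain ⟨d', hd', h'⟩ := K2 (solvableRadical G) (radicalQuotImage M) B h2F hp.out hN hk.ne' hcent tp h htS'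
      refine ⟨d', hd', Dvd.dvd.trans ?_ h'⟩
      rw [mul_comm]; exact mul_dvd_mul_left t ⟨N + 1, by ring⟩
    · obtain ⟨d', hd', h'⟩ := K1 (solvableRadical G) M hRM.le e D npr nps nrs hn
      exact ⟨d', hd', (mul_dvd_mul_left 2 htn).trans h'⟩
  have hfin : (charPrimes G).Finite := Nat.finite_of_card_ne_zero (by rw [h7]; decide)
  have hthree : 2 < (charPrimes G \ ((({2, p, r, s} : Finset ℕ)) : Set ℕ)).ncard := by
    have h := Set.le_ncard_diff ((({2, p, r, s} : Finset ℕ)) : Set ℕ) (charPrimes G) (Finset.finite_toSet _)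
    rw [Set.ncard_coe_finset] at h
    have h' : ({2, p, r, s} : Finset ℕ).card ≤ 4 := Finset.card_le_four
    have : (charPrimes G).ncard = 7 := h7
    omega
  obtain ⟨x, y, z, hx, hy, hz, xy, xz, yz⟩ := (Set.two_lt_ncard_iff (hfin.diff)).1 hthree
  have out : ∀ x, x ∈ charPrimes G \ ((({2, p, r, s} : Finset ℕ)) : Set ℕ) →
      x ∉ (Nat.card (radicalQuotImage M)).primeFactors ∧ x ≠ 2 ∧ x ≠ r ∧ x ≠ s := by
    rintro x ⟨-, hx⟩
    simp only [Finset.coe_insert, Finset.coe_singleton, Set.mem_insert_iff, Set.mem_singleton_iff, not_or] at hx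
    refine ⟨fun h => ?_, hx.1, hx.2.2.1, hx.2.2.2⟩
    have := hcard x h
    tauto
  obtain ⟨ox, x2, xr, xs⟩ := out x hx
  obtain ⟨oy, y2, yr, ys⟩ := out y hy
  obtain ⟨oz, z2, zr, zs⟩ := out z hz
  refine comb (charGraph G) (fun x => (x : ℕ) ∈ (Nat.card (radicalQuotImage M)).primeFactors) hoddcyc h4
    (z := ⟨2, Nat.prime_two, d1, hd1, (dvd_mul_right 2 s).trans a2s⟩) (a := ⟨x, hx.1⟩) (b := ⟨y, hy.1⟩) (c := ⟨z, hz.1⟩)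
    (r := ⟨r, hr, d2, hd2, (dvd_mul_left r 2).trans a2r⟩) (s := ⟨s, hs, d1, hd1, (dvd_mul_left s 2).trans a2s⟩)
    ?_ ?_ ox oy oz
  · simp only [List.nodup_cons, List.mem_cons, List.not_mem_nil, or_false, not_or, not_false_eq_true, List.nodup_nil, and_true, ← Subtype.coe_inj]
    exact ⟨⟨xy, xz, xr, xs⟩, ⟨yz, yr, ys⟩, ⟨zr, zs⟩, rs⟩
  · intro v hv
    simp only [List.mem_cons, List.not_mem_nil, or_false] at hv
    rcases hv with rfl | rfl | rfl | rfl | rfl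
    · exact ⟨x2.symm, key x hx.1 ox⟩
    · exact ⟨y2.symm, key y hy.1 oy⟩
    · exact ⟨z2.symm, key z hz.1 oz⟩
    · exact ⟨r2.symm, d2, hd2, a2r⟩
    · exact ⟨s2.symm, d1, hd1, a2s⟩
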